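/- arXiv:2403.16515 — 4 statements merged into one kernel-verified Lean document; each statement's English description precedes it below -/
import Mathlib

section
/- Let t₀ < T be reals and let V : (0, ∞) × [t₀, T] → ℝ be smooth, and suppose there is a compact interval [a, b] ⊂ (0, ∞) such that V(x, t) = 0 whenever x ∉ [a, b]. Let F : (0, ∞) × [t₀, T] → ℝ be continuous and suppose ∂_t V = ∂_x² V + ((1/4 − γ²)/x²) V + F on (0, ∞) × [t₀, T]. Then for every t ∈ (t₀, T] and every x > 0, V(x, t) = ∫₀^∞ B(x, w, t − t₀) V(w, t₀) dw + ∫_{t₀}^{t} ∫₀^∞ B(x, w, t − ξ) F(w, ξ) dw dξ. -/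
open Set MeasureTheory

open Filter Topology
open scoped ContDiff

/-- The entire series `∑ yᵐ / (m! Γ(m + ν + 1))`, so that `I_ν(x) = (x/2)^ν * besselSeries ν (x²/4)`. -/
noncomputable def besselSeries (ν y : ℝ) : ℝ :=
  ∑' m : ℕ, y ^ m / ((m.factorial : ℝ) * Real.Gamma ((m : ℝ) + ν + 1))

theorem gamma_le_gamma_add_nat {ν : ℝ} (hν : 0 ≤ ν) (m : ℕ) :
    Real.Gamma (ν + 1) ≤ Real.Gamma ((m : ℝ) + ν + 1) := by
  induction m with
  | zero => simp
  | succ m ih =>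
    have hpos : 0 < (m : ℝ) + ν + 1 := by positivity
    have h : ((m + 1 : ℕ) : ℝ) + ν + 1 = ((m : ℝ) + ν + 1) + 1 := by push_cast; ring
    rw [h, Real.Gamma_add_one hpos.ne']
    have hG := Real.Gamma_pos_of_pos hpos
    have hm : (0 : ℝ) ≤ m := m.cast_nonneg
    nlinarith

theorem gamma_add_nat_pos {ν : ℝ} (hν : 0 ≤ ν) (m : ℕ) :
    0 < Real.Gamma ((m : ℝ) + ν + 1) :=
  Real.Gamma_pos_of_pos (by positivity)

theorem norm_besselSeries_term_le {ν : ℝ} (hν : 0 ≤ ν) {y R : ℝ} (hy : |y| ≤ R) (m : ℕ) :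
    ‖y ^ m / ((m.factorial : ℝ) * Real.Gamma ((m : ℝ) + ν + 1))‖
      ≤ R ^ m / (m.factorial : ℝ) * (Real.Gamma (ν + 1))⁻¹ := by
  have hG : 0 < Real.Gamma (ν + 1) := Real.Gamma_pos_of_pos (by positivity)
  have hfac : (0 : ℝ) < m.factorial := by exact_mod_cast m.factorial_pos
  rw [norm_div, norm_pow, Real.norm_eq_abs, Real.norm_eq_abs,
    abs_of_pos (mul_pos hfac (gamma_add_nat_pos hν m)), ← div_eq_mul_inv, div_div]
  have hR : 0 ≤ R := (abs_nonneg y).trans hy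
  have := gamma_le_gamma_add_nat hν m
  gcongr

theorem summable_besselSeries {ν : ℝ} (hν : 0 ≤ ν) (y : ℝ) :
    Summable fun m : ℕ => y ^ m / ((m.factorial : ℝ) * Real.Gamma ((m : ℝ) + ν + 1)) :=
  .of_norm_bounded ((Real.summable_pow_div_factorial |y|).mul_right _)
    fun m => norm_besselSeries_term_le hν le_rfl m

theorem besselSeries_deriv_term (ν y : ℝ) (m : ℕ) :
    ((m + 1 : ℕ) : ℝ) * y ^ (m + 1 - 1) /
        (((m + 1).factorial : ℝ) * Real.Gamma (((m + 1 : ℕ) : ℝ) + ν + 1))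
      = y ^ m / ((m.factorial : ℝ) * Real.Gamma ((m : ℝ) + (ν + 1) + 1)) := by
  have h : ((m + 1 : ℕ) : ℝ) + ν + 1 = (m : ℝ) + (ν + 1) + 1 := by push_cast; ring
  have hm : ((m + 1 : ℕ) : ℝ) ≠ 0 := by positivity
  rw [h, Nat.factorial_succ, Nat.cast_mul, mul_assoc, mul_div_mul_left _ _ hm]
  simp

theorem hasDerivAt_besselSeries {ν : ℝ} (hν : 0 ≤ ν) (y : ℝ) :
    HasDerivAt (besselSeries ν) (besselSeries (ν + 1) y) y := by
  have hν' : 0 ≤ ν + 1 := by linarith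
  set R := |y| + 1 with hR
  have hR0 : 0 ≤ R := by positivity
  let u : ℕ → ℝ := fun m => (m : ℝ) * R ^ (m - 1) /
    ((m.factorial : ℝ) * Real.Gamma ((m : ℝ) + ν + 1))
  have hu : Summable u := by
    rw [← summable_nat_add_iff 1]
    exact (summable_besselSeries hν' R).congr fun m => (besselSeries_deriv_term ν R m).symm
  have hy : y ∈ Metric.ball (0 : ℝ) R := by simp [hR]
  have key := hasDerivAt_tsum_of_isPreconnected
    (g := fun (m : ℕ) z => z ^ m / ((m.factorial : ℝ) * Real.Gamma ((m : ℝ) + ν + 1)))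
    (g' := fun (m : ℕ) z => (m : ℝ) * z ^ (m - 1) /
      ((m.factorial : ℝ) * Real.Gamma ((m : ℝ) + ν + 1)))
    hu Metric.isOpen_ball (convex_ball (0 : ℝ) R).isPreconnected
    (fun m z _ => (hasDerivAt_pow m z).div_const _)
    (fun m z hz => by
      have hz' : |z| ≤ R := by simpa using (Metric.mem_ball.1 hz).le
      have := gamma_add_nat_pos hν m
      rw [norm_div, norm_mul, norm_pow, norm_mul, Real.norm_natCast, Real.norm_natCast,
        Real.norm_of_nonneg this.le, Real.norm_eq_abs]
      simp only [u]
      gcongr) hy (summable_besselSeries hν y) hy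
  have hsum : Summable fun m : ℕ => (m : ℝ) * y ^ (m - 1) /
      ((m.factorial : ℝ) * Real.Gamma ((m : ℝ) + ν + 1)) := by
    rw [← summable_nat_add_iff 1]
    exact (summable_besselSeries hν' y).congr fun m => (besselSeries_deriv_term ν y m).symm
  have hval : ∑' m : ℕ, (m : ℝ) * y ^ (m - 1) /
      ((m.factorial : ℝ) * Real.Gamma ((m : ℝ) + ν + 1)) = besselSeries (ν + 1) y := by
    rw [hsum.tsum_eq_zero_add, besselSeries]
    simp only [besselSeries_deriv_term]
    simp
  rw [hval] at key
  exact key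

theorem contDiff_besselSeries {ν : ℝ} (hν : 0 ≤ ν) : ContDiff ℝ ∞ (besselSeries ν) := by
  rw [contDiff_infty]
  intro k
  induction k generalizing ν with
  | zero =>
    exact contDiff_zero.2 (continuous_iff_continuousAt.2 fun y =>
      (hasDerivAt_besselSeries hν y).continuousAt)
  | succ k ih =>
    rw [Nat.cast_succ, contDiff_succ_iff_deriv]
    refine ⟨fun y => (hasDerivAt_besselSeries hν y).differentiableAt, by simp, ?_⟩
    have : deriv (besselSeries ν) = besselSeries (ν + 1) :=
      funext fun y => (hasDerivAt_besselSeries hν y).deriv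
    rw [this]
    exact ih (by linarith)

/-- The Bessel differential equation in terms of the series. -/
theorem besselSeries_recurrence {ν : ℝ} (hν : 0 ≤ ν) (y : ℝ) :
    besselSeries ν y = (ν + 1) * besselSeries (ν + 1) y + y * besselSeries (ν + 1 + 1) y := by
  have hν' : 0 ≤ ν + 1 := by linarith
  have hν'' : 0 ≤ ν + 1 + 1 := by linarith
  have h1 := (summable_besselSeries hν' y).mul_left (ν + 1)
  have h2 := summable_besselSeries hν y
  simp only [besselSeries]
  rw [h2.tsum_eq_zero_add, ← tsum_mul_left, h1.tsum_eq_zero_add, ← tsum_mul_left, add_assoc ((ν + 1) * _),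
    ← Summable.tsum_add ((summable_nat_add_iff 1).2 h1)
      ((summable_besselSeries hν'' y).mul_left y)]
  congr 1
  · have hG := Real.Gamma_add_one (s := ν + 1) (by positivity)
    have := Real.Gamma_pos_of_pos (s := ν + 1) (by positivity)
    simp only [Nat.cast_zero, zero_add, hG]
    field_simp
  · refine tsum_congr fun m => ?_
    have hG := Real.Gamma_add_one (s := (m : ℝ) + ν + 2) (by positivity)
    have hpos := Real.Gamma_pos_of_pos (s := (m : ℝ) + ν + 2) (by positivity)
    have e1 : ((m + 1 : ℕ) : ℝ) + ν + 1 = (m : ℝ) + ν + 2 := by push_cast; ring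
    have e2 : ((m + 1 : ℕ) : ℝ) + (ν + 1) + 1 = (m : ℝ) + ν + 2 + 1 := by push_cast; ring
    have e3 : (m : ℝ) + (ν + 1 + 1) + 1 = (m : ℝ) + ν + 2 + 1 := by ring
    have hne : (m : ℝ) + ν + 2 ≠ 0 := by positivity
    rw [e1, e2, e3, hG, Nat.factorial_succ]
    push_cast
    field_simp
    ring

theorem besselSeries_nonneg {ν : ℝ} (hν : 0 ≤ ν) {y : ℝ} (hy : 0 ≤ y) : 0 ≤ besselSeries ν y :=
  tsum_nonneg fun m => div_nonneg (pow_nonneg hy m)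
    (mul_nonneg (Nat.cast_nonneg _) (gamma_add_nat_pos hν m).le)

/-- The Bessel heat kernel of index `ν`, with the index `μ` of the series left free. -/
noncomputable def besselHeat (ν μ x w s : ℝ) : ℝ :=
  (x * w) ^ (ν + 1 / 2) * (2 * (4 * s) ^ (-(ν + 1))) * Real.exp (-(x ^ 2 + w ^ 2) / (4 * s)) *
    besselSeries μ ((x * w / (4 * s)) ^ 2)

theorem besselHeat_eq {γ x w s : ℝ} (hx : 0 < x) (hw : 0 < w) (hs : 0 < s) :
    Real.sqrt (x * w) / (2 * s) * (∑' m : ℕ, (x * w / (2 * s) / 2) ^ (2 * (m : ℝ) + γ) /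
        ((m.factorial : ℝ) * Real.Gamma ((m : ℝ) + γ + 1))) *
      Real.exp (-(x ^ 2 + w ^ 2) / (4 * s)) = besselHeat γ γ x w s := by
  have hxw : 0 < x * w := mul_pos hx hw
  have hs4 : 0 < 4 * s := by positivity
  have hq : x * w / (2 * s) / 2 = x * w / (4 * s) := by field_simp; norm_num
  have hterm : ∀ m : ℕ, (x * w / (2 * s) / 2) ^ (2 * (m : ℝ) + γ) /
      ((m.factorial : ℝ) * Real.Gamma ((m : ℝ) + γ + 1)) =
      (x * w / (4 * s)) ^ γ * (((x * w / (4 * s)) ^ 2) ^ m /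
        ((m.factorial : ℝ) * Real.Gamma ((m : ℝ) + γ + 1))) := by
    intro m
    have hpos : 0 < x * w / (4 * s) := by positivity
    rw [hq, Real.rpow_add hpos, ← pow_mul, ← Real.rpow_natCast _ (2 * m)]
    push_cast
    ring
  simp only [hterm]
  rw [tsum_mul_left, besselHeat, besselSeries, Real.sqrt_eq_rpow, Real.rpow_add hxw,
    Real.div_rpow hxw.le hs4.le, Real.rpow_neg hs4.le,
    Real.rpow_add_one hs4.ne']
  field_simp
  ring

theorem hasDerivAt_besselHeat_space {ν μ x w s : ℝ} (hμ : 0 ≤ μ) (hx : 0 < x) (hw : 0 < w) :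
    HasDerivAt (fun w' => besselHeat ν μ x w' s)
      (besselHeat ν μ x w s * ((ν + 1 / 2) / w - w / (2 * s)) +
        besselHeat ν (μ + 1) x w s * (x ^ 2 * w / (8 * s ^ 2))) w := by
  have hxw : 0 < x * w := mul_pos hx hw
  have h1 : HasDerivAt (fun w' : ℝ => x * w') x w := by simpa using (hasDerivAt_id w).const_mul x
  have hp := h1.rpow_const (p := ν + 1 / 2) (Or.inl hxw.ne')
  have h2 : HasDerivAt (fun w' : ℝ => -(x ^ 2 + w' ^ 2) / (4 * s)) (-(2 * w) / (4 * s)) w := by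
    simpa using (((hasDerivAt_pow 2 w).const_add (x ^ 2)).neg.div_const (4 * s))
  have h3 := (h1.div_const (4 * s)).pow 2
  have h4 := (hasDerivAt_besselSeries hμ ((x * w / (4 * s)) ^ 2)).comp w h3
  refine (((hp.mul_const (2 * (4 * s) ^ (-(ν + 1)))).mul h2.exp).mul h4).congr_deriv ?_
  simp only [besselHeat, Function.comp_apply, Pi.mul_apply, Pi.pow_apply, Real.rpow_sub_one hxw.ne']
  field_simp
  ring

theorem hasDerivAt_besselHeat_time {ν μ x w s : ℝ} (hμ : 0 ≤ μ) (hs : 0 < s) :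
    HasDerivAt (fun s' => besselHeat ν μ x w s')
      (besselHeat ν μ x w s * (-(ν + 1) / s + (x ^ 2 + w ^ 2) / (4 * s ^ 2)) -
        besselHeat ν (μ + 1) x w s * (x ^ 2 * w ^ 2 / (8 * s ^ 3))) s := by
  have hs4 : 0 < 4 * s := by positivity
  have h1 : HasDerivAt (fun s' : ℝ => 4 * s') 4 s := by simpa using (hasDerivAt_id s).const_mul 4
  have hp := h1.rpow_const (p := -(ν + 1)) (Or.inl hs4.ne')
  have h2 := (hasDerivAt_const s (-(x ^ 2 + w ^ 2))).div h1 hs4.ne'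
  have h3 := ((hasDerivAt_const s (x * w)).div h1 hs4.ne').pow 2
  have h4 := (hasDerivAt_besselSeries hμ ((x * w / (4 * s)) ^ 2)).comp s h3
  refine ((((hp.const_mul 2).const_mul ((x * w) ^ (ν + 1 / 2))).mul h2.exp).mul h4).congr_deriv ?_
  simp only [besselHeat, Function.comp_apply, Pi.mul_apply, Pi.pow_apply, Pi.div_apply,
    Nat.add_one_sub_one, pow_one, Real.rpow_sub_one hs4.ne']
  generalize besselSeries μ _ = J
  generalize besselSeries (μ + 1) _ = J₁
  field_simp
  ring

theorem besselHeat_recurrence {ν x w s : ℝ} (hν : 0 ≤ ν) :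
    besselHeat ν ν x w s = (ν + 1) * besselHeat ν (ν + 1) x w s +
      (x * w / (4 * s)) ^ 2 * besselHeat ν (ν + 1 + 1) x w s := by
  simp only [besselHeat]
  rw [besselSeries_recurrence hν]
  ring

/-- The Bessel heat kernel solves `∂ₛ u = ∂_w² u + ((1/4 - ν²)/w²) u`. -/
theorem deriv_besselHeat_time {ν x w s : ℝ} (hν : 0 ≤ ν) (hx : 0 < x) (hw : 0 < w) (hs : 0 < s) :
    deriv (fun s' => besselHeat ν ν x w s') s =
      deriv (deriv fun w' => besselHeat ν ν x w' s) w +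
        ((1 / 4 - ν ^ 2) / w ^ 2) * besselHeat ν ν x w s := by
  have hν' : 0 ≤ ν + 1 := by linarith
  have hev : deriv (fun w' => besselHeat ν ν x w' s) =ᶠ[𝓝 w] fun w' =>
      besselHeat ν ν x w' s * ((ν + 1 / 2) / w' - w' / (2 * s)) +
        besselHeat ν (ν + 1) x w' s * (x ^ 2 * w' / (8 * s ^ 2)) := by
    filter_upwards [Ioi_mem_nhds hw] with w' hw'
    exact (hasDerivAt_besselHeat_space hν hx hw').deriv
  have h1 : HasDerivAt (fun w' : ℝ => (ν + 1 / 2) / w' - w' / (2 * s))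
      (-(ν + 1 / 2) / w ^ 2 - 1 / (2 * s)) w := by
    refine (((hasDerivAt_const w (ν + 1 / 2)).div (hasDerivAt_id' w) hw.ne').sub
      ((hasDerivAt_id' w).div_const (2 * s))).congr_deriv ?_
    ring
  have h2 : HasDerivAt (fun w' : ℝ => x ^ 2 * w' / (8 * s ^ 2)) (x ^ 2 / (8 * s ^ 2)) w := by
    simpa using ((hasDerivAt_id w).const_mul (x ^ 2)).div_const (8 * s ^ 2)
  have h3 := ((hasDerivAt_besselHeat_space (s := s) (ν := ν) hν hx hw).mul h1).add
    ((hasDerivAt_besselHeat_space (s := s) (ν := ν) hν' hx hw).mul h2)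
  rw [hev.deriv_eq, (hasDerivAt_besselHeat_time hν hs).deriv]
  refine Eq.trans ?_ (congrArg (· + _) h3.deriv.symm)
  rw [besselHeat_recurrence hν]
  field_simp
  ring

theorem contDiffOn_besselHeat {ν x t : ℝ} (hν : 0 ≤ ν) (hx : 0 < x) :
    ContDiffOn ℝ ∞ (fun p : ℝ × ℝ => besselHeat ν ν x p.1 (t - p.2)) (Ioi 0 ×ˢ Iio t) := by
  have hw : ∀ p ∈ (Ioi (0 : ℝ) ×ˢ Iio t), x * p.1 ≠ 0 := fun p hp => (mul_pos hx hp.1).ne'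
  have hs : ∀ p ∈ (Ioi (0 : ℝ) ×ˢ Iio t), 4 * (t - p.2) ≠ 0 := fun p hp => by
    have : p.2 < t := hp.2
    have : 0 < t - p.2 := by linarith
    positivity
  have c1 : ContDiffOn ℝ ∞ (fun p : ℝ × ℝ => x * p.1) (Ioi 0 ×ˢ Iio t) := by fun_prop
  have c2 : ContDiffOn ℝ ∞ (fun p : ℝ × ℝ => 4 * (t - p.2)) (Ioi 0 ×ˢ Iio t) := by fun_prop
  have c3 : ContDiffOn ℝ ∞ (fun p : ℝ × ℝ => -(x ^ 2 + p.1 ^ 2)) (Ioi 0 ×ˢ Iio t) := by fun_prop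
  exact (((c1.rpow_const_of_ne hw).mul (contDiffOn_const.mul (c2.rpow_const_of_ne hs))).mul
    (c3.div c2 hs).exp).mul ((contDiff_besselSeries hν).comp_contDiffOn ((c1.div c2 hs).pow 2))

theorem besselHeat_nonneg {ν x w s : ℝ} (hν : 0 ≤ ν) (hx : 0 < x) (hw : 0 < w) (hs : 0 < s) :
    0 ≤ besselHeat ν ν x w s := by
  have := besselSeries_nonneg hν (sq_nonneg (x * w / (4 * s)))
  rw [besselHeat]
  positivity

theorem integral_besselHeat_mul_pow {ν x s S : ℝ} (hν : 0 ≤ ν) (hx : 0 < x) (hs : 0 < s) (k : ℕ)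
    (hS : HasSum (fun m : ℕ => (x ^ 2 / (4 * s)) ^ m / (m.factorial : ℝ) *
      (Real.Gamma ((m : ℝ) + ν + 1 + k) / Real.Gamma ((m : ℝ) + ν + 1))) S) :
    ∫ w in Ioi (0 : ℝ), besselHeat ν ν x w s * w ^ (ν + 1 / 2) * (w ^ 2) ^ k =
      x ^ (ν + 1 / 2) * (4 * s) ^ k * Real.exp (-(x ^ 2 / (4 * s))) * S := by
  have hs4 : 0 < 4 * s := by positivity
  set b : ℝ := (4 * s)⁻¹ with hb
  have hb0 : 0 < b := inv_pos.2 hs4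
  let q : ℕ → ℝ := fun m => 2 * ν + 1 + 2 * m + 2 * k
  have hq : ∀ m, -1 < q m := fun m => by
    have : 0 ≤ 2 * ν + 1 + 2 * (m : ℝ) + 2 * k := by positivity
    simp only [q]
    linarith
  let c : ℕ → ℝ := fun m => x ^ (ν + 1 / 2) * (2 * (4 * s) ^ (-(ν + 1))) *
    Real.exp (-(x ^ 2 / (4 * s))) *
    (((x / (4 * s)) ^ 2) ^ m / ((m.factorial : ℝ) * Real.Gamma ((m : ℝ) + ν + 1)))
  have hc : ∀ m, 0 ≤ c m := fun m => by
    have := gamma_add_nat_pos hν m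
    positivity
  let f : ℕ → ℝ → ℝ := fun m w => c m * (w ^ q m * Real.exp (-b * w ^ (2 : ℝ)))
  have hf_int : ∀ m, Integrable (f m) (volume.restrict (Ioi 0)) := fun m =>
    (integrableOn_rpow_mul_exp_neg_mul_rpow (hq m) two_pos hb0).const_mul (c m)
  have hf_val : ∀ m, ∫ w in Ioi (0 : ℝ), f m w =
      x ^ (ν + 1 / 2) * (4 * s) ^ k * Real.exp (-(x ^ 2 / (4 * s))) *
        ((x ^ 2 / (4 * s)) ^ m / (m.factorial : ℝ) *
          (Real.Gamma ((m : ℝ) + ν + 1 + k) / Real.Gamma ((m : ℝ) + ν + 1))) := by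
    intro m
    have hG := gamma_add_nat_pos hν m
    have e1 : (q m + 1) / 2 = (m : ℝ) + ν + 1 + k := by simp only [q]; ring
    have e2 : -(q m + 1) / 2 = -((ν + 1) + m + k) := by simp only [q]; ring
    have e3 : b ^ (-((ν + 1) + m + k)) = (4 * s) ^ (ν + 1) * (4 * s) ^ m * (4 * s) ^ k := by
      rw [hb, Real.inv_rpow hs4.le, Real.rpow_neg hs4.le, inv_inv, Real.rpow_add hs4,
        Real.rpow_add hs4, Real.rpow_natCast, Real.rpow_natCast]
    simp only [f]
    rw [integral_const_mul, integral_rpow_mul_exp_neg_mul_rpow two_pos (hq m) hb0, e1, e2, e3]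
    simp only [c]
    rw [Real.rpow_neg hs4.le]
    have h4 : (4 * s) ^ (ν + 1) ≠ 0 := (Real.rpow_pos_of_pos hs4 _).ne'
    have e4 : ((x / (4 * s)) ^ 2) ^ m * (4 * s) ^ m = (x ^ 2 / (4 * s)) ^ m := by
      rw [← mul_pow]
      congr 1
      field_simp
    rw [← e4]
    generalize (4 * s) ^ (ν + 1) = A at *
    field_simp
  have hf_nonneg : ∀ m, ∀ w ∈ Ioi (0 : ℝ), 0 ≤ f m w := fun m w hw =>
    mul_nonneg (hc m) (mul_nonneg (Real.rpow_nonneg (le_of_lt hw) _) (Real.exp_nonneg _))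
  have hf_norm : ∀ m, ∫ w in Ioi (0 : ℝ), ‖f m w‖ = ∫ w in Ioi (0 : ℝ), f m w := fun m =>
    setIntegral_congr_fun measurableSet_Ioi fun w hw => Real.norm_of_nonneg (hf_nonneg m w hw)
  have hS' := hS.mul_left (x ^ (ν + 1 / 2) * (4 * s) ^ k * Real.exp (-(x ^ 2 / (4 * s))))
  have hsum : Summable fun m => ∫ w in Ioi (0 : ℝ), ‖f m w‖ := by
    simp only [hf_norm, hf_val]
    exact hS'.summable
  have key := hasSum_integral_of_summable_integral_norm hf_int hsum
  simp only [hf_val] at key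
  rw [← key.unique hS']
  refine setIntegral_congr_fun measurableSet_Ioi fun w hw => ?_
  have hw : 0 < w := hw
  have hterm : ∀ m, f m w = (x ^ (ν + 1 / 2) * (2 * (4 * s) ^ (-(ν + 1))) *
      Real.exp (-(x ^ 2 + w ^ 2) / (4 * s)) * w ^ (ν + 1 / 2) * w ^ (ν + 1 / 2) * (w ^ 2) ^ k) *
      (((x * w / (4 * s)) ^ 2) ^ m / ((m.factorial : ℝ) * Real.Gamma ((m : ℝ) + ν + 1))) := by
    intro m
    have e1 : w ^ q m = w ^ (ν + 1 / 2) * w ^ (ν + 1 / 2) * (w ^ 2) ^ m * (w ^ 2) ^ k := by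
      rw [← pow_mul, ← pow_mul, ← Real.rpow_natCast, ← Real.rpow_natCast, ← Real.rpow_add hw,
        ← Real.rpow_add hw, ← Real.rpow_add hw]
      congr 1
      simp only [q]
      push_cast
      ring
    have e2 : Real.exp (-(x ^ 2 + w ^ 2) / (4 * s)) =
        Real.exp (-(x ^ 2 / (4 * s))) * Real.exp (-b * w ^ (2 : ℝ)) := by
      rw [← Real.exp_add, Real.rpow_two, hb]
      congr 1
      ring
    have e3 : ((x * w / (4 * s)) ^ 2) ^ m = ((x / (4 * s)) ^ 2) ^ m * (w ^ 2) ^ m := by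
      rw [← mul_pow]
      ring
    simp only [f, c]
    rw [e1, e2, e3]
    ring
  simp only [hterm]
  rw [tsum_mul_left]
  simp only [besselHeat, besselSeries]
  rw [Real.mul_rpow hx.le hw.le]
  ring

theorem hasSum_pow_div_factorial (y : ℝ) :
    HasSum (fun m : ℕ => y ^ m / (m.factorial : ℝ)) (Real.exp y) := by
  rw [Real.exp_eq_exp_ℝ]
  exact NormedSpace.expSeries_div_hasSum_exp y

theorem hasSum_pow_div_factorial_mul {y S : ℝ} {g : ℕ → ℝ}
    (h : HasSum (fun m : ℕ => y ^ m / (m.factorial : ℝ) * g (m + 1)) S) :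
    HasSum (fun m : ℕ => y ^ m / (m.factorial : ℝ) * (m * g m)) (y * S) := by
  rw [← hasSum_nat_add_iff' 1]
  simp only [Finset.range_one, Finset.sum_singleton, Nat.cast_zero, zero_mul, mul_zero, sub_zero]
  refine (h.mul_left y).congr_fun ?_
  intro m
  rw [Nat.factorial_succ]
  push_cast
  field_simp
  ring

theorem integral_besselHeat_mul {ν x s : ℝ} (hν : 0 ≤ ν) (hx : 0 < x) (hs : 0 < s) :
    ∫ w in Ioi (0 : ℝ), besselHeat ν ν x w s * w ^ (ν + 1 / 2) = x ^ (ν + 1 / 2) := by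
  have h := integral_besselHeat_mul_pow hν hx hs 0 (S := Real.exp (x ^ 2 / (4 * s))) <| by
    refine (hasSum_pow_div_factorial _).congr_fun fun m => ?_
    simp [div_self (gamma_add_nat_pos hν m).ne']
  simpa [mul_assoc, ← Real.exp_add] using h

theorem integral_besselHeat_mul_sq {ν x s : ℝ} (hν : 0 ≤ ν) (hx : 0 < x) (hs : 0 < s) :
    ∫ w in Ioi (0 : ℝ), besselHeat ν ν x w s * w ^ (ν + 1 / 2) * w ^ 2 =
      x ^ (ν + 1 / 2) * (x ^ 2 + 4 * s * (ν + 1)) := by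
  set y := x ^ 2 / (4 * s) with hy
  have h1 : HasSum (fun m : ℕ => y ^ m / (m.factorial : ℝ) * (m * (1 : ℝ))) (y * Real.exp y) :=
    hasSum_pow_div_factorial_mul (g := fun _ => 1) (by simpa using hasSum_pow_div_factorial y)
  have h := integral_besselHeat_mul_pow hν hx hs 1 (S := (y + (ν + 1)) * Real.exp y) <| by
    rw [add_mul]
    refine (h1.add ((hasSum_pow_div_factorial y).mul_left (ν + 1))).congr_fun fun m => ?_
    have := gamma_add_nat_pos hν m
    rw [Nat.cast_one, Real.Gamma_add_one (by positivity)]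
    field_simp
    ring
  simp only [pow_one] at h
  rw [h, ← hy, Real.exp_neg, hy]
  field_simp

theorem integral_besselHeat_mul_sq_sq {ν x s : ℝ} (hν : 0 ≤ ν) (hx : 0 < x) (hs : 0 < s) :
    ∫ w in Ioi (0 : ℝ), besselHeat ν ν x w s * w ^ (ν + 1 / 2) * (w ^ 2) ^ 2 =
      x ^ (ν + 1 / 2) * (x ^ 4 + (2 * ν + 4) * (4 * s) * x ^ 2 +
        16 * s ^ 2 * ((ν + 1) * (ν + 2))) := by
  set y := x ^ 2 / (4 * s) with hy
  have h0 := hasSum_pow_div_factorial y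
  have h1 : HasSum (fun m : ℕ => y ^ m / (m.factorial : ℝ) * (m * (1 : ℝ))) (y * Real.exp y) :=
    hasSum_pow_div_factorial_mul (g := fun _ => 1) (by simpa using h0)
  have h2 : HasSum (fun m : ℕ => y ^ m / (m.factorial : ℝ) * (m * ((m : ℝ) - 1)))
      (y * (y * Real.exp y)) :=
    hasSum_pow_div_factorial_mul (g := fun m => (m : ℝ) - 1) (by simpa using h1)
  have h := integral_besselHeat_mul_pow hν hx hs 2
    (S := (y ^ 2 + (2 * ν + 4) * y + (ν + 1) * (ν + 2)) * Real.exp y) <| by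
    have e : (y ^ 2 + (2 * ν + 4) * y + (ν + 1) * (ν + 2)) * Real.exp y =
      y * (y * Real.exp y) + (2 * ν + 4) * (y * Real.exp y) +
        (ν + 1) * (ν + 2) * Real.exp y := by ring
    rw [e]
    refine ((h2.add (h1.mul_left (2 * ν + 4))).add
      (h0.mul_left ((ν + 1) * (ν + 2)))).congr_fun fun m => ?_
    have := gamma_add_nat_pos hν m
    have e2 : (m : ℝ) + ν + 1 + (2 : ℕ) = (m : ℝ) + ν + 1 + 1 + 1 := by push_cast; ring
    rw [e2, Real.Gamma_add_one (by positivity), Real.Gamma_add_one (by positivity)]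
    field_simp
    ring
  rw [h, ← hy, Real.exp_neg, hy]
  field_simp
  ring

theorem integrable_besselHeat_mul {ν x s : ℝ} (hν : 0 ≤ ν) (hx : 0 < x) (hs : 0 < s) :
    IntegrableOn (fun w => besselHeat ν ν x w s * w ^ (ν + 1 / 2)) (Ioi 0) :=
  .of_integral_ne_zero (by rw [integral_besselHeat_mul hν hx hs]; positivity)

theorem hasIntegral_besselHeat_variance {ν x s : ℝ} (hν : 0 ≤ ν) (hx : 0 < x) (hs : 0 < s) :
    IntegrableOn (fun w => besselHeat ν ν x w s * w ^ (ν + 1 / 2) * (w ^ 2 - x ^ 2) ^ 2) (Ioi 0) ∧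
    ∫ w in Ioi (0 : ℝ), besselHeat ν ν x w s * w ^ (ν + 1 / 2) * (w ^ 2 - x ^ 2) ^ 2 =
      x ^ (ν + 1 / 2) * (8 * s * x ^ 2 + 16 * s ^ 2 * ((ν + 1) * (ν + 2))) := by
  have i0 := integrable_besselHeat_mul hν hx hs
  have i1 : IntegrableOn (fun w => besselHeat ν ν x w s * w ^ (ν + 1 / 2) * w ^ 2) (Ioi 0) :=
    .of_integral_ne_zero (by rw [integral_besselHeat_mul_sq hν hx hs]; positivity)
  have i2 : IntegrableOn (fun w => besselHeat ν ν x w s * w ^ (ν + 1 / 2) * (w ^ 2) ^ 2) (Ioi 0) :=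
    .of_integral_ne_zero (by rw [integral_besselHeat_mul_sq_sq hν hx hs]; positivity)
  have e : (fun w => besselHeat ν ν x w s * w ^ (ν + 1 / 2) * (w ^ 2 - x ^ 2) ^ 2) =
      fun w => besselHeat ν ν x w s * w ^ (ν + 1 / 2) * (w ^ 2) ^ 2 -
        2 * x ^ 2 * (besselHeat ν ν x w s * w ^ (ν + 1 / 2) * w ^ 2) +
        x ^ 4 * (besselHeat ν ν x w s * w ^ (ν + 1 / 2)) := by
    funext w
    ring
  have i3 : IntegrableOn (fun w => besselHeat ν ν x w s * w ^ (ν + 1 / 2) * (w ^ 2) ^ 2 -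
      2 * x ^ 2 * (besselHeat ν ν x w s * w ^ (ν + 1 / 2) * w ^ 2)) (Ioi 0) :=
    i2.sub (i1.const_mul _)
  rw [e]
  refine ⟨i3.add (i0.const_mul _), ?_⟩
  rw [integral_add i3 (i0.const_mul _), integral_sub i2 (i1.const_mul _),
    integral_const_mul, integral_const_mul, integral_besselHeat_mul hν hx hs,
    integral_besselHeat_mul_sq hν hx hs, integral_besselHeat_mul_sq_sq hν hx hs]
  ring

theorem continuousOn_integral_Icc {P : ℝ × ℝ → ℝ} {c d : ℝ} {S : Set ℝ} (hcd : c ≤ d)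
    (hS : IsLocallyClosed S) (hP : ContinuousOn P (Icc c d ×ˢ S)) :
    ContinuousOn (fun ξ => ∫ w in Icc c d, P (w, ξ)) S := by
  have : LocallyCompactSpace S := hS.locallyCompactSpace
  have hcont : Continuous (Function.uncurry fun (ξ : S) (w : ℝ) =>
      P ((projIcc c d hcd w : ℝ), (ξ : ℝ))) :=
    hP.comp_continuous (by fun_prop) fun q => ⟨(projIcc c d hcd q.2).2, q.1.2⟩
  have key := continuous_parametric_integral_of_continuous (μ := volume) hcont
    (isCompact_Icc (a := c) (b := d))
  rw [continuousOn_iff_continuous_domRestrict]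
  refine key.congr fun ξ => setIntegral_congr_fun measurableSet_Icc fun w hw => ?_
  simp only [projIcc_of_mem hcd hw]

theorem hasDerivAt_integral_of_contDiffOn {P : ℝ × ℝ → ℝ} {Ω U : Set ℝ} {c d ξ : ℝ}
    (hΩ : IsOpen Ω) (hU : IsOpen U) (hcd : c ≤ d) (hcΩ : Icc c d ⊆ Ω)
    (hP : ContDiffOn ℝ ∞ P (Ω ×ˢ U)) (hξ : ξ ∈ U) :
    HasDerivAt (fun ξ' => ∫ w in c..d, P (w, ξ')) (∫ w in c..d, deriv (fun ξ' => P (w, ξ')) ξ)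
      ξ := by
  have hopen : IsOpen (Ω ×ˢ U) := hΩ.prod hU
  obtain ⟨ε, hε, hball⟩ := Metric.nhds_basis_closedBall.mem_iff.1 (hU.mem_nhds hξ)
  have hDcont : ContinuousOn (fun p => fderiv ℝ P p (0, 1)) (Ω ×ˢ U) :=
    (hP.continuousOn_fderiv_of_isOpen hopen (by simp)).clm_apply continuousOn_const
  have hderiv : ∀ w ∈ Ω, ∀ ξ' ∈ U,
      HasDerivAt (fun ξ'' => P (w, ξ'')) (fderiv ℝ P (w, ξ') (0, 1)) ξ' := fun w hw ξ' hξ' =>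
    ((hP.contDiffAt (hopen.mem_nhds ⟨hw, hξ'⟩)).differentiableAt (by simp)).hasFDerivAt.comp_hasDerivAt
      ξ' ((hasDerivAt_const ξ' w).prodMk (hasDerivAt_id ξ'))
  obtain ⟨M, hM⟩ := ((isCompact_Icc (a := c) (b := d)).prod
    (isCompact_closedBall ξ ε)).exists_bound_of_continuousOn
      (hDcont.mono (prod_mono hcΩ hball))
  have hslice : ∀ {Q : ℝ × ℝ → ℝ}, ContinuousOn Q (Ω ×ˢ U) → ∀ ξ' ∈ U,
      ContinuousOn (fun w => Q (w, ξ')) (uIcc c d) := fun hQ ξ' hξ' =>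
    hQ.comp (by fun_prop) fun w hw => ⟨hcΩ (uIcc_of_le hcd ▸ hw), hξ'⟩
  have hsub : uIoc c d ⊆ Icc c d := by
    rw [uIoc_of_le hcd]
    exact Ioc_subset_Icc_self
  have key := (intervalIntegral.hasDerivAt_integral_of_dominated_loc_of_deriv_le (μ := volume)
    (a := c) (b := d) (F := fun ξ' w => P (w, ξ'))
    (F' := fun ξ' w => fderiv ℝ P (w, ξ') (0, 1)) (bound := fun _ => M)
    (Metric.closedBall_mem_nhds ξ hε)
    (by
      filter_upwards [hU.mem_nhds hξ] with ξ' hξ'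
      exact ((hslice hP.continuousOn ξ' hξ').intervalIntegrable).def'.aestronglyMeasurable)
    (hslice hP.continuousOn ξ hξ).intervalIntegrable
    ((hslice hDcont ξ hξ).intervalIntegrable).def'.aestronglyMeasurable
    (ae_of_all _ fun w hw ξ' hξ' => hM (w, ξ') ⟨hsub hw, hξ'⟩)
    intervalIntegrable_const
    (ae_of_all _ fun w hw ξ' hξ' => hderiv w (hcΩ (hsub hw)) ξ' (hball hξ'))).2
  exact key.congr_deriv (intervalIntegral.integral_congr fun w hw =>
    (hderiv w (hcΩ (uIcc_of_le hcd ▸ hw)) ξ hξ).deriv.symm)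

/-- Green's identity on an interval for functions one of which vanishes near the endpoints. -/
theorem integral_green {u v : ℝ → ℝ} {Ω : Set ℝ} {a b c d : ℝ} (hΩ : IsOpen Ω)
    (hcΩ : Icc c d ⊆ Ω) (hca : c < a) (hcd : c ≤ d) (hbd : b < d)
    (hu : ContDiffOn ℝ ∞ u Ω) (hv : ContDiffOn ℝ ∞ v Ω) (hsupp : ∀ w, w ∉ Icc a b → v w = 0) :
    ContinuousOn (fun w => u w * deriv (deriv v) w - deriv (deriv u) w * v w) (uIcc c d) ∧
    ∫ w in c..d, (u w * deriv (deriv v) w - deriv (deriv u) w * v w) = 0 := by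
  have hu' := ((contDiffOn_infty_iff_deriv_of_isOpen hΩ).1 hu).2
  have hv' := ((contDiffOn_infty_iff_deriv_of_isOpen hΩ).1 hv).2
  have hu'' := ((contDiffOn_infty_iff_deriv_of_isOpen hΩ).1 hu').2
  have hv'' := ((contDiffOn_infty_iff_deriv_of_isOpen hΩ).1 hv').2
  have hD : ∀ {f : ℝ → ℝ}, ContDiffOn ℝ ∞ f Ω → ∀ w ∈ Ω, HasDerivAt f (deriv f w) w :=
    fun hf w hw => ((hf.contDiffAt (hΩ.mem_nhds hw)).differentiableAt (by simp)).hasDerivAt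
  have hsub : uIcc c d ⊆ Ω := by rwa [uIcc_of_le hcd]
  have hcont : ContinuousOn (fun w => u w * deriv (deriv v) w - deriv (deriv u) w * v w)
      (uIcc c d) :=
    ((hu.continuousOn.mul hv''.continuousOn).sub (hu''.continuousOn.mul hv.continuousOn)).mono hsub
  have hend : ∀ w, w ∉ Icc a b → v w = 0 ∧ deriv v w = 0 := fun w hw => by
    refine ⟨hsupp w hw, ?_⟩
    have : v =ᶠ[𝓝 w] fun _ => 0 := by
      filter_upwards [isClosed_Icc.isOpen_compl.mem_nhds hw] with w' hw' using hsupp w' hw'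
    rw [this.deriv_eq, deriv_const]
  have key := intervalIntegral.integral_eq_sub_of_hasDerivAt (a := c) (b := d)
    (f := fun w => u w * deriv v w - deriv u w * v w)
    (f' := fun w => u w * deriv (deriv v) w - deriv (deriv u) w * v w)
    (fun w hw => (((hD hu w (hsub hw)).mul (hD hv' w (hsub hw))).sub
      ((hD hu' w (hsub hw)).mul (hD hv w (hsub hw)))).congr_deriv (by ring))
    hcont.intervalIntegrable
  refine ⟨hcont, ?_⟩
  rw [key]
  obtain ⟨hc0, hc1⟩ := hend c fun h => (not_le.2 hca) h.1
  obtain ⟨hd0, hd1⟩ := hend d fun h => (not_le.2 hbd) h.2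
  simp [hc0, hc1, hd0, hd1]

theorem continuousOn_besselHeat {ν x t : ℝ} (hν : 0 ≤ ν) (hx : 0 < x) :
    ContinuousOn (fun p : ℝ × ℝ => besselHeat ν ν x p.1 (t - p.2)) (Ioi 0 ×ˢ Iio t) :=
  (contDiffOn_besselHeat hν hx).continuousOn

theorem exists_quadratic_modulus {φ : ℝ → ℝ → ℝ} {x t t₀ M : ℝ} (hx : 0 < x) (ht : t₀ < t)
    (hφ : ContinuousOn (fun p : ℝ × ℝ => φ p.1 p.2) (Ioi 0 ×ˢ Icc t₀ t))
    (hM : ∀ w, 0 < w → ∀ ξ ∈ Icc t₀ t, |φ w ξ| ≤ M) {ε : ℝ} (hε : 0 < ε) :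
    ∃ C, 0 ≤ C ∧ ∀ᶠ ξ in 𝓝[<] t, ∀ w, 0 < w →
      |φ w ξ - φ x t| ≤ ε + C * (w ^ 2 - x ^ 2) ^ 2 := by
  have htmem : t ∈ Icc t₀ t := ⟨ht.le, le_rfl⟩
  obtain ⟨δ, hδ, hclose⟩ := Metric.continuousOn_iff.1 hφ (x, t) ⟨hx, htmem⟩ ε hε
  have hM0 : 0 ≤ M := (abs_nonneg _).trans (hM x hx t htmem)
  have hδx : 0 < δ * x := mul_pos hδ hx
  refine ⟨2 * M / (δ * x) ^ 2, by positivity, ?_⟩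
  have hlt : max t₀ (t - δ) < t := max_lt ht (by linarith)
  filter_upwards [Ioo_mem_nhdsLT hlt] with ξ hξ w hw
  have hξ₀ : t₀ < ξ := (le_max_left _ _).trans_lt hξ.1
  have hξδ : t - δ < ξ := (le_max_right _ _).trans_lt hξ.1
  have hξmem : ξ ∈ Icc t₀ t := ⟨hξ₀.le, hξ.2.le⟩
  by_cases hwx : |w - x| < δ
  · have h := hclose (w, ξ) ⟨hw, hξmem⟩ (by
      rw [Prod.dist_eq, max_lt_iff, Real.dist_eq, Real.dist_eq]
      exact ⟨hwx, abs_lt.2 ⟨by linarith, by linarith [hξ.2]⟩⟩)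
    rw [Real.dist_eq] at h
    have : 0 ≤ 2 * M / (δ * x) ^ 2 * (w ^ 2 - x ^ 2) ^ 2 := by positivity
    linarith
  · have hlow : (δ * x) ^ 2 ≤ (w ^ 2 - x ^ 2) ^ 2 := by
      rw [← sq_abs (w ^ 2 - x ^ 2)]
      have e : |w ^ 2 - x ^ 2| = |w - x| * (w + x) := by
        rw [← abs_of_pos (add_pos hw hx), ← abs_mul]
        congr 1
        ring
      rw [e]
      have := not_lt.1 hwx
      have : x ≤ w + x := by linarith
      gcongr
    have h1 : |φ w ξ - φ x t| ≤ 2 * M := by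
      have := abs_sub (φ w ξ) (φ x t)
      linarith [hM w hw ξ hξmem, hM x hx t htmem]
    have h2 : 2 * M ≤ 2 * M / (δ * x) ^ 2 * (w ^ 2 - x ^ 2) ^ 2 := by
      rw [div_mul_eq_mul_div, le_div_iff₀ (by positivity)]
      gcongr
    linarith

theorem exists_bound_div_rpow {V : ℝ → ℝ → ℝ} {p a b t₀ t : ℝ} (ha : 0 < a)
    (hV : ContinuousOn (fun p : ℝ × ℝ => V p.1 p.2) (Ioi 0 ×ˢ Icc t₀ t))
    (hsupp : ∀ w, 0 < w → ∀ ξ ∈ Icc t₀ t, w ∉ Icc a b → V w ξ = 0) :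
    ContinuousOn (fun q : ℝ × ℝ => V q.1 q.2 / q.1 ^ p) (Ioi 0 ×ˢ Icc t₀ t) ∧
    ∃ M, ∀ w, 0 < w → ∀ ξ ∈ Icc t₀ t, |V w ξ / w ^ p| ≤ M := by
  have hcont : ContinuousOn (fun q : ℝ × ℝ => V q.1 q.2 / q.1 ^ p) (Ioi 0 ×ˢ Icc t₀ t) :=
    hV.div (continuous_fst.continuousOn.rpow_const fun q hq => Or.inl (ne_of_gt hq.1))
      fun q hq => (Real.rpow_pos_of_pos hq.1 _).ne'
  refine ⟨hcont, ?_⟩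
  obtain ⟨M, hM⟩ := ((isCompact_Icc (a := a) (b := b)).prod
    (isCompact_Icc (a := t₀) (b := t))).exists_bound_of_continuousOn
      (hcont.mono (prod_mono_left fun w hw => ha.trans_le hw.1))
  refine ⟨max M 0, fun w hw ξ hξ => ?_⟩
  by_cases hwab : w ∈ Icc a b
  · exact (hM (w, ξ) ⟨hwab, hξ⟩).trans (le_max_left _ _)
  · simp [hsupp w hw ξ hξ hwab]

theorem tendsto_integral_besselHeat {V : ℝ → ℝ → ℝ} {ν x a b t₀ t : ℝ} (hν : 0 ≤ ν) (hx : 0 < x)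
    (ha : 0 < a) (ht : t₀ < t)
    (hV : ContinuousOn (fun p : ℝ × ℝ => V p.1 p.2) (Ioi 0 ×ˢ Icc t₀ t))
    (hsupp : ∀ w, 0 < w → ∀ ξ ∈ Icc t₀ t, w ∉ Icc a b → V w ξ = 0) :
    Tendsto (fun ξ => ∫ w in Ioi (0 : ℝ), besselHeat ν ν x w (t - ξ) * V w ξ) (𝓝[<] t)
      (𝓝 (V x t)) := by
  set p := ν + 1 / 2 with hp
  obtain ⟨hφ, M, hM⟩ := exists_bound_div_rpow (p := p) ha hV hsupp
  have hxp : 0 < x ^ p := Real.rpow_pos_of_pos hx p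
  rw [Metric.tendsto_nhds]
  intro ε hε
  have hε' : 0 < ε / (2 * x ^ p) := by positivity
  obtain ⟨C, hC, hmod⟩ := exists_quadratic_modulus (φ := fun w ξ => V w ξ / w ^ p) hx ht hφ hM hε'
  have hlim : Tendsto (fun ξ => x ^ p * (ε / (2 * x ^ p)) + C * (x ^ p *
      (8 * (t - ξ) * x ^ 2 + 16 * (t - ξ) ^ 2 * ((ν + 1) * (ν + 2))))) (𝓝[<] t)
      (𝓝 (ε / 2)) := by
    have hc : Continuous fun ξ => x ^ p * (ε / (2 * x ^ p)) + C * (x ^ p *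
      (8 * (t - ξ) * x ^ 2 + 16 * (t - ξ) ^ 2 * ((ν + 1) * (ν + 2)))) := by fun_prop
    have := (hc.tendsto t).mono_left (nhdsWithin_le_nhds (s := Iio t))
    convert this using 2
    simp
    field_simp
  filter_upwards [hmod, hlim.eventually_lt_const (show ε / 2 < ε by linarith),
    Ioo_mem_nhdsLT ht] with ξ hξ hsmall hξt
  have hs : 0 < t - ξ := sub_pos.2 hξt.2
  have hξmem : ξ ∈ Icc t₀ t := ⟨hξt.1.le, hξt.2.le⟩
  have hi0 := integrable_besselHeat_mul hν hx hs
  obtain ⟨hi2, hval⟩ := hasIntegral_besselHeat_variance hν hx hs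
  have hone := integral_besselHeat_mul hν hx hs
  rw [← hp] at hi0 hi2 hval hone
  have hiV : IntegrableOn (fun w => besselHeat ν ν x w (t - ξ) * V w ξ) (Ioi 0) := by
    refine IntegrableOn.of_forall_sdiff_eq_zero (s := Icc a b) ?_ measurableSet_Ioi
      fun w hw => by simp [hsupp w hw.1 ξ hξmem hw.2]
    refine ContinuousOn.integrableOn_Icc ?_
    have hmaps : ∀ w ∈ Icc a b, 0 < w := fun w hw => ha.trans_le hw.1
    have hslice : ContinuousOn (fun w : ℝ => (w, ξ)) (Icc a b) := by fun_prop
    exact ((continuousOn_besselHeat hν hx).comp hslice fun w hw => ⟨hmaps w hw, hξt.2⟩).mul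
      (hV.comp hslice fun w hw => ⟨hmaps w hw, hξmem⟩)
  have hVx : V x t = ∫ w in Ioi (0 : ℝ), besselHeat ν ν x w (t - ξ) * w ^ p * (V x t / x ^ p) := by
    rw [integral_mul_const, hone]
    field_simp
  rw [Real.dist_eq]
  rw [hVx, ← integral_sub hiV (hi0.mul_const _), ← Real.norm_eq_abs]
  refine (norm_integral_le_of_norm_le
    (g := fun w => besselHeat ν ν x w (t - ξ) * w ^ p * (ε / (2 * x ^ p)) +
      C * (besselHeat ν ν x w (t - ξ) * w ^ p * (w ^ 2 - x ^ 2) ^ 2))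
    ((hi0.mul_const _).add (hi2.const_mul C)) ?_).trans_lt ?_
  · refine (ae_restrict_iff' measurableSet_Ioi).2 (ae_of_all _ fun w hw => ?_)
    have hw : 0 < w := hw
    have hwp : 0 < w ^ p := Real.rpow_pos_of_pos hw p
    have hK : 0 ≤ besselHeat ν ν x w (t - ξ) * w ^ p :=
      mul_nonneg (besselHeat_nonneg hν hx hw hs) hwp.le
    have e : besselHeat ν ν x w (t - ξ) * V w ξ -
        besselHeat ν ν x w (t - ξ) * w ^ p * (V x t / x ^ p) =
        besselHeat ν ν x w (t - ξ) * w ^ p * (V w ξ / w ^ p - V x t / x ^ p) := by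
      field_simp
    rw [e, norm_mul, Real.norm_of_nonneg hK, Real.norm_eq_abs]
    calc _ ≤ besselHeat ν ν x w (t - ξ) * w ^ p *
          (ε / (2 * x ^ p) + C * (w ^ 2 - x ^ 2) ^ 2) := by gcongr; exact hξ w hw
      _ = _ := by ring
  · rw [integral_add (hi0.mul_const _) (hi2.const_mul C), integral_mul_const, integral_const_mul,
      hval, hone]
    exact hsmall

theorem abs_integral_besselHeat_le {f : ℝ → ℝ} {ν x s M : ℝ} (hν : 0 ≤ ν) (hx : 0 < x)
    (hs : 0 < s) (hf : ∀ w, 0 < w → |f w / w ^ (ν + 1 / 2)| ≤ M) :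
    |∫ w in Ioi (0 : ℝ), besselHeat ν ν x w s * f w| ≤ x ^ (ν + 1 / 2) * M := by
  rw [← integral_besselHeat_mul hν hx hs, ← integral_mul_const, ← Real.norm_eq_abs]
  refine norm_integral_le_of_norm_le ((integrable_besselHeat_mul hν hx hs).mul_const M)
    ((ae_restrict_iff' measurableSet_Ioi).2 (ae_of_all _ fun w hw => ?_))
  have hw : 0 < w := hw
  have hwp : 0 < w ^ (ν + 1 / 2) := Real.rpow_pos_of_pos hw _
  have hK := besselHeat_nonneg hν hx hw hs
  have h := hf w hw
  rw [abs_div, abs_of_pos hwp, div_le_iff₀ hwp] at h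
  rw [norm_mul, Real.norm_of_nonneg hK, Real.norm_eq_abs]
  calc _ ≤ besselHeat ν ν x w s * (M * w ^ (ν + 1 / 2)) := by gcongr
    _ = _ := by ring

theorem hasDerivAt_besselHeat_backward {ν x w t ξ : ℝ} (hν : 0 ≤ ν) (hs : 0 < t - ξ) :
    HasDerivAt (fun ξ' => besselHeat ν ν x w (t - ξ'))
      (-deriv (fun s' => besselHeat ν ν x w s') (t - ξ)) ξ :=
  HasDerivAt.comp_const_sub t ξ
    (hasDerivAt_besselHeat_time (x := x) (w := w) hν hs).differentiableAt.hasDerivAt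

/-- Time derivative of the pairing of the backward Bessel heat kernel with a solution of the
inhomogeneous equation. -/
theorem hasDerivAt_integral_besselHeat {ν a b c d t₀ t x ξ : ℝ} {V F : ℝ → ℝ → ℝ} (hν : 0 ≤ ν)
    (hcΩ : Icc c d ⊆ Ioi (0 : ℝ)) (hca : c < a) (hcd : c ≤ d) (hbd : b < d) (hx : 0 < x)
    (hV : ContDiffOn ℝ ∞ (fun p : ℝ × ℝ => V p.1 p.2) (Ioi 0 ×ˢ Icc t₀ t))
    (hVsupp : ∀ w ξ, w ∉ Icc a b → V w ξ = 0)
    (hF : ContinuousOn (fun p : ℝ × ℝ => F p.1 p.2) (Ioi 0 ×ˢ Icc t₀ t))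
    (hpde : ∀ w, 0 < w → ∀ ξ ∈ Ioo t₀ t, deriv (fun ξ' => V w ξ') ξ =
      deriv (deriv fun w' => V w' ξ) w + ((1 / 4 - ν ^ 2) / w ^ 2) * V w ξ + F w ξ)
    (hξ : ξ ∈ Ioo t₀ t) :
    HasDerivAt (fun ξ' => ∫ w in c..d, besselHeat ν ν x w (t - ξ') * V w ξ')
      (∫ w in c..d, besselHeat ν ν x w (t - ξ) * F w ξ) ξ := by
  have hξIcc : ξ ∈ Icc t₀ t := Ioo_subset_Icc_self hξ
  have hs : 0 < t - ξ := sub_pos.2 hξ.2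
  have hP : ContDiffOn ℝ ∞ (fun p : ℝ × ℝ => besselHeat ν ν x p.1 (t - p.2) * V p.1 p.2)
      (Ioi 0 ×ˢ Ioo t₀ t) :=
    ((contDiffOn_besselHeat hν hx).mono (prod_mono_right fun _ h => h.2)).mul
      (hV.mono (prod_mono_right Ioo_subset_Icc_self))
  have key := hasDerivAt_integral_of_contDiffOn isOpen_Ioi isOpen_Ioo hcd hcΩ hP hξ
  have hslice : ContDiffOn ℝ ∞ (fun w : ℝ => (w, ξ)) (Ioi 0) := by fun_prop
  have hu : ContDiffOn ℝ ∞ (fun w => besselHeat ν ν x w (t - ξ)) (Ioi 0) :=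
    (contDiffOn_besselHeat hν hx).comp hslice fun w hw => ⟨hw, hξ.2⟩
  have hv : ContDiffOn ℝ ∞ (fun w => V w ξ) (Ioi 0) :=
    hV.comp hslice fun w hw => ⟨hw, hξIcc⟩
  obtain ⟨hgc, hg⟩ := integral_green isOpen_Ioi hcΩ hca hcd hbd hu hv fun w hw => hVsupp w ξ hw
  have hFc : ContinuousOn (fun w => besselHeat ν ν x w (t - ξ) * F w ξ) (uIcc c d) := by
    refine ContinuousOn.mono (s := Ioi 0) ?_ (by rwa [uIcc_of_le hcd])
    exact hu.continuousOn.mul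
      (hF.comp hslice.continuousOn fun w hw => ⟨hw, hξIcc⟩)
  have hpt : ∀ w ∈ uIcc c d,
      deriv (fun ξ' => besselHeat ν ν x w (t - ξ') * V w ξ') ξ =
        besselHeat ν ν x w (t - ξ) * F w ξ +
          (besselHeat ν ν x w (t - ξ) * deriv (deriv fun w' => V w' ξ) w -
            deriv (deriv fun w' => besselHeat ν ν x w' (t - ξ)) w * V w ξ) := by
    intro w hw
    have hw0 : 0 < w := hcΩ (uIcc_of_le hcd ▸ hw)
    have h1 := hasDerivAt_besselHeat_backward (x := x) (w := w) hν hs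
    have h2 : HasDerivAt (fun ξ' => V w ξ') (deriv (fun ξ' => V w ξ') ξ) ξ := by
      have hVξ : ContDiffAt ℝ ∞ (fun ξ' => V w ξ') ξ :=
        (hV.contDiffAt (prod_mem_nhds (Ioi_mem_nhds hw0) (Icc_mem_nhds hξ.1 hξ.2))).comp ξ
          (by fun_prop : ContDiffAt ℝ ∞ (fun ξ' : ℝ => (w, ξ')) ξ)
      exact (hVξ.differentiableAt (by simp)).hasDerivAt
    refine (h1.mul h2).deriv.trans ?_
    rw [hpde w hw0 ξ hξ, deriv_besselHeat_time hν hx hw0 hs]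
    ring
  refine key.congr_deriv ?_
  rw [intervalIntegral.integral_congr hpt,
    intervalIntegral.integral_add hFc.intervalIntegrable hgc.intervalIntegrable, hg, add_zero]

/-- Duhamel's formula for `besselHeat`, for functions supported in `[a, b]` in space. -/
theorem duhamel_besselHeat {ν a b t₀ t x : ℝ} {V F : ℝ → ℝ → ℝ} (hν : 0 ≤ ν) (ha : 0 < a)
    (hab : a ≤ b) (ht : t₀ < t) (hx : 0 < x)
    (hV : ContDiffOn ℝ ∞ (fun p : ℝ × ℝ => V p.1 p.2) (Ioi 0 ×ˢ Icc t₀ t))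
    (hVsupp : ∀ w ξ, w ∉ Icc a b → V w ξ = 0)
    (hF : ContinuousOn (fun p : ℝ × ℝ => F p.1 p.2) (Ioi 0 ×ˢ Icc t₀ t))
    (hFsupp : ∀ w, 0 < w → ∀ ξ ∈ Icc t₀ t, w ∉ Icc a b → F w ξ = 0)
    (hpde : ∀ w, 0 < w → ∀ ξ ∈ Ioo t₀ t, deriv (fun ξ' => V w ξ') ξ =
      deriv (deriv fun w' => V w' ξ) w + ((1 / 4 - ν ^ 2) / w ^ 2) * V w ξ + F w ξ) :
    V x t = (∫ w in Ioi (0 : ℝ), besselHeat ν ν x w (t - t₀) * V w t₀) +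
      ∫ ξ in Ioo t₀ t, ∫ w in Ioi (0 : ℝ), besselHeat ν ν x w (t - ξ) * F w ξ := by
  set c := a / 2 with hc
  set d := b + 1 with hd
  have hc0 : 0 < c := by positivity
  have hca : c < a := by linarith
  have hbd : b < d := by linarith
  have hcd : c ≤ d := by linarith
  have hcΩ : Icc c d ⊆ Ioi (0 : ℝ) := fun w hw => hc0.trans_le hw.1
  have hIcoIcc : Ico t₀ t ⊆ Icc t₀ t := Ico_subset_Icc_self
  have hK := continuousOn_besselHeat (t := t) hν hx
  have hrestrict : ∀ {f : ℝ → ℝ}, (∀ w, 0 < w → w ∉ Icc a b → f w = 0) →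
      ∫ w in Ioi (0 : ℝ), f w = ∫ w in Icc c d, f w := fun hf =>
    setIntegral_eq_of_subset_of_forall_sdiff_eq_zero measurableSet_Ioi hcΩ fun w hw =>
      hf w hw.1 fun h => hw.2 ⟨hca.le.trans h.1, h.2.trans hbd.le⟩
  have hinterval : ∀ f : ℝ → ℝ, ∫ w in Icc c d, f w = ∫ w in c..d, f w := fun f => by
    rw [integral_Icc_eq_integral_Ioc, intervalIntegral.integral_of_le hcd]
  have hVint : ∀ ξ, ∫ w in Ioi (0 : ℝ), besselHeat ν ν x w (t - ξ) * V w ξ =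
      ∫ w in Icc c d, besselHeat ν ν x w (t - ξ) * V w ξ := fun ξ =>
    hrestrict fun w _ hw => by simp [hVsupp w ξ hw]
  have hFint : ∀ ξ ∈ Icc t₀ t, ∫ w in Ioi (0 : ℝ), besselHeat ν ν x w (t - ξ) * F w ξ =
      ∫ w in Icc c d, besselHeat ν ν x w (t - ξ) * F w ξ := fun ξ hξ =>
    hrestrict fun w hw hw' => by simp [hFsupp w hw ξ hξ hw']
  have hcontKU : ∀ {U : ℝ → ℝ → ℝ},
      ContinuousOn (fun p : ℝ × ℝ => U p.1 p.2) (Ioi 0 ×ˢ Icc t₀ t) →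
      ContinuousOn (fun p : ℝ × ℝ => besselHeat ν ν x p.1 (t - p.2) * U p.1 p.2)
        (Icc c d ×ˢ Ico t₀ t) := fun hU =>
    (hK.mono (prod_mono hcΩ fun ξ hξ => hξ.2)).mul (hU.mono (prod_mono hcΩ hIcoIcc))
  have hVcont := continuousOn_integral_Icc hcd isLocallyClosed_Ico (hcontKU hV.continuousOn)
  have hFcont := continuousOn_integral_Icc hcd isLocallyClosed_Ico (hcontKU hF)
  have hderiv : ∀ ξ ∈ Ioo t₀ t,
      HasDerivAt (fun ξ' => ∫ w in Ioi (0 : ℝ), besselHeat ν ν x w (t - ξ') * V w ξ')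
        (∫ w in Ioi (0 : ℝ), besselHeat ν ν x w (t - ξ) * F w ξ) ξ := by
    intro ξ hξ
    rw [hFint ξ (Ioo_subset_Icc_self hξ), hinterval]
    simp only [hVint, hinterval]
    exact hasDerivAt_integral_besselHeat hν hcΩ hca hcd hbd hx hV hVsupp hF hpde hξ
  obtain ⟨-, M, hM⟩ := exists_bound_div_rpow (p := ν + 1 / 2) ha hF hFsupp
  have hint : IntervalIntegrable
      (fun ξ => ∫ w in Ioi (0 : ℝ), besselHeat ν ν x w (t - ξ) * F w ξ) volume t₀ t := by
    rw [intervalIntegrable_iff_integrableOn_Ioo_of_le ht.le]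
    have hcont : ContinuousOn (fun ξ => ∫ w in Ioi (0 : ℝ), besselHeat ν ν x w (t - ξ) * F w ξ)
        (Ioo t₀ t) :=
      (hFcont.mono Ioo_subset_Ico_self).congr fun ξ hξ => hFint ξ (Ioo_subset_Icc_self hξ)
    refine IntegrableOn.of_bound (by simp) (hcont.aestronglyMeasurable measurableSet_Ioo)
      (x ^ (ν + 1 / 2) * M) ((ae_restrict_iff' measurableSet_Ioo).2 (ae_of_all _ fun ξ hξ => ?_))
    exact abs_integral_besselHeat_le hν hx (sub_pos.2 hξ.2)
      fun w hw => hM w hw ξ (Ioo_subset_Icc_self hξ)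
  have hleft : Tendsto (fun ξ => ∫ w in Ioi (0 : ℝ), besselHeat ν ν x w (t - ξ) * V w ξ)
      (𝓝[>] t₀) (𝓝 (∫ w in Ioi (0 : ℝ), besselHeat ν ν x w (t - t₀) * V w t₀)) := by
    simp only [hVint]
    have h := hVcont t₀ ⟨le_rfl, ht⟩
    rw [ContinuousWithinAt, nhdsWithin_Ico_eq_nhdsGE ht] at h
    exact h.mono_left (nhdsWithin_mono _ Ioi_subset_Ici_self)
  have hright := tendsto_integral_besselHeat hν hx ha ht hV.continuousOn
    fun w _ ξ _ hw => hVsupp w ξ hw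
  have key := intervalIntegral.integral_eq_sub_of_hasDerivAt_of_tendsto ht hderiv hint hleft hright
  rw [intervalIntegral.integral_of_le ht.le, integral_Ioc_eq_integral_Ioo] at key
  rw [key]
  ring

/-- Duhamel representation formula via the Bessel heat kernel for smooth,
compactly (in space) supported solutions of `∂_t V = ∂_x² V + ((1/4 − γ²)/x²) V + F` on
`(0, ∞) × [t₀, T]`. -/
theorem stmt_10 (n : ℕ) (hn : 8 ≤ n)
    (α γ : ℝ)
    (hα : α = (3 - (n : ℝ) + Real.sqrt ((n : ℝ) ^ 2 - 10 * (n : ℝ) + 17)) / 2)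
    (hγ : γ = ((n : ℝ) - 3) / 2 + α)
    (Iγ : ℝ → ℝ)
    (hI : ∀ x : ℝ, Iγ x = ∑' m : ℕ,
      (x / 2) ^ (2 * (m : ℝ) + γ) / ((m.factorial : ℝ) * Real.Gamma ((m : ℝ) + γ + 1)))
    (B : ℝ → ℝ → ℝ → ℝ)
    (hB : ∀ x w t : ℝ, B x w t
      = Real.sqrt (x * w) / (2 * t) * Iγ (x * w / (2 * t))
        * Real.exp (-(x ^ 2 + w ^ 2) / (4 * t)))
    (t₀ T : ℝ) (hT : t₀ < T)
    (V F : ℝ → ℝ → ℝ)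
    (hV : ContDiffOn ℝ (⊤ : ℕ∞) (fun pt : ℝ × ℝ => V pt.1 pt.2) (Ioi 0 ×ˢ Icc t₀ T))
    (hsupp : ∃ a b1 : ℝ, 0 < a ∧ a ≤ b1 ∧ ∀ x t : ℝ, x ∉ Icc a b1 → V x t = 0)
    (hF : ContinuousOn (fun pt : ℝ × ℝ => F pt.1 pt.2) (Ioi 0 ×ˢ Icc t₀ T))
    (hpde : ∀ x : ℝ, 0 < x → ∀ t ∈ Icc t₀ T,
      derivWithin (fun t' => V x t') (Icc t₀ T) t
        = deriv (deriv (fun x' => V x' t)) x + ((1 / 4 - γ ^ 2) / x ^ 2) * V x t + F x t) :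
    ∀ t ∈ Ioc t₀ T, ∀ x : ℝ, 0 < x →
      V x t = (∫ w in Ioi (0 : ℝ), B x w (t - t₀) * V w t₀)
        + ∫ ξ in Ioo t₀ t, ∫ w in Ioi (0 : ℝ), B x w (t - ξ) * F w ξ := by
  intro t ht x hx
  have hγ0 : 0 ≤ γ := by
    have hsq := Real.sqrt_nonneg ((n : ℝ) ^ 2 - 10 * (n : ℝ) + 17)
    rw [hγ, hα]
    linarith
  obtain ⟨a, b, ha, hab, hVsupp⟩ := hsupp
  have hBeq : ∀ w, 0 < w → ∀ s, 0 < s → B x w s = besselHeat γ γ x w s := fun w hw s hs => by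
    rw [hB, hI, besselHeat_eq hx hw hs]
  have hIcc : Icc t₀ t ⊆ Icc t₀ T := Icc_subset_Icc_right ht.2
  have hFsupp : ∀ w, 0 < w → ∀ ξ ∈ Icc t₀ t, w ∉ Icc a b → F w ξ = 0 := by
    intro w hw ξ hξ hwab
    have h := hpde w hw ξ (hIcc hξ)
    have hev : (fun w' => V w' ξ) =ᶠ[𝓝 w] fun _ => 0 := by
      filter_upwards [isClosed_Icc.isOpen_compl.mem_nhds hwab] with w' hw' using hVsupp w' ξ hw'
    have hdd : deriv (deriv fun w' => V w' ξ) w = 0 := by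
      rw [hev.deriv.deriv_eq]
      simp
    have htime : (fun t' => V w t') = fun _ => 0 := funext fun t' => hVsupp w t' hwab
    rw [hdd, hVsupp w ξ hwab, htime] at h
    simpa using h.symm
  rw [duhamel_besselHeat hγ0 ha hab ht.1 hx (hV.mono (prod_mono_right hIcc)) hVsupp
    (hF.mono (prod_mono_right hIcc)) hFsupp fun w hw ξ hξ => by
      rw [← hpde w hw ξ (hIcc (Ioo_subset_Icc_self hξ)),
        derivWithin_of_mem_nhds (Icc_mem_nhds hξ.1 (hξ.2.trans_le ht.2))]]
  congr 1
  · exact setIntegral_congr_fun measurableSet_Ioi fun w hw => by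
      simp only [hBeq w hw (t - t₀) (sub_pos.2 ht.1)]
  · refine setIntegral_congr_fun measurableSet_Ioo fun ξ hξ => ?_
    exact setIntegral_congr_fun measurableSet_Ioi fun w hw => by
      simp only [hBeq w hw (t - ξ) (sub_pos.2 hξ.2)]
end

section
/- For every integer j ≥ 0, every s > 0 and every y > 0, the integral ∫₀^∞ K(y, z, s) φ_j(z) dz converges absolutely and equals e^{−λ_j s} φ_j(y). -/
open Set MeasureTheory

open Finset in
/-- Chu–Vandermonde recursion for the polynomials
`(b)_m ∑ l, (m choose l) X ^ l / (b)_l`, where `(b)_m` is the rising factorial. -/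
lemma prod_mul_sum_choose_succ {b : ℝ} (hb : 0 < b) (X : ℝ) (m : ℕ) :
    b * ((∏ i ∈ range m, (b + 1 + (i : ℝ))) *
        ∑ l ∈ range (m + 1), (m.choose l : ℝ) * X ^ l / ∏ i ∈ range l, (b + 1 + (i : ℝ)))
      + X * ((∏ i ∈ range m, (b + 2 + (i : ℝ))) *
        ∑ l ∈ range (m + 1), (m.choose l : ℝ) * X ^ l / ∏ i ∈ range l, (b + 2 + (i : ℝ)))
      = (∏ i ∈ range (m + 1), (b + (i : ℝ))) *
        ∑ l ∈ range (m + 2), ((m + 1).choose l : ℝ) * X ^ l / ∏ i ∈ range l, (b + (i : ℝ)) := by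
  have hs (c : ℝ) (l : ℕ) : (∏ i ∈ range (l + 1), (c + (i : ℝ)))
      = c * ∏ i ∈ range l, (c + 1 + (i : ℝ)) := by
    rw [prod_range_succ', mul_comm]
    congr 1
    · simp
    · exact prod_congr rfl fun i _ => by push_cast; ring
  have hpos (l : ℕ) : 0 < ∏ i ∈ range l, (b + (i : ℝ)) := prod_pos fun i _ => by positivity
  have h1 (l : ℕ) : (∏ i ∈ range l, (b + 1 + (i : ℝ)))
      = (∏ i ∈ range l, (b + (i : ℝ))) * (b + l) / b := by
    rw [← prod_range_succ, hs]; field_simp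
  have h2 (l : ℕ) : (∏ i ∈ range l, (b + 2 + (i : ℝ)))
      = (∏ i ∈ range (l + 1), (b + (i : ℝ))) * (b + l + 1) / (b * (b + 1)) := by
    have h := prod_range_succ (fun i : ℕ => b + (i : ℝ)) (l + 1)
    rw [hs b (l + 1), hs (b + 1) l, show b + 1 + 1 = b + 2 by ring] at h
    push_cast at h
    rw [add_assoc b, ← h]
    field_simp
  have hA : b * ((∏ i ∈ range m, (b + 1 + (i : ℝ))) *
        ∑ l ∈ range (m + 1), (m.choose l : ℝ) * X ^ l / ∏ i ∈ range l, (b + 1 + (i : ℝ)))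
      = (∏ i ∈ range (m + 1), (b + (i : ℝ))) * (1 + ∑ l ∈ range (m + 1),
        (m.choose (l + 1) : ℝ) * X ^ (l + 1) * b / (∏ i ∈ range (l + 1), (b + (i : ℝ)))
          / (b + l + 1)) := by
    have hext : ∑ l ∈ range (m + 1), (m.choose l : ℝ) * X ^ l / ∏ i ∈ range l, (b + 1 + (i : ℝ))
      = ∑ l ∈ range (m + 2), (m.choose l : ℝ) * X ^ l / ∏ i ∈ range l, (b + 1 + (i : ℝ)) := by
      rw [sum_range_succ _ (m + 1)]; simp
    rw [hext, sum_range_succ', hs b m, add_comm (1 : ℝ), mul_assoc]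
    congr 3
    · refine sum_congr rfl fun l _ => ?_
      rw [h1 (l + 1)]
      have := hpos (l + 1)
      push_cast
      field_simp
      ring
    · simp
  have hB : X * ((∏ i ∈ range m, (b + 2 + (i : ℝ))) *
        ∑ l ∈ range (m + 1), (m.choose l : ℝ) * X ^ l / ∏ i ∈ range l, (b + 2 + (i : ℝ)))
      = (∏ i ∈ range (m + 1), (b + (i : ℝ))) * ∑ l ∈ range (m + 1),
        (m.choose l : ℝ) * X ^ (l + 1) * (b + m + 1) / (∏ i ∈ range (l + 1), (b + (i : ℝ)))
          / (b + l + 1) := by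
    simp only [mul_sum]
    refine sum_congr rfl fun l _ => ?_
    rw [h2 l, h2 m]
    have := hpos (l + 1)
    field_simp
    ring
  rw [hA, hB, sum_range_succ' _ (m + 1), ← mul_add, add_assoc, ← sum_add_distrib, add_comm (1 : ℝ)]
  congr 2
  · refine sum_congr rfl fun l _ => ?_
    have := hpos (l + 1)
    have hc : ((m : ℝ) + 1) * m.choose l = ((m + 1).choose (l + 1) : ℝ) * (l + 1) := by
      exact_mod_cast Nat.add_one_mul_choose_eq m l
    have hc' : ((m + 1).choose (l + 1) : ℝ) = m.choose l + m.choose (l + 1) := by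
      exact_mod_cast Nat.choose_succ_succ m l
    have : (b + l + 1) ≠ 0 := by positivity
    rw [hc'] at hc ⊢
    field_simp
    linear_combination X ^ (l + 1) * hc
  · simp

open Finset in
/-- The exponential generating series of `k ↦ (b + k)_m`. -/
lemma hasSum_pow_div_factorial_mul_prod (X : ℝ) (m : ℕ) {b : ℝ} (hb : 0 < b) :
    HasSum (fun k : ℕ => X ^ k / (k.factorial : ℝ) * ∏ i ∈ range m, (b + k + (i : ℝ)))
      (Real.exp X * ((∏ i ∈ range m, (b + (i : ℝ))) *
        ∑ l ∈ range (m + 1), (m.choose l : ℝ) * X ^ l / ∏ i ∈ range l, (b + (i : ℝ)))) := by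
  induction m generalizing b with
  | zero =>
    simpa [Real.exp_eq_exp_ℝ] using NormedSpace.expSeries_div_hasSum_exp X
  | succ m ih =>
    rw [← prod_mul_sum_choose_succ hb, mul_add, mul_left_comm _ b, mul_left_comm _ X]
    have h1 := (ih (b := b + 1) (by linarith)).mul_left b
    have h2 := (ih (b := b + 2) (by linarith)).mul_left X
    have h3 : HasSum (fun k : ℕ => (k : ℝ) * (X ^ k / (k.factorial : ℝ) *
        ∏ i ∈ range m, (b + 1 + k + (i : ℝ))))
        (X * (Real.exp X * ((∏ i ∈ range m, (b + 2 + (i : ℝ))) *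
        ∑ l ∈ range (m + 1), (m.choose l : ℝ) * X ^ l / ∏ i ∈ range l, (b + 2 + (i : ℝ))))) := by
      rw [← hasSum_nat_add_iff' 1]
      simp only [sum_range_one, Nat.cast_zero, zero_mul, sub_zero]
      refine h2.congr_fun fun k => ?_
      rw [Nat.factorial_succ, show b + 1 + ((k + 1 : ℕ) : ℝ) = b + 2 + k by push_cast; ring]
      push_cast
      field_simp
      ring
    have h4 := h1.add h3
    refine h4.congr_fun fun k => ?_
    rw [prod_range_succ', show (∏ i ∈ range m, (b + (k : ℝ) + ((i + 1 : ℕ) : ℝ)))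
      = ∏ i ∈ range m, (b + 1 + k + (i : ℝ)) from
        prod_congr rfl fun i _ => by push_cast; ring]
    push_cast
    ring

open Finset in
/-- The binomial resummation turning the moments into the dilated Kummer polynomial. -/
lemma sum_neg_pow_choose_mul_sum (j : ℕ) (t X : ℝ) (P : ℕ → ℝ) :
    ∑ m ∈ range (j + 1), (-1 : ℝ) ^ m * (j.choose m : ℝ) * t ^ m *
        ∑ l ∈ range (m + 1), (m.choose l : ℝ) * X ^ l / P l
      = ∑ l ∈ range (j + 1), (-1 : ℝ) ^ l * (j.choose l : ℝ) * (t * X) ^ l *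
        (1 - t) ^ (j - l) / P l := by
  simp only [mul_sum]
  rw [sum_comm' (t' := range (j + 1)) (s' := fun l => Ico l (j + 1))
    (by intro m l; simp only [Finset.mem_range, Finset.mem_Ico]; omega)]
  refine sum_congr rfl fun l hl => ?_
  have hl' : l ≤ j := Nat.lt_succ_iff.mp (Finset.mem_range.mp hl)
  rw [sum_Ico_eq_sum_range, show j + 1 - l = (j - l) + 1 by omega,
    show (1 : ℝ) - t = -t + 1 by ring, add_pow, mul_sum, sum_div]
  refine sum_congr rfl fun i hi => ?_
  have hc : ((j.choose (l + i) : ℝ)) * ((l + i).choose l : ℝ)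
      = (j.choose l : ℝ) * ((j - l).choose i : ℝ) := by
    have := Nat.choose_mul (n := j) (k := l + i) (s := l) (by omega)
    rw [Nat.add_sub_cancel_left] at this
    exact_mod_cast this
  rw [one_pow, neg_pow t, mul_pow, pow_add, pow_add]
  linear_combination ((-1) ^ l * (-1) ^ i * t ^ l * t ^ i * X ^ l / P l) * hc

lemma Real.Gamma_add_natCast_eq_mul_prod {a : ℝ} (ha : 0 < a) (m : ℕ) :
    Real.Gamma (a + m) = Real.Gamma a * ∏ i ∈ Finset.range m, (a + (i : ℝ)) := by
  induction m with
  | zero => simp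
  | succ m ih =>
    rw [Finset.prod_range_succ, ← mul_assoc, ← ih, Nat.cast_succ, ← add_assoc,
      Real.Gamma_add_one (by positivity), mul_comm]

/-- Gaussian moments of the modified Bessel function `I_γ` (Weber's integral). -/
lemma integral_rpow_mul_exp_mul_besselI {γ c t : ℝ} (hγ : -1 < γ) (hc : 0 < c) (ht : 0 < t)
    (m : ℕ) :
    IntegrableOn (fun z : ℝ => z ^ (γ + 1) * (z ^ 2 / 4) ^ m * Real.exp (-z ^ 2 / (4 * t)) *
      ∑' k : ℕ, (c * z / 2) ^ (2 * (k : ℝ) + γ) /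
        ((k.factorial : ℝ) * Real.Gamma ((k : ℝ) + γ + 1))) (Ioi 0) ∧
    ∫ z in Ioi (0 : ℝ), z ^ (γ + 1) * (z ^ 2 / 4) ^ m * Real.exp (-z ^ 2 / (4 * t)) *
      ∑' k : ℕ, (c * z / 2) ^ (2 * (k : ℝ) + γ) /
        ((k.factorial : ℝ) * Real.Gamma ((k : ℝ) + γ + 1))
      = (c / 2) ^ γ * (4 * t) ^ (γ + 1) / 2 * t ^ m *
        (Real.exp (c ^ 2 * t) * ((∏ i ∈ Finset.range m, (γ + 1 + (i : ℝ))) *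
          ∑ l ∈ Finset.range (m + 1), (m.choose l : ℝ) * (c ^ 2 * t) ^ l /
            ∏ i ∈ Finset.range l, (γ + 1 + (i : ℝ)))) := by
  set A : ℝ := (c / 2) ^ γ * (4 * t) ^ (γ + 1) / 2 * t ^ m with hA
  have hApos : 0 < A := by positivity
  have hb : 0 < γ + 1 := by linarith
  have hG (k : ℕ) : 0 < Real.Gamma ((k : ℝ) + γ + 1) :=
    Real.Gamma_pos_of_pos (by have : (0 : ℝ) ≤ k := k.cast_nonneg; linarith)
  set F : ℕ → ℝ → ℝ := fun k z => z ^ (γ + 1) * (z ^ 2 / 4) ^ m * Real.exp (-z ^ 2 / (4 * t)) *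
    ((c * z / 2) ^ (2 * (k : ℝ) + γ) / ((k.factorial : ℝ) * Real.Gamma ((k : ℝ) + γ + 1))) with hF
  have hFnn (k : ℕ) (z : ℝ) (hz : 0 < z) : 0 ≤ F k z := by
    have := hG k
    simp only [hF]
    positivity
  have hFeq (k : ℕ) : EqOn (F k) (fun z => (c / 2) ^ (2 * (k : ℝ) + γ) / (4 ^ m * ((k.factorial : ℝ)
      * Real.Gamma ((k : ℝ) + γ + 1))) * (z ^ (2 * (γ + 1 + k + m) - 1) *
        Real.exp (-(4 * t)⁻¹ * z ^ 2))) (Ioi 0) := by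
    intro z hz
    have hz : 0 < z := hz
    have h1 : (c * z / 2) ^ (2 * (k : ℝ) + γ)
        = (c / 2) ^ (2 * (k : ℝ) + γ) * z ^ (2 * (k : ℝ) + γ) := by
      rw [← Real.mul_rpow (by positivity) hz.le]; ring_nf
    have h2 : z ^ (2 * (γ + 1 + k + m) - 1) = z ^ (γ + 1) * (z ^ 2) ^ m * z ^ (2 * (k : ℝ) + γ) := by
      rw [← pow_mul, ← Real.rpow_natCast z (2 * m), ← Real.rpow_add hz, ← Real.rpow_add hz]
      congr 1
      push_cast
      ring
    have h3 : -(4 * t)⁻¹ * z ^ 2 = -z ^ 2 / (4 * t) := by ring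
    have := hG k
    simp only [hF]
    rw [h1, h2, h3, div_pow]
    field_simp
  have hexp (k : ℕ) : (-1 : ℝ) < 2 * (γ + 1 + k + m) - 1 := by
    have : (0 : ℝ) ≤ k := k.cast_nonneg
    have : (0 : ℝ) ≤ m := m.cast_nonneg
    linarith
  have hFint (k : ℕ) : IntegrableOn (F k) (Ioi 0) :=
    IntegrableOn.congr_fun ((integrableOn_rpow_mul_exp_neg_mul_sq (b := (4 * t)⁻¹) (by positivity)
      (hexp k)).const_mul _) (hFeq k).symm measurableSet_Ioi
  have hFval (k : ℕ) : ∫ z in Ioi (0 : ℝ), F k z = A * ((c ^ 2 * t) ^ k / (k.factorial : ℝ) *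
      ∏ i ∈ Finset.range m, (γ + 1 + k + (i : ℝ))) := by
    rw [setIntegral_congr_fun measurableSet_Ioi (hFeq k), integral_const_mul]
    have h := integral_rpow_mul_exp_neg_mul_rpow (p := 2) (b := (4 * t)⁻¹) two_pos (hexp k)
      (by positivity)
    simp only [Real.rpow_two] at h
    have hk : 0 < γ + 1 + (k : ℝ) := by positivity
    rw [h, show (2 * (γ + 1 + k + m) - 1 + 1) / 2 = γ + 1 + (k : ℝ) + (m : ℝ) by ring,
      show -(2 * (γ + 1 + k + m) - 1 + 1) / 2 = -(γ + 1 + (k : ℝ) + (m : ℝ)) by ring,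
      Real.Gamma_add_natCast_eq_mul_prod hk, Real.inv_rpow (by positivity),
      ← Real.rpow_neg (by positivity), neg_neg, show (k : ℝ) + γ + 1 = γ + 1 + k by ring,
      Real.rpow_add (by positivity) (_ + _) (m : ℝ), Real.rpow_add (by positivity) (γ + 1) (k : ℝ),
      Real.rpow_add (by positivity) (2 * (k : ℝ)) γ, mul_comm 2 (k : ℝ),
      Real.rpow_mul (by positivity), Real.rpow_natCast, Real.rpow_natCast, Real.rpow_natCast,
      Real.rpow_two, hA]
    have hg : Real.Gamma (γ + 1 + k) ≠ 0 := (Real.Gamma_pos_of_pos hk).ne'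
    rw [← pow_mul, mul_comm k 2, pow_mul]
    have h5 : ((c / 2) ^ 2) ^ k * (4 * t) ^ k = (c ^ 2 * t) ^ k := by
      rw [← mul_pow]; congr 1; ring
    rw [← h5, mul_pow 4 t m]
    field_simp
  have hsum := (hasSum_pow_div_factorial_mul_prod (c ^ 2 * t) m hb).mul_left A
  have hI : HasSum (fun k => ∫ z in Ioi (0 : ℝ), F k z) (∫ z in Ioi (0 : ℝ), ∑' k, F k z) := by
    refine hasSum_integral_of_summable_integral_norm hFint ?_
    refine hsum.summable.congr fun k => ?_
    rw [← hFval k]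
    exact setIntegral_congr_fun measurableSet_Ioi fun z hz =>
      (Real.norm_of_nonneg (hFnn k z hz)).symm
  have hval := (hI.congr_fun fun k => (hFval k).symm).unique hsum
  simp only [hF, tsum_mul_left] at hval
  refine ⟨not_imp_comm.mp integral_undef ?_, hval⟩
  rw [hval]
  have hp (l : ℕ) : 0 < ∏ i ∈ Finset.range l, (γ + 1 + (i : ℝ)) :=
    Finset.prod_pos fun i _ => by positivity
  have hS : 0 < ∑ l ∈ Finset.range (m + 1), (m.choose l : ℝ) * (c ^ 2 * t) ^ l /
      ∏ i ∈ Finset.range l, (γ + 1 + (i : ℝ)) := by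
    refine Finset.sum_pos (fun l hl => ?_) ⟨0, by simp⟩
    have := Nat.choose_pos (Nat.lt_succ_iff.mp (Finset.mem_range.mp hl))
    have := hp l
    positivity
  have := hp m
  positivity

/-- for every `j ≥ 0`, `s > 0`, `y > 0`, the integral
`∫₀^∞ K(y, z, s) φ_j(z) dz` converges absolutely and equals `e^{−λ_j s} φ_j(y)`. -/
theorem stmt_11 (n : ℕ) (hn : 8 ≤ n)
    (α b γ : ℝ)
    (hα : α = (3 - (n : ℝ) + Real.sqrt ((n : ℝ) ^ 2 - 10 * (n : ℝ) + 17)) / 2)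
    (hb : b = α + ((n : ℝ) - 1) / 2)
    (hγ : γ = ((n : ℝ) - 3) / 2 + α)
    (j : ℕ) (lam : ℝ) (hlam : lam = -(1 - α) / 2 + (j : ℝ))
    (φ : ℝ → ℝ)
    (hφ : ∀ y : ℝ, φ y = y ^ α * ∑ m ∈ Finset.range (j + 1),
      (-1 : ℝ) ^ m * (j.choose m : ℝ) * (y ^ 2 / 4) ^ m
        / ∏ k ∈ Finset.range m, (b + (k : ℝ)))
    (Iγ : ℝ → ℝ)
    (hI : ∀ x : ℝ, Iγ x = ∑' m : ℕ,
      (x / 2) ^ (2 * (m : ℝ) + γ) / ((m.factorial : ℝ) * Real.Gamma ((m : ℝ) + γ + 1)))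
    (K : ℝ → ℝ → ℝ → ℝ)
    (hK : ∀ y z s : ℝ, K y z s
      = (z / y) ^ ((n : ℝ) / 2 - 1) * Real.sqrt (y * z)
        * (Real.exp (((n : ℝ) - 1) * s / 4) / (2 * (1 - Real.exp (-s))))
        * Iγ (Real.exp (-s / 2) * y * z / (2 * (1 - Real.exp (-s))))
        * Real.exp (-(Real.exp (-s) * y ^ 2 + z ^ 2) / (4 * (1 - Real.exp (-s))))) :
    ∀ s : ℝ, 0 < s → ∀ y : ℝ, 0 < y →
      IntegrableOn (fun z => K y z s * φ z) (Ioi 0) ∧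
      ∫ z in Ioi (0 : ℝ), K y z s * φ z = Real.exp (-lam * s) * φ y := by
  intro s hs y hy
  have hn' : (8 : ℝ) ≤ n := by exact_mod_cast hn
  have hγ1 : -1 < γ := by
    have := Real.sqrt_nonneg ((n : ℝ) ^ 2 - 10 * (n : ℝ) + 17)
    rw [hγ, hα]
    linarith
  have hbγ : b = γ + 1 := by rw [hb, hγ]; ring
  set t : ℝ := 1 - Real.exp (-s) with ht_def
  have ht : 0 < t := by
    have : Real.exp (-s) < 1 := by simpa using hs
    linarith
  set c : ℝ := Real.exp (-s / 2) * y / (2 * t) with hc_def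
  have hc : 0 < c := by positivity
  have hq : Real.exp (-s / 2) ^ 2 = Real.exp (-s) := by
    rw [← Real.exp_nat_mul]; congr 1; push_cast; ring
  have hct : c ^ 2 * t = Real.exp (-s) * y ^ 2 / (4 * t) := by
    rw [hc_def, ← hq]; field_simp; ring
  set C : ℝ := y ^ ((3 - (n : ℝ)) / 2) * (Real.exp (((n : ℝ) - 1) * s / 4) / (2 * t)) *
    Real.exp (-(c ^ 2 * t)) with hC
  set f : ℕ → ℝ → ℝ := fun m z => z ^ (γ + 1) * (z ^ 2 / 4) ^ m * Real.exp (-z ^ 2 / (4 * t)) *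
      ∑' k : ℕ, (c * z / 2) ^ (2 * (k : ℝ) + γ) /
        ((k.factorial : ℝ) * Real.Gamma ((k : ℝ) + γ + 1)) with hf
  set w : ℕ → ℝ := fun m => (-1 : ℝ) ^ m * (j.choose m : ℝ) / ∏ k ∈ Finset.range m, (b + (k : ℝ))
    with hw
  have hKf : EqOn (fun z => K y z s * φ z)
      (fun z => C * ∑ m ∈ Finset.range (j + 1), w m * f m z) (Ioi 0) := by
    intro z hz
    have hz : 0 < z := hz
    have h1 : (z / y) ^ ((n : ℝ) / 2 - 1) * Real.sqrt (y * z) * z ^ α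
        = y ^ ((3 - (n : ℝ)) / 2) * z ^ (γ + 1) := by
      rw [Real.sqrt_eq_rpow, Real.mul_rpow hy.le hz.le, Real.div_rpow hz.le hy.le, div_eq_mul_inv,
        ← Real.rpow_neg hy.le]
      have h2 : z ^ (γ + 1) = z ^ ((n : ℝ) / 2 - 1) * z ^ (1 / 2 : ℝ) * z ^ α := by
        rw [← Real.rpow_add hz, ← Real.rpow_add hz, hγ]; congr 1; ring
      have h3 : y ^ ((3 - (n : ℝ)) / 2) = y ^ (-((n : ℝ) / 2 - 1)) * y ^ (1 / 2 : ℝ) := by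
        rw [← Real.rpow_add hy]; congr 1; ring
      rw [h2, h3]; ring
    have h4 : Real.exp (-(Real.exp (-s) * y ^ 2 + z ^ 2) / (4 * t))
        = Real.exp (-(c ^ 2 * t)) * Real.exp (-z ^ 2 / (4 * t)) := by
      rw [← Real.exp_add, hct]; congr 1; ring
    have h5 : Real.exp (-s / 2) * y * z / (2 * t) = c * z := by rw [hc_def]; ring
    have h6 : ∑ m ∈ Finset.range (j + 1), w m * f m z = z ^ (γ + 1) *
        Real.exp (-z ^ 2 / (4 * t)) * Iγ (c * z) * ∑ m ∈ Finset.range (j + 1),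
          (-1 : ℝ) ^ m * (j.choose m : ℝ) * (z ^ 2 / 4) ^ m
            / ∏ k ∈ Finset.range m, (b + (k : ℝ)) := by
      rw [Finset.mul_sum]
      refine Finset.sum_congr rfl fun m _ => ?_
      simp only [hw, hf, ← hI]
      ring
    simp only
    rw [h6, hK, hφ, h4, h5, hC]
    linear_combination ((Real.exp (((n : ℝ) - 1) * s / 4) / (2 * t)) * Iγ (c * z) *
      (Real.exp (-(c ^ 2 * t)) * Real.exp (-z ^ 2 / (4 * t))) * ∑ m ∈ Finset.range (j + 1),
          (-1 : ℝ) ^ m * (j.choose m : ℝ) * (z ^ 2 / 4) ^ m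
            / ∏ k ∈ Finset.range m, (b + (k : ℝ))) * h1
  have h_integrable (m : ℕ) : IntegrableOn (fun z => w m * f m z) (Ioi 0) :=
    (integral_rpow_mul_exp_mul_besselI hγ1 hc ht m).1.const_mul _
  have h_integrable_sum : IntegrableOn (fun z => C * ∑ m ∈ Finset.range (j + 1), w m * f m z) (Ioi 0) :=
    (integrable_finsetSum _ fun m _ => h_integrable m).const_mul _
  refine ⟨h_integrable_sum.congr_fun hKf.symm measurableSet_Ioi, ?_⟩
  rw [setIntegral_congr_fun measurableSet_Ioi hKf, integral_const_mul,
    integral_finsetSum _ fun m _ => h_integrable m]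
  have hp (l : ℕ) : 0 < ∏ i ∈ Finset.range l, (b + (i : ℝ)) :=
    Finset.prod_pos fun i _ => by have : 0 < b := by linarith
                                  positivity
  have hterm (m : ℕ) : ∫ z in Ioi (0 : ℝ), w m * f m z
      = (c / 2) ^ γ * (4 * t) ^ (γ + 1) / 2 * Real.exp (c ^ 2 * t) *
        ((-1 : ℝ) ^ m * (j.choose m : ℝ) * t ^ m * ∑ l ∈ Finset.range (m + 1),
          (m.choose l : ℝ) * (c ^ 2 * t) ^ l / ∏ i ∈ Finset.range l, (b + (i : ℝ))) := by
    rw [integral_const_mul, (integral_rpow_mul_exp_mul_besselI hγ1 hc ht m).2, ← hbγ]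
    have := hp m
    simp only [hw]
    field_simp
  have hX : t * (c ^ 2 * t) = Real.exp (-s) * (y ^ 2 / 4) := by rw [hct]; field_simp
  have hsum : ∑ l ∈ Finset.range (j + 1), (-1 : ℝ) ^ l * (j.choose l : ℝ) * (t * (c ^ 2 * t)) ^ l *
        (1 - t) ^ (j - l) / ∏ i ∈ Finset.range l, (b + (i : ℝ))
      = Real.exp (-s) ^ j * ∑ m ∈ Finset.range (j + 1),
      (-1 : ℝ) ^ m * (j.choose m : ℝ) * (y ^ 2 / 4) ^ m
        / ∏ k ∈ Finset.range m, (b + (k : ℝ)) := by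
    rw [Finset.mul_sum]
    refine Finset.sum_congr rfl fun l hl => ?_
    have hl' : l ≤ j := Nat.lt_succ_iff.mp (Finset.mem_range.mp hl)
    rw [hX, mul_pow, show 1 - t = Real.exp (-s) by rw [ht_def]; ring,
      ← Nat.add_sub_of_le hl', pow_add, Nat.add_sub_cancel_left]
    ring
  have hpre : C * ((c / 2) ^ γ * (4 * t) ^ (γ + 1) / 2 * Real.exp (c ^ 2 * t))
      * Real.exp (-s) ^ j = Real.exp (-lam * s) * y ^ α := by
    have h1 : (c / 2) ^ γ * (4 * t) ^ (γ + 1) = Real.exp (-s / 2 * γ) * y ^ γ * (4 * t) := by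
      rw [Real.rpow_add_one (by positivity), ← mul_assoc, ← Real.mul_rpow (by positivity)
        (by positivity), show c / 2 * (4 * t) = Real.exp (-s / 2) * y by rw [hc_def]; field_simp; ring,
        Real.mul_rpow (by positivity) hy.le, ← Real.exp_mul]
    have h2 : y ^ α = y ^ ((3 - (n : ℝ)) / 2) * y ^ γ := by
      rw [← Real.rpow_add hy, hγ]; congr 1; ring
    have h3 : Real.exp (-lam * s) = Real.exp (((n : ℝ) - 1) * s / 4) * Real.exp (-s / 2 * γ) *
        Real.exp (-s) ^ j := by
      rw [← Real.exp_nat_mul, ← Real.exp_add, ← Real.exp_add, hlam, hγ]; congr 1; ring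
    have h4 : Real.exp (-(c ^ 2 * t)) * Real.exp (c ^ 2 * t) = 1 := by
      rw [← Real.exp_add]; simp
    have h5 : t⁻¹ * t = 1 := inv_mul_cancel₀ ht.ne'
    rw [h1, h2, h3, hC]
    clear_value t
    linear_combination (y ^ ((3 - (n : ℝ)) / 2) * y ^ γ * Real.exp (((n : ℝ) - 1) * s / 4) *
      Real.exp (-s / 2 * γ) * Real.exp (-s) ^ j) * (t⁻¹ * t * h4 + h5)
  simp only [hterm]
  rw [← Finset.mul_sum, sum_neg_pow_choose_mul_sum, hsum, hφ, ← mul_assoc (Real.exp (-lam * s)),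
    ← hpre]
  ring
end

section
/- Let l ≥ 2 be an integer, A > 0, β ≥ 1, ρ ∈ (0, 1), R ≥ 1, ϑ ∈ (0, 1). Suppose f = f₁ + f₂ + f₃ where f₁, f₂, f₃ : (0, ∞) × ℝ → ℝ are continuous and, for some s₀ ∈ ℝ, for all s ≥ s₀ and y > 0: |f₁(y, s)| ≤ A e^{−2λ_l s} y^{−3}(y^{2α} + y^{4λ_l + 2}) with f₁(y, s) = 0 unless β e^{−σ_l s} < y < ρ e^{s/2}; |f₂(y, s)| ≤ A e^{−λ_l s} y^{α−2} with f₂(y, s) = 0 unless β e^{−σ_l s} < y < (β + 1) e^{−σ_l s}; and |f₃(y, s)| ≤ A e^{−λ_l s} y^{2λ_l + 2} with f₃(y, s) = 0 unless ρ e^{s/2} − 1 < y < ρ e^{s/2}. Then there exist S₀ and C > 0, depending only on n, l, A, ρ, β, R, ϑ, such that whenever s₀ ≥ S₀, for every s with s₀ < s ≤ s₀ + 1 and every y with (1/2) e^{−ϑ σ_l s} ≤ y ≤ 2R, one has |∫_{s₀}^{s} ∫₀^∞ K(y, z, s − τ) f(z, τ) dz dτ| ≤ C e^{−(1 + κ̃)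 λ_l s₀} y^α. -/
open Set MeasureTheory

lemma lintegral_rpow_mul_exp_neg_mul {p r : ℝ} (hp : 0 < p) (hr : 0 < r) :
    ∫⁻ u in Ioi (0 : ℝ), ENNReal.ofReal (u ^ (p - 1) * Real.exp (-(r * u)))
      = ENNReal.ofReal ((1 / r) ^ p * Real.Gamma p) := by
  have key := Real.integral_rpow_mul_exp_neg_mul_Ioi hp hr
  have hpos : 0 < (1 / r) ^ p * Real.Gamma p :=
    mul_pos (by positivity) (Real.Gamma_pos_of_pos hp)
  rw [← key, ofReal_integral_eq_lintegral_ofReal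
    (.of_integral_ne_zero (by rw [key]; exact hpos.ne'))]
  filter_upwards [ae_restrict_mem measurableSet_Ioi] with u (hu : 0 < u)
  simp only [Pi.zero_apply]
  positivity

lemma lintegral_rpow_mul_exp_neg_mul_sq {q b : ℝ} (hq : -1 < q) (hb : 0 < b) :
    ∫⁻ z in Ioi (0 : ℝ), ENNReal.ofReal (z ^ q * Real.exp (-b * z ^ 2))
      = ENNReal.ofReal (b ^ (-(q + 1) / 2) * (1 / 2) * Real.Gamma ((q + 1) / 2)) := by
  have key := integral_rpow_mul_exp_neg_mul_rpow two_pos hq hb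
  simp only [Real.rpow_two] at key
  have hpos : 0 < b ^ (-(q + 1) / 2) * (1 / 2) * Real.Gamma ((q + 1) / 2) :=
    mul_pos (by positivity) (Real.Gamma_pos_of_pos (by linarith))
  rw [← key, ofReal_integral_eq_lintegral_ofReal
    (.of_integral_ne_zero (by rw [key]; exact hpos.ne'))]
  filter_upwards [ae_restrict_mem measurableSet_Ioi] with u (hu : 0 < u)
  simp only [Pi.zero_apply]
  positivity

/-- The transition density at time `t`, started at `a`, of the Bessel process of index `γ`
(generator `∂² + (2γ + 1) / z ∂`), as an `ℝ≥0∞`-valued power series. -/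
noncomputable def besselDensity (γ t a z : ℝ) : ENNReal :=
  ∑' m : ℕ, ENNReal.ofReal (z ^ (γ + 1) * a ^ (-γ) / (2 * t)
    * ((a * z / (4 * t)) ^ (2 * (m : ℝ) + γ) / ((m.factorial : ℝ) * Real.Gamma ((m : ℝ) + γ + 1)))
    * Real.exp (-(a ^ 2 + z ^ 2) / (4 * t)))

lemma measurable_besselDensity (γ : ℝ) :
    Measurable fun x : (ℝ × ℝ) × ℝ => besselDensity γ x.1.1 x.1.2 x.2 := by
  unfold besselDensity
  refine Measurable.tsum fun m => ?_
  fun_prop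

lemma measurable_besselDensity_space (γ t a : ℝ) : Measurable fun z => besselDensity γ t a z :=
  (measurable_besselDensity γ).comp (g := fun x : (ℝ × ℝ) × ℝ => besselDensity γ x.1.1 x.1.2 x.2)
    (f := fun z => ((t, a), z)) (by fun_prop)

lemma besselDensity_term_mul_exp {γ t a u z : ℝ} (ht : 0 < t) (ha : 0 < a)
    (hz : 0 < z) (m : ℕ) :
    z ^ (γ + 1) * a ^ (-γ) / (2 * t)
      * ((a * z / (4 * t)) ^ (2 * (m : ℝ) + γ) / ((m.factorial : ℝ) * Real.Gamma ((m : ℝ) + γ + 1)))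
      * Real.exp (-(a ^ 2 + z ^ 2) / (4 * t)) * Real.exp (-u * z ^ 2)
    = a ^ (2 * (m : ℝ)) * (4 * t) ^ (-(2 * (m : ℝ) + γ)) / (2 * t)
        * Real.exp (-a ^ 2 / (4 * t)) / ((m.factorial : ℝ) * Real.Gamma ((m : ℝ) + γ + 1))
      * (z ^ (2 * (m : ℝ) + 2 * γ + 1) * Real.exp (-((1 + 4 * u * t) / (4 * t)) * z ^ 2)) := by
  have e1 : Real.exp (-(a ^ 2 + z ^ 2) / (4 * t)) * Real.exp (-u * z ^ 2)
      = Real.exp (-a ^ 2 / (4 * t)) * Real.exp (-((1 + 4 * u * t) / (4 * t)) * z ^ 2) := by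
    rw [← Real.exp_add, ← Real.exp_add]; congr 1; field_simp; ring
  have e2 : z ^ (2 * (m : ℝ) + 2 * γ + 1) = z ^ (γ + 1) * z ^ (2 * (m : ℝ) + γ) := by
    rw [← Real.rpow_add hz]; congr 1; ring
  have e3 : a ^ (2 * (m : ℝ)) = a ^ (-γ) * a ^ (2 * (m : ℝ) + γ) := by
    rw [← Real.rpow_add ha]; congr 1; ring
  rw [mul_assoc, e1, e2, e3, Real.div_rpow (by positivity) (by positivity),
    Real.mul_rpow ha.le hz.le, Real.rpow_neg (by positivity : 0 ≤ 4 * t)]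
  ring

/-- Gaussian expectations of the Bessel process. -/
lemma lintegral_besselDensity_mul_exp {γ t a u : ℝ} (hγ : 0 < γ) (ht : 0 < t) (ha : 0 < a)
    (hu : 0 < 1 + 4 * u * t) :
    ∫⁻ z in Ioi (0 : ℝ), besselDensity γ t a z * ENNReal.ofReal (Real.exp (-u * z ^ 2))
      = ENNReal.ofReal
        ((1 + 4 * u * t) ^ (-(γ + 1)) * Real.exp (-(u * a ^ 2 / (1 + 4 * u * t)))) := by
  have hΓ (m : ℕ) : 0 < Real.Gamma ((m : ℝ) + γ + 1) := Real.Gamma_pos_of_pos (by positivity)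
  have hterm (m : ℕ) : ∫⁻ z in Ioi (0 : ℝ), ENNReal.ofReal (z ^ (γ + 1) * a ^ (-γ) / (2 * t)
      * ((a * z / (4 * t)) ^ (2 * (m : ℝ) + γ)
        / ((m.factorial : ℝ) * Real.Gamma ((m : ℝ) + γ + 1)))
      * Real.exp (-(a ^ 2 + z ^ 2) / (4 * t))) * ENNReal.ofReal (Real.exp (-u * z ^ 2))
      = ENNReal.ofReal ((1 + 4 * u * t) ^ (-(γ + 1)) * Real.exp (-a ^ 2 / (4 * t))
        * ((a ^ 2 / (4 * t * (1 + 4 * u * t))) ^ m / (m.factorial : ℝ))) := by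
    have hc : 0 ≤ a ^ (2 * (m : ℝ)) * (4 * t) ^ (-(2 * (m : ℝ) + γ)) / (2 * t)
        * Real.exp (-a ^ 2 / (4 * t)) / ((m.factorial : ℝ) * Real.Gamma ((m : ℝ) + γ + 1)) := by
      have := hΓ m
      positivity
    rw [setLIntegral_congr_fun (g := fun z => ENNReal.ofReal _ * ENNReal.ofReal
        (z ^ (2 * (m : ℝ) + 2 * γ + 1) * Real.exp (-((1 + 4 * u * t) / (4 * t)) * z ^ 2)))
        measurableSet_Ioi fun z (hz : 0 < z) => by
          rw [← ENNReal.ofReal_mul' (Real.exp_nonneg _),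
            besselDensity_term_mul_exp ht ha hz m, ENNReal.ofReal_mul hc],
      lintegral_const_mul' _ _ ENNReal.ofReal_ne_top,
      lintegral_rpow_mul_exp_neg_mul_sq (by have : (0:ℝ) ≤ m := by positivity
                                            linarith) (by positivity),
      ← ENNReal.ofReal_mul hc]
    congr 1
    have h1 : (2 * (m : ℝ) + 2 * γ + 1 + 1) / 2 = m + γ + 1 := by ring
    have h2 : -(2 * (m : ℝ) + 2 * γ + 1 + 1) / 2 = -(γ + 1) + -(m : ℝ) := by ring
    have h3 : -(2 * (m : ℝ) + γ) = -(γ + 1) + -(m : ℝ) + -(m : ℝ) + 1 := by ring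
    rw [h1, h2, Real.div_rpow hu.le (by positivity), Real.rpow_add hu,
      Real.rpow_add (by positivity : 0 < 4 * t), h3, Real.rpow_add (by positivity : 0 < 4 * t),
      Real.rpow_add (by positivity : 0 < 4 * t), Real.rpow_add (by positivity : 0 < 4 * t),
      Real.rpow_one, Real.rpow_mul ha.le, Real.rpow_two, div_pow, mul_pow]
    simp only [Real.rpow_neg hu.le, Real.rpow_neg (by positivity : 0 ≤ 4 * t), Real.rpow_natCast]
    have := (hΓ m).ne'
    field_simp
    norm_num
  have hsum : HasSum (fun m : ℕ => (1 + 4 * u * t) ^ (-(γ + 1)) * Real.exp (-a ^ 2 / (4 * t))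
        * ((a ^ 2 / (4 * t * (1 + 4 * u * t))) ^ m / (m.factorial : ℝ)))
      ((1 + 4 * u * t) ^ (-(γ + 1)) * Real.exp (-a ^ 2 / (4 * t))
        * Real.exp (a ^ 2 / (4 * t * (1 + 4 * u * t)))) := by
    have h := NormedSpace.expSeries_div_hasSum_exp (a ^ 2 / (4 * t * (1 + 4 * u * t)))
    rw [← Real.exp_eq_exp_ℝ] at h
    exact h.mul_left _
  simp only [besselDensity, ← ENNReal.tsum_mul_right]
  rw [lintegral_tsum fun m => by fun_prop, tsum_congr hterm,
    ← ENNReal.ofReal_tsum_of_nonneg (fun m => by positivity) hsum.summable, hsum.tsum_eq,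
    mul_assoc, ← Real.exp_add]
  congr 3
  have hne : 1 + 4 * t * u ≠ 0 := by rw [mul_right_comm]; exact hu.ne'
  field_simp
  ring

lemma lintegral_time_le {γ u b s₀ s : ℝ} (hu : 0 < u) (hs : s ≤ s₀ + 1) :
    ∫⁻ τ in Ioo s₀ s, ENNReal.ofReal ((1 + 4 * u * (1 - Real.exp (-(s - τ)))) ^ (-(γ + 1))
        * Real.exp (-(u * b / (1 + 4 * u * (1 - Real.exp (-(s - τ)))))))
      ≤ ENNReal.ofReal (Real.exp 1 / (4 * u))
        * ∫⁻ v in Ioo (0 : ℝ) 1, ENNReal.ofReal (v ^ (γ - 1) * Real.exp (-(u * b * v))) := by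
  set w : ℝ → ℝ := fun τ => 1 + 4 * u * (1 - Real.exp (-(s - τ))) with hw
  have hw1 : ∀ τ ∈ Ioo s₀ s, 1 < w τ := fun τ hτ => by
    have : Real.exp (-(s - τ)) < 1 := Real.exp_lt_one_iff.2 (by linarith [hτ.2])
    have : 0 < 4 * u * (1 - Real.exp (-(s - τ))) := by
      have : 0 < 1 - Real.exp (-(s - τ)) := by linarith
      positivity
    simp only [hw]; linarith
  have hderiv : ∀ τ ∈ Ioo s₀ s, HasDerivWithinAt (fun τ => (w τ)⁻¹)
      (4 * u * Real.exp (-(s - τ)) / w τ ^ 2) (Ioo s₀ s) τ := fun τ hτ => by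
    have h1 : HasDerivAt (fun τ : ℝ => -(s - τ)) 1 τ := by
      simpa using (hasDerivAt_id' τ).sub_const s
    have h2 : HasDerivAt w (-(4 * u * Real.exp (-(s - τ)))) τ := by
      have := ((h1.exp.const_sub 1).const_mul (4 * u)).const_add 1
      simpa [hw] using this
    refine (h2.fun_inv (by linarith [hw1 τ hτ])).hasDerivWithinAt.congr_deriv ?_
    rw [neg_neg]
  have hinj : InjOn (fun τ => (w τ)⁻¹) (Ioo s₀ s) := fun x _ x' _ h => by
    have h1 : w x = w x' := inv_injective h
    simp only [hw, add_right_inj, mul_eq_mul_left_iff] at h1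
    rcases h1 with h1 | h1
    · have := Real.exp_injective (sub_right_injective h1)
      linarith
    · linarith
  have himg : (fun τ => (w τ)⁻¹) '' Ioo s₀ s ⊆ Ioo 0 1 := by
    rintro _ ⟨τ, hτ, rfl⟩
    have := hw1 τ hτ
    exact ⟨by positivity, inv_lt_one_of_one_lt₀ this⟩
  calc _ ≤ ∫⁻ τ in Ioo s₀ s, ENNReal.ofReal (Real.exp 1 / (4 * u))
        * (ENNReal.ofReal |4 * u * Real.exp (-(s - τ)) / w τ ^ 2|
          * ENNReal.ofReal ((w τ)⁻¹ ^ (γ - 1) * Real.exp (-(u * b * (w τ)⁻¹)))) := by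
        refine setLIntegral_mono' measurableSet_Ioo fun τ hτ => ?_
        have hwp : 0 < w τ := by linarith [hw1 τ hτ]
        rw [← ENNReal.ofReal_mul (abs_nonneg _), ← ENNReal.ofReal_mul (by positivity),
          abs_of_pos (by positivity)]
        refine ENNReal.ofReal_le_ofReal ?_
        have h1 : 1 ≤ Real.exp 1 * Real.exp (-(s - τ)) := by
          rw [← Real.exp_add]
          exact Real.one_le_exp (by linarith [hτ.1])
        have h2 : (w τ)⁻¹ ^ (γ - 1) = (w τ) ^ (-(γ + 1)) * w τ ^ 2 := by
          rw [Real.inv_rpow hwp.le, ← Real.rpow_neg hwp.le, ← Real.rpow_two, ← Real.rpow_add hwp]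
          congr 1; ring
        calc _ ≤ (w τ ^ (-(γ + 1)) * Real.exp (-(u * b / w τ)))
              * (Real.exp 1 * Real.exp (-(s - τ))) := le_mul_of_one_le_right (by positivity) h1
          _ = _ := by
            rw [h2, ← div_eq_mul_inv]
            field_simp
    _ = ENNReal.ofReal (Real.exp 1 / (4 * u)) * ∫⁻ v in (fun τ => (w τ)⁻¹) '' Ioo s₀ s,
          ENNReal.ofReal (v ^ (γ - 1) * Real.exp (-(u * b * v))) := by
        rw [lintegral_const_mul' _ _ ENNReal.ofReal_ne_top,
          lintegral_image_eq_lintegral_abs_deriv_mul measurableSet_Ioo hderiv hinj]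
    _ ≤ _ := by gcongr

lemma lintegral_besselDensity_mul_rpow_neg {γ p t a ε : ℝ} (hγ : 0 < γ) (hp : 0 < p) (ht : 0 < t)
    (ha : 0 < a) :
    ∫⁻ z in Ioi (0 : ℝ), besselDensity γ t a z * ENNReal.ofReal ((z ^ 2 + ε ^ 2) ^ (-p))
      = ENNReal.ofReal (1 / Real.Gamma p) * ∫⁻ u in Ioi (0 : ℝ),
        ENNReal.ofReal (u ^ (p - 1) * Real.exp (-(ε ^ 2 * u)))
          * ENNReal.ofReal ((1 + 4 * u * t) ^ (-(γ + 1))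
            * Real.exp (-(u * a ^ 2 / (1 + 4 * u * t)))) := by
  have hΓ := Real.Gamma_pos_of_pos hp
  have hmeas := measurable_besselDensity_space γ t a
  calc _ = ∫⁻ z in Ioi (0 : ℝ), ENNReal.ofReal (1 / Real.Gamma p) * ∫⁻ u in Ioi (0 : ℝ),
        besselDensity γ t a z * (ENNReal.ofReal (u ^ (p - 1) * Real.exp (-(ε ^ 2 * u)))
          * ENNReal.ofReal (Real.exp (-u * z ^ 2))) := by
        refine setLIntegral_congr_fun measurableSet_Ioi fun z (hz : 0 < z) => ?_
        have hr : 0 < z ^ 2 + ε ^ 2 := by positivity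
        rw [lintegral_const_mul _ (by fun_prop), mul_left_comm]
        congr 1
        rw [setLIntegral_congr_fun (g := fun u => ENNReal.ofReal
          (u ^ (p - 1) * Real.exp (-((z ^ 2 + ε ^ 2) * u)))) measurableSet_Ioi fun u (hu : 0 < u) => by
            rw [← ENNReal.ofReal_mul' (Real.exp_nonneg _), mul_assoc, ← Real.exp_add]
            congr 4; ring, lintegral_rpow_mul_exp_neg_mul hp hr,
          ← ENNReal.ofReal_mul (by positivity)]
        congr 1
        rw [one_div (z ^ 2 + ε ^ 2), Real.inv_rpow hr.le, Real.rpow_neg hr.le]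
        field_simp
    _ = _ := by
        rw [lintegral_const_mul' _ _ ENNReal.ofReal_ne_top, lintegral_lintegral_swap (by fun_prop)]
        congr 1
        refine setLIntegral_congr_fun measurableSet_Ioi fun u (hu : 0 < u) => ?_
        simp only [mul_left_comm (besselDensity _ _ _ _)]
        rw [lintegral_const_mul' _ _ ENNReal.ofReal_ne_top,
          lintegral_besselDensity_mul_exp hγ ht ha (by positivity)]

lemma lintegral_lintegral_besselDensity_mul_rpow_neg_le {γ p ε s₀ s y : ℝ} (hγ : 0 < γ)
    (hp : 0 < p) (hy : 0 < y) (hs : s ≤ s₀ + 1) :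
    ∫⁻ τ in Ioo s₀ s, ∫⁻ z in Ioi (0 : ℝ),
        besselDensity γ (1 - Real.exp (-(s - τ))) (Real.exp (-(s - τ) / 2) * y) z
          * ENNReal.ofReal ((z ^ 2 + ε ^ 2) ^ (-p))
      ≤ ENNReal.ofReal (Real.exp 1 / (4 * Real.Gamma p)) * ∫⁻ u in Ioi (0 : ℝ),
        ENNReal.ofReal (u ^ (p - 1 - 1) * Real.exp (-(ε ^ 2 * u)))
          * ∫⁻ v in Ioo (0 : ℝ) 1, ENNReal.ofReal
            (v ^ (γ - 1) * Real.exp (-(u * (Real.exp (-1) * y ^ 2) * v))) := by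
  have hΓ := Real.Gamma_pos_of_pos hp
  set b := Real.exp (-1) * y ^ 2 with hb
  calc _ ≤ ∫⁻ τ in Ioo s₀ s, ENNReal.ofReal (1 / Real.Gamma p) * ∫⁻ u in Ioi (0 : ℝ),
        ENNReal.ofReal (u ^ (p - 1) * Real.exp (-(ε ^ 2 * u)))
          * ENNReal.ofReal ((1 + 4 * u * (1 - Real.exp (-(s - τ)))) ^ (-(γ + 1))
            * Real.exp (-(u * b / (1 + 4 * u * (1 - Real.exp (-(s - τ))))))) := by
        refine setLIntegral_mono' measurableSet_Ioo fun τ hτ => ?_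
        have ht : 0 < 1 - Real.exp (-(s - τ)) := by
          have := (Real.exp_lt_one_iff (x := -(s - τ))).2 (by linarith [hτ.2])
          linarith
        rw [lintegral_besselDensity_mul_rpow_neg hγ hp ht (by positivity)]
        gcongr ENNReal.ofReal _ * ?_
        refine setLIntegral_mono' measurableSet_Ioi fun u (hu : 0 < u) => ?_
        gcongr
        rw [hb, mul_pow, ← Real.exp_nat_mul]
        gcongr
        push_cast
        linarith [hτ.1]
    _ = ENNReal.ofReal (1 / Real.Gamma p) * ∫⁻ u in Ioi (0 : ℝ),
          ENNReal.ofReal (u ^ (p - 1) * Real.exp (-(ε ^ 2 * u))) * ∫⁻ τ in Ioo s₀ s,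
            ENNReal.ofReal ((1 + 4 * u * (1 - Real.exp (-(s - τ)))) ^ (-(γ + 1))
              * Real.exp (-(u * b / (1 + 4 * u * (1 - Real.exp (-(s - τ))))))) := by
        rw [lintegral_const_mul' _ _ ENNReal.ofReal_ne_top, lintegral_lintegral_swap (by fun_prop)]
        simp only [lintegral_const_mul' _ _ ENNReal.ofReal_ne_top]
    _ ≤ ENNReal.ofReal (1 / Real.Gamma p) * ∫⁻ u in Ioi (0 : ℝ),
          ENNReal.ofReal (Real.exp 1 / 4) * (ENNReal.ofReal (u ^ (p - 1 - 1) * Real.exp (-(ε ^ 2 * u)))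
          * ∫⁻ v in Ioo (0 : ℝ) 1, ENNReal.ofReal (v ^ (γ - 1) * Real.exp (-(u * b * v)))) := by
        gcongr ENNReal.ofReal _ * ?_
        refine setLIntegral_mono' measurableSet_Ioi fun u (hu : 0 < u) => ?_
        refine (mul_le_mul_right (lintegral_time_le hu hs) _).trans_eq ?_
        rw [← mul_assoc, ← mul_assoc (ENNReal.ofReal (Real.exp 1 / 4)),
          ← ENNReal.ofReal_mul (by positivity), ← ENNReal.ofReal_mul (by positivity),
          Real.rpow_sub_one hu.ne' (p - 1)]
        congr 2
        field_simp
    _ = _ := by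
        rw [lintegral_const_mul' _ _ ENNReal.ofReal_ne_top, ← mul_assoc,
          ← ENNReal.ofReal_mul (by positivity)]
        congr 2
        field_simp

/-- Time potential of `(z² + ε²) ^ (-p)` in the range where it is locally integrable uniformly
in `ε`. -/
lemma exists_potential_le_of_lt {γ p : ℝ} (hp : 1 < p) (hpγ : p - 1 < γ) :
    ∃ C : ℝ, 0 < C ∧ ∀ ε s₀ s y : ℝ, 0 < y → s ≤ s₀ + 1 →
      ∫⁻ τ in Ioo s₀ s, ∫⁻ z in Ioi (0 : ℝ),
        besselDensity γ (1 - Real.exp (-(s - τ))) (Real.exp (-(s - τ) / 2) * y) z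
          * ENNReal.ofReal ((z ^ 2 + ε ^ 2) ^ (-p)) ≤ ENNReal.ofReal (C * y ^ (-2 * (p - 1))) := by
  have hΓ := Real.Gamma_pos_of_pos (by linarith : 0 < p)
  have hΓ' := Real.Gamma_pos_of_pos (by linarith : 0 < p - 1)
  have hint : IntegrableOn (fun v : ℝ => v ^ (γ - 1 - (p - 1))) (Ioo 0 1) :=
    (intervalIntegral.integrableOn_Ioo_rpow_iff one_pos).2 (by linarith)
  set M := ∫ v in Ioo (0 : ℝ) 1, v ^ (γ - 1 - (p - 1)) with hM
  have hM0 : 0 ≤ M := setIntegral_nonneg measurableSet_Ioo fun v hv => Real.rpow_nonneg hv.1.le _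
  refine ⟨Real.exp 1 / (4 * Real.Gamma p) * (Real.Gamma (p - 1) * Real.exp (p - 1)) * (M + 1),
    by positivity, fun ε s₀ s y hy hs => ?_⟩
  refine (lintegral_lintegral_besselDensity_mul_rpow_neg_le (by linarith) (by linarith) hy hs).trans
    ?_
  set b := Real.exp (-1) * y ^ 2 with hb
  have hb0 : 0 < b := by positivity
  have hbp : (1 / b) ^ (p - 1) = Real.exp (p - 1) * y ^ (-2 * (p - 1)) := by
    rw [hb, one_div, mul_inv, ← Real.exp_neg, neg_neg,
      Real.mul_rpow (by positivity) (by positivity),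
      ← Real.exp_mul, one_mul, Real.rpow_mul hy.le, Real.rpow_neg hy.le, Real.rpow_two]
  calc _ ≤ ENNReal.ofReal (Real.exp 1 / (4 * Real.Gamma p)) * ∫⁻ u in Ioi (0 : ℝ),
        ∫⁻ v in Ioo (0 : ℝ) 1, ENNReal.ofReal (v ^ (γ - 1))
          * ENNReal.ofReal (u ^ (p - 1 - 1) * Real.exp (-(b * v * u))) := by
        gcongr ENNReal.ofReal _ * ?_
        refine setLIntegral_mono' measurableSet_Ioi fun u (hu : 0 < u) => ?_
        rw [← lintegral_const_mul' _ _ ENNReal.ofReal_ne_top]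
        refine setLIntegral_mono' measurableSet_Ioo fun v hv => ?_
        have hv0 : 0 < v := hv.1
        rw [← ENNReal.ofReal_mul (by positivity), ← ENNReal.ofReal_mul (by positivity)]
        refine ENNReal.ofReal_le_ofReal ?_
        have h1 : Real.exp (-(ε ^ 2 * u)) ≤ 1 := Real.exp_le_one_iff.2 (by
          have : 0 ≤ ε ^ 2 * u := by positivity
          linarith)
        calc _ = Real.exp (-(ε ^ 2 * u)) * (v ^ (γ - 1) * (u ^ (p - 1 - 1)
              * Real.exp (-(u * b * v)))) := by ring
          _ ≤ 1 * (v ^ (γ - 1) * (u ^ (p - 1 - 1) * Real.exp (-(u * b * v)))) := by gcongr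
          _ = _ := by rw [one_mul]; congr 4; ring
    _ = ENNReal.ofReal (Real.exp 1 / (4 * Real.Gamma p)) * ∫⁻ v in Ioo (0 : ℝ) 1,
        ENNReal.ofReal (Real.Gamma (p - 1) * (1 / b) ^ (p - 1))
          * ENNReal.ofReal (v ^ (γ - 1 - (p - 1))) := by
        rw [lintegral_lintegral_swap (by fun_prop)]
        congr 1
        refine setLIntegral_congr_fun measurableSet_Ioo fun v hv => ?_
        have hv0 : 0 < v := hv.1
        rw [lintegral_const_mul' _ _ ENNReal.ofReal_ne_top,
          lintegral_rpow_mul_exp_neg_mul (by linarith) (by positivity),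
          ← ENNReal.ofReal_mul (by positivity), ← ENNReal.ofReal_mul (by positivity)]
        congr 1
        rw [Real.rpow_sub hv0 (γ - 1), one_div, one_div, mul_inv,
          Real.mul_rpow (by positivity) (by positivity), Real.inv_rpow hv0.le]
        ring
    _ = ENNReal.ofReal (Real.exp 1 / (4 * Real.Gamma p)
          * (Real.Gamma (p - 1) * (1 / b) ^ (p - 1)) * M) := by
        rw [lintegral_const_mul' _ _ ENNReal.ofReal_ne_top, ← ofReal_integral_eq_lintegral_ofReal hint
          ((ae_restrict_mem measurableSet_Ioo).mono fun v hv => Real.rpow_nonneg hv.1.le _),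
          ← ENNReal.ofReal_mul (by positivity), ← ENNReal.ofReal_mul (by positivity), ← hM,
          ← mul_assoc]
    _ ≤ _ := by
        refine ENNReal.ofReal_le_ofReal ?_
        rw [hbp]
        calc _ ≤ Real.exp 1 / (4 * Real.Gamma p) * (Real.Gamma (p - 1)
                * (Real.exp (p - 1) * y ^ (-2 * (p - 1)))) * (M + 1) := by gcongr; linarith
          _ = _ := by ring

/-- Time potential of `(z² + ε²) ^ (-p)` in the range where it is singular as `ε → 0`. -/
lemma exists_potential_le_of_gt {γ p : ℝ} (hγ : 0 < γ) (hpγ : γ < p - 1) :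
    ∃ C : ℝ, 0 < C ∧ ∀ ε s₀ s y : ℝ, 0 < ε → 0 < y → s ≤ s₀ + 1 →
      ∫⁻ τ in Ioo s₀ s, ∫⁻ z in Ioi (0 : ℝ),
        besselDensity γ (1 - Real.exp (-(s - τ))) (Real.exp (-(s - τ) / 2) * y) z
          * ENNReal.ofReal ((z ^ 2 + ε ^ 2) ^ (-p))
        ≤ ENNReal.ofReal (C * (y ^ (-2 * γ) * ε ^ (-2 * (p - 1 - γ)))) := by
  have hΓ := Real.Gamma_pos_of_pos (by linarith : 0 < p)
  have hΓγ := Real.Gamma_pos_of_pos hγ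
  have hΓ' := Real.Gamma_pos_of_pos (by linarith : 0 < p - 1 - γ)
  refine ⟨Real.exp 1 / (4 * Real.Gamma p) * (Real.Gamma γ * Real.exp γ) * Real.Gamma (p - 1 - γ),
    by positivity, fun ε s₀ s y hε hy hs => ?_⟩
  refine (lintegral_lintegral_besselDensity_mul_rpow_neg_le (by linarith) (by linarith) hy hs).trans
    ?_
  set b := Real.exp (-1) * y ^ 2 with hb
  have hb0 : 0 < b := by positivity
  have hbp : (1 / b) ^ γ = Real.exp γ * y ^ (-2 * γ) := by
    rw [hb, one_div, mul_inv, ← Real.exp_neg, neg_neg,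
      Real.mul_rpow (by positivity) (by positivity),
      ← Real.exp_mul, one_mul, Real.rpow_mul hy.le, Real.rpow_neg hy.le, Real.rpow_two]
  have hεp : (1 / ε ^ 2) ^ (p - 1 - γ) = ε ^ (-2 * (p - 1 - γ)) := by
    rw [one_div, Real.rpow_mul hε.le, Real.rpow_neg hε.le, Real.rpow_two]
  calc _ ≤ ENNReal.ofReal (Real.exp 1 / (4 * Real.Gamma p)) * ∫⁻ u in Ioi (0 : ℝ),
        ENNReal.ofReal (Real.Gamma γ * (1 / b) ^ γ)
          * ENNReal.ofReal (u ^ (p - 1 - γ - 1) * Real.exp (-(ε ^ 2 * u))) := by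
        gcongr ENNReal.ofReal _ * ?_
        refine setLIntegral_mono' measurableSet_Ioi fun u (hu : 0 < u) => ?_
        calc _ ≤ ENNReal.ofReal (u ^ (p - 1 - 1) * Real.exp (-(ε ^ 2 * u)))
                * ∫⁻ v in Ioi (0 : ℝ), ENNReal.ofReal (v ^ (γ - 1) * Real.exp (-(u * b * v))) := by
              gcongr
              exact Ioo_subset_Ioi_self
          _ = _ := by
              rw [lintegral_rpow_mul_exp_neg_mul hγ (by positivity),
                ← ENNReal.ofReal_mul (by positivity), ← ENNReal.ofReal_mul (by positivity)]
              congr 1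
              rw [show p - 1 - γ - 1 = p - 1 - 1 - γ by ring, Real.rpow_sub hu (p - 1 - 1), one_div,
                one_div, mul_inv, Real.mul_rpow (by positivity) (by positivity),
                Real.inv_rpow hu.le]
              ring
    _ = _ := by
        rw [lintegral_const_mul' _ _ ENNReal.ofReal_ne_top,
          lintegral_rpow_mul_exp_neg_mul (by linarith) (by positivity), hbp, hεp,
          ← ENNReal.ofReal_mul (by positivity), ← ENNReal.ofReal_mul (by positivity)]
        congr 1
        ring

lemma lintegral_lintegral_besselDensity_mul_exp_le {γ s₀ s y : ℝ} (hγ : 0 < γ) (hy : 0 < y)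
    (hs : s ≤ s₀ + 1) :
    ∫⁻ τ in Ioo s₀ s, ∫⁻ z in Ioi (0 : ℝ),
        besselDensity γ (1 - Real.exp (-(s - τ))) (Real.exp (-(s - τ) / 2) * y) z
          * ENNReal.ofReal (Real.exp (z ^ 2 / 8))
      ≤ ENNReal.ofReal (2 ^ (γ + 1) * Real.exp (y ^ 2 / 4)) := by
  calc _ ≤ ∫⁻ τ in Ioo s₀ s, ENNReal.ofReal (2 ^ (γ + 1) * Real.exp (y ^ 2 / 4)) := by
        refine setLIntegral_mono' measurableSet_Ioo fun τ hτ => ?_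
        have he : Real.exp (-(s - τ)) < 1 := Real.exp_lt_one_iff.2 (by linarith [hτ.2])
        have he0 := Real.exp_pos (-(s - τ))
        set t := 1 - Real.exp (-(s - τ)) with ht
        have hw : 1 / 2 ≤ 1 + 4 * (-(1 / 8)) * t := by linarith
        have hw0 : 0 < 1 + 4 * (-(1 / 8)) * t := by linarith
        have h := lintegral_besselDensity_mul_exp (γ := γ) (t := t) (u := -(1 / 8))
          (a := Real.exp (-(s - τ) / 2) * y) hγ (by linarith) (by positivity) hw0
        have hfun (z : ℝ) : Real.exp (-(-(1 / 8)) * z ^ 2) = Real.exp (z ^ 2 / 8) := by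
          congr 1; ring
        simp only [hfun] at h
        rw [h]
        refine ENNReal.ofReal_le_ofReal (mul_le_mul ?_ ?_ (Real.exp_nonneg _) (by positivity))
        · calc _ ≤ (1 / 2 : ℝ) ^ (-(γ + 1)) :=
                Real.rpow_le_rpow_of_nonpos (by norm_num) hw (by linarith)
            _ = _ := by rw [one_div, Real.inv_rpow two_pos.le, ← Real.rpow_neg two_pos.le, neg_neg]
        · refine Real.exp_le_exp.2 ?_
          rw [mul_pow, ← Real.exp_nat_mul, show ((2 : ℕ) : ℝ) * (-(s - τ) / 2) = -(s - τ) by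
            push_cast; ring, ← neg_div, div_le_iff₀ hw0]
          nlinarith [mul_le_mul_of_nonneg_right he.le (sq_nonneg y),
            mul_le_mul_of_nonneg_left hw (sq_nonneg y)]
    _ ≤ _ := by
        rw [setLIntegral_const, Real.volume_Ioo]
        refine mul_le_of_le_one_right' ?_
        rw [ENNReal.ofReal_le_one]
        linarith

lemma rpow_le_exp_mul_exp {p z : ℝ} (hp : 0 ≤ p) (hz : 0 < z) :
    z ^ p ≤ Real.exp (2 * p ^ 2) * Real.exp (z ^ 2 / 8) := by
  rw [Real.rpow_def_of_pos hz, ← Real.exp_add]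
  gcongr
  have h1 : Real.log z * p ≤ z * p := by
    gcongr
    linarith [Real.log_le_sub_one_of_pos hz]
  nlinarith [sq_nonneg (z - 4 * p)]

lemma kernel_term_eq {N α γ y z r : ℝ} (hγ : γ = (N - 3) / 2 + α) (hy : 0 < y) (hz : 0 < z)
    (m : ℕ) :
    (z / y) ^ (N / 2 - 1) * Real.sqrt (y * z)
        * (Real.exp ((N - 1) * r / 4) / (2 * (1 - Real.exp (-r))))
        * ((Real.exp (-r / 2) * y * z / (2 * (1 - Real.exp (-r))) / 2) ^ (2 * (m : ℝ) + γ)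
          / ((m.factorial : ℝ) * Real.Gamma ((m : ℝ) + γ + 1)))
        * Real.exp (-(Real.exp (-r) * y ^ 2 + z ^ 2) / (4 * (1 - Real.exp (-r))))
      = Real.exp ((1 - α) * r / 2) * y ^ α * z ^ (-α)
        * (z ^ (γ + 1) * (Real.exp (-r / 2) * y) ^ (-γ) / (2 * (1 - Real.exp (-r)))
          * ((Real.exp (-r / 2) * y * z / (4 * (1 - Real.exp (-r)))) ^ (2 * (m : ℝ) + γ)
            / ((m.factorial : ℝ) * Real.Gamma ((m : ℝ) + γ + 1)))
          * Real.exp (-((Real.exp (-r / 2) * y) ^ 2 + z ^ 2) / (4 * (1 - Real.exp (-r))))) := by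
  have h1 : Real.exp (-r / 2) * y * z / (2 * (1 - Real.exp (-r))) / 2
      = Real.exp (-r / 2) * y * z / (4 * (1 - Real.exp (-r))) := by
    rw [div_div]; ring_nf
  have h2 : (Real.exp (-r / 2) * y) ^ 2 = Real.exp (-r) * y ^ 2 := by
    rw [mul_pow, ← Real.exp_nat_mul]; congr 2; push_cast; ring
  have h3 : (z / y) ^ (N / 2 - 1) * Real.sqrt (y * z) * Real.exp ((N - 1) * r / 4)
      = Real.exp ((1 - α) * r / 2) * y ^ α * z ^ (-α)
        * (z ^ (γ + 1) * (Real.exp (-r / 2) * y) ^ (-γ)) := by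
    rw [Real.sqrt_eq_rpow, Real.mul_rpow hy.le hz.le, Real.div_rpow hz.le hy.le,
      Real.mul_rpow (by positivity) hy.le, ← Real.exp_mul, Real.rpow_def_of_pos hy,
      Real.rpow_def_of_pos hz, Real.rpow_def_of_pos hy, Real.rpow_def_of_pos hz,
      Real.rpow_def_of_pos hy, Real.rpow_def_of_pos hz, Real.rpow_def_of_pos hz,
      Real.rpow_def_of_pos hy, ← Real.exp_sub]
    simp only [← Real.exp_add]
    congr 1
    rw [hγ]
    ring
  rw [h1, h2]
  linear_combination (1 / (2 * (1 - Real.exp (-r)))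
    * ((Real.exp (-r / 2) * y * z / (4 * (1 - Real.exp (-r)))) ^ (2 * (m : ℝ) + γ)
            / ((m.factorial : ℝ) * Real.Gamma ((m : ℝ) + γ + 1)))
    * Real.exp (-(Real.exp (-r) * y ^ 2 + z ^ 2) / (4 * (1 - Real.exp (-r))))) * h3

lemma ofReal_tsum_le {f : ℕ → ℝ} (hf : ∀ m, 0 ≤ f m) :
    ENNReal.ofReal (∑' m, f m) ≤ ∑' m, ENNReal.ofReal (f m) := by
  by_cases h : Summable f
  · exact (ENNReal.ofReal_tsum_of_nonneg hf h).le
  · simp [tsum_eq_zero_of_not_summable h]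

lemma enorm_kernel_le {N α γ y z r : ℝ} (hγ : γ = (N - 3) / 2 + α) (hγ0 : 0 < γ) (hy : 0 < y)
    (hz : 0 < z) (hr : 0 < r) :
    ‖(z / y) ^ (N / 2 - 1) * Real.sqrt (y * z)
        * (Real.exp ((N - 1) * r / 4) / (2 * (1 - Real.exp (-r))))
        * (∑' m : ℕ, (Real.exp (-r / 2) * y * z / (2 * (1 - Real.exp (-r))) / 2) ^ (2 * (m : ℝ) + γ)
          / ((m.factorial : ℝ) * Real.Gamma ((m : ℝ) + γ + 1)))
        * Real.exp (-(Real.exp (-r) * y ^ 2 + z ^ 2) / (4 * (1 - Real.exp (-r))))‖ₑ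
      ≤ ENNReal.ofReal (Real.exp ((1 - α) * r / 2) * y ^ α * z ^ (-α))
        * besselDensity γ (1 - Real.exp (-r)) (Real.exp (-r / 2) * y) z := by
  have ht : 0 < 1 - Real.exp (-r) := by
    have := Real.exp_lt_one_iff.2 (neg_lt_zero.2 hr)
    linarith
  have hΓ (m : ℕ) : 0 < Real.Gamma ((m : ℝ) + γ + 1) := Real.Gamma_pos_of_pos (by positivity)
  rw [← tsum_mul_left, ← tsum_mul_right]
  simp only [kernel_term_eq hγ hy hz]
  have hterm (m : ℕ) : 0 ≤ z ^ (γ + 1) * (Real.exp (-r / 2) * y) ^ (-γ) / (2 * (1 - Real.exp (-r)))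
      * ((Real.exp (-r / 2) * y * z / (4 * (1 - Real.exp (-r)))) ^ (2 * (m : ℝ) + γ)
        / ((m.factorial : ℝ) * Real.Gamma ((m : ℝ) + γ + 1)))
      * Real.exp (-((Real.exp (-r / 2) * y) ^ 2 + z ^ 2) / (4 * (1 - Real.exp (-r)))) := by
    have := hΓ m
    positivity
  rw [tsum_mul_left, Real.enorm_eq_ofReal (mul_nonneg (by positivity) (tsum_nonneg hterm)),
    ENNReal.ofReal_mul (by positivity), besselDensity]
  gcongr
  exact ofReal_tsum_le hterm

lemma rpow_sub_three_le {α ε z : ℝ} (hα : α ≤ 3) (hz : 0 < z) (hε : 0 ≤ ε) (hεz : ε ≤ z) :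
    z ^ (α - 3) ≤ 2 ^ ((3 - α) / 2) * (z ^ 2 + ε ^ 2) ^ (-((3 - α) / 2)) := by
  have h : z ^ 2 + ε ^ 2 ≤ 2 * z ^ 2 := by nlinarith
  calc z ^ (α - 3) = 2 ^ ((3 - α) / 2) * (2 * z ^ 2) ^ (-((3 - α) / 2)) := by
        rw [Real.mul_rpow two_pos.le (by positivity), ← mul_assoc, ← Real.rpow_add two_pos,
          add_neg_cancel, Real.rpow_zero, one_mul, ← Real.rpow_two, ← Real.rpow_mul hz.le]
        congr 1; ring
    _ ≤ _ := by
        gcongr 2 ^ _ * ?_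
        exact Real.rpow_le_rpow_of_nonpos (by positivity) h (by linarith)

section sourceBounds

variable {α lam A β ρ F z τ s₀ s : ℝ}

lemma nonlinear_source_le (hα : α < 0) (hlam : 0 < lam) (hp : 0 ≤ 4 * lam - 1 - α) (hA : 0 < A)
    (hβ : 1 ≤ β) (hz : 0 < z) (hτ : s₀ ≤ τ) (hτs : τ ≤ s)
    (hF : |F| ≤ A * Real.exp (-2 * lam * τ) * z ^ (-3 : ℝ) * (z ^ (2 * α) + z ^ (4 * lam + 2)))
    (hsupp : ¬(β * Real.exp (-(lam / (1 - α)) * τ) < z ∧ z < ρ * Real.exp (τ / 2)) → F = 0) :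
    |F| * z ^ (-α) ≤ A * (2 ^ ((3 - α) / 2) + Real.exp (2 * (4 * lam - 1 - α) ^ 2))
      * Real.exp (-2 * lam * s₀)
      * ((z ^ 2 + Real.exp (-(lam / (1 - α)) * s) ^ 2) ^ (-((3 - α) / 2))
        + Real.exp (z ^ 2 / 8)) := by
  set W := (z ^ 2 + Real.exp (-(lam / (1 - α)) * s) ^ 2) ^ (-((3 - α) / 2)) with hW
  have hW0 : 0 ≤ W := by positivity
  by_cases h : β * Real.exp (-(lam / (1 - α)) * τ) < z ∧ z < ρ * Real.exp (τ / 2)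
  swap
  · rw [hsupp h, abs_zero, zero_mul]
    positivity
  have hσ : 0 < lam / (1 - α) := div_pos hlam (by linarith)
  have hεz : Real.exp (-(lam / (1 - α)) * s) ≤ z := by
    calc _ ≤ Real.exp (-(lam / (1 - α)) * τ) := by
          refine Real.exp_le_exp.2 ?_
          nlinarith
      _ ≤ β * Real.exp (-(lam / (1 - α)) * τ) := le_mul_of_one_le_left (by positivity) hβ
      _ ≤ z := h.1.le
  have h1 := rpow_sub_three_le (by linarith : α ≤ 3) hz (Real.exp_nonneg _) hεz
  have h2 := rpow_le_exp_mul_exp hp hz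
  have h3 : z ^ (-3 : ℝ) * z ^ (2 * α) * z ^ (-α) = z ^ (α - 3) := by
    rw [← Real.rpow_add hz, ← Real.rpow_add hz]; congr 1; ring
  have h4 : z ^ (-3 : ℝ) * z ^ (4 * lam + 2) * z ^ (-α) = z ^ (4 * lam - 1 - α) := by
    rw [← Real.rpow_add hz, ← Real.rpow_add hz]; congr 1; ring
  have hexp : Real.exp (-2 * lam * τ) ≤ Real.exp (-2 * lam * s₀) := by
    refine Real.exp_le_exp.2 ?_
    nlinarith
  calc |F| * z ^ (-α) ≤ A * Real.exp (-2 * lam * τ) * z ^ (-3 : ℝ)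
        * (z ^ (2 * α) + z ^ (4 * lam + 2)) * z ^ (-α) := by gcongr
    _ = A * Real.exp (-2 * lam * τ) * (z ^ (α - 3) + z ^ (4 * lam - 1 - α)) := by
        rw [← h3, ← h4]; ring
    _ ≤ A * Real.exp (-2 * lam * s₀) * (2 ^ ((3 - α) / 2) * W
          + Real.exp (2 * (4 * lam - 1 - α) ^ 2) * Real.exp (z ^ 2 / 8)) := by gcongr
    _ ≤ A * Real.exp (-2 * lam * s₀) * ((2 ^ ((3 - α) / 2) + Real.exp (2 * (4 * lam - 1 - α) ^ 2))
          * (W + Real.exp (z ^ 2 / 8))) := by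
        gcongr
        have ha : (0 : ℝ) ≤ 2 ^ ((3 - α) / 2) * Real.exp (z ^ 2 / 8) := by positivity
        have hb : 0 ≤ Real.exp (2 * (4 * lam - 1 - α) ^ 2) * W := by positivity
        linarith
    _ = _ := by ring

lemma inner_cutoff_source_le (hα : α < 0) (hlam : 0 < lam) (hA : 0 < A)
    (hβ : 1 ≤ β) (hz : 0 < z) (hτ : s₀ ≤ τ) (hτs : τ ≤ s)
    (hF : |F| ≤ A * Real.exp (-lam * τ) * z ^ (α - 2))
    (hsupp : ¬(β * Real.exp (-(lam / (1 - α)) * τ) < z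
      ∧ z < (β + 1) * Real.exp (-(lam / (1 - α)) * τ)) → F = 0) :
    |F| * z ^ (-α) ≤ A * ((β + 1) ^ (1 - α) * 2 ^ ((3 - α) / 2)) * Real.exp (-2 * lam * s₀)
      * ((z ^ 2 + Real.exp (-(lam / (1 - α)) * s) ^ 2) ^ (-((3 - α) / 2))
        + Real.exp (z ^ 2 / 8)) := by
  set W := (z ^ 2 + Real.exp (-(lam / (1 - α)) * s) ^ 2) ^ (-((3 - α) / 2)) with hW
  have hW0 : 0 ≤ W := by positivity
  by_cases h : β * Real.exp (-(lam / (1 - α)) * τ) < z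
      ∧ z < (β + 1) * Real.exp (-(lam / (1 - α)) * τ)
  swap
  · rw [hsupp h, abs_zero, zero_mul]
    positivity
  have hσ : 0 < lam / (1 - α) := div_pos hlam (by linarith)
  have hεz : Real.exp (-(lam / (1 - α)) * s) ≤ z := by
    calc _ ≤ Real.exp (-(lam / (1 - α)) * τ) := by
          refine Real.exp_le_exp.2 ?_
          nlinarith
      _ ≤ β * Real.exp (-(lam / (1 - α)) * τ) := le_mul_of_one_le_left (by positivity) hβ
      _ ≤ z := h.1.le
  have h1 := rpow_sub_three_le (by linarith : α ≤ 3) hz (Real.exp_nonneg _) hεz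
  have h2 : z ^ (1 - α) ≤ (β + 1) ^ (1 - α) * Real.exp (-lam * τ) := by
    calc z ^ (1 - α) ≤ ((β + 1) * Real.exp (-(lam / (1 - α)) * τ)) ^ (1 - α) := by
          gcongr
          · linarith
          · exact h.2.le
      _ = _ := by
          have : 1 - α ≠ 0 := by linarith
          rw [Real.mul_rpow (by positivity) (by positivity), ← Real.exp_mul]
          congr 2
          field_simp
  have h3 : z ^ (α - 2) * z ^ (-α) = z ^ (1 - α) * z ^ (α - 3) := by
    rw [← Real.rpow_add hz, ← Real.rpow_add hz]; congr 1; ring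
  have hexp : Real.exp (-lam * τ) * Real.exp (-lam * τ) ≤ Real.exp (-2 * lam * s₀) := by
    rw [← Real.exp_add]
    refine Real.exp_le_exp.2 ?_
    nlinarith
  calc |F| * z ^ (-α) ≤ A * Real.exp (-lam * τ) * z ^ (α - 2) * z ^ (-α) := by gcongr
    _ = A * Real.exp (-lam * τ) * (z ^ (1 - α) * z ^ (α - 3)) := by rw [← h3]; ring
    _ ≤ A * Real.exp (-lam * τ) * ((β + 1) ^ (1 - α) * Real.exp (-lam * τ)
          * (2 ^ ((3 - α) / 2) * W)) := by gcongr
    _ = A * ((β + 1) ^ (1 - α) * 2 ^ ((3 - α) / 2)) * (Real.exp (-lam * τ) * Real.exp (-lam * τ))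
          * W := by ring
    _ ≤ _ := by
        gcongr
        linarith [Real.exp_pos (z ^ 2 / 8)]

lemma outer_cutoff_source_le (hα : α < 0) (hlam : 0 < lam) (hA : 0 < A) (hρ : 0 < ρ)
    (hz : 0 < z) (hτ : s₀ ≤ τ) (hlarge : 2 ≤ ρ * Real.exp (τ / 2))
    (hF : |F| ≤ A * Real.exp (-lam * τ) * z ^ (2 * lam + 2))
    (hsupp : ¬(ρ * Real.exp (τ / 2) - 1 < z ∧ z < ρ * Real.exp (τ / 2)) → F = 0) :
    |F| * z ^ (-α) ≤ A * ((ρ / 2) ^ (-(2 * lam)) * Real.exp (2 * (4 * lam + 2 - α) ^ 2))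
      * Real.exp (-2 * lam * s₀)
      * ((z ^ 2 + Real.exp (-(lam / (1 - α)) * s) ^ 2) ^ (-((3 - α) / 2))
        + Real.exp (z ^ 2 / 8)) := by
  set W := (z ^ 2 + Real.exp (-(lam / (1 - α)) * s) ^ 2) ^ (-((3 - α) / 2)) with hW
  have hW0 : 0 ≤ W := by positivity
  by_cases h : ρ * Real.exp (τ / 2) - 1 < z ∧ z < ρ * Real.exp (τ / 2)
  swap
  · rw [hsupp h, abs_zero, zero_mul]
    positivity
  have h1 : z ^ (-(2 * lam)) ≤ (ρ / 2) ^ (-(2 * lam)) * Real.exp (-lam * τ) := by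
    calc z ^ (-(2 * lam)) ≤ (ρ / 2 * Real.exp (τ / 2)) ^ (-(2 * lam)) :=
          Real.rpow_le_rpow_of_nonpos (by positivity) (by linarith [h.1]) (by linarith)
      _ = _ := by
          rw [Real.mul_rpow (by positivity) (by positivity), ← Real.exp_mul]
          congr 2
          ring
  have h2 := rpow_le_exp_mul_exp (by linarith : 0 ≤ 4 * lam + 2 - α) hz
  have h3 : z ^ (2 * lam + 2) * z ^ (-α) = z ^ (-(2 * lam)) * z ^ (4 * lam + 2 - α) := by
    rw [← Real.rpow_add hz, ← Real.rpow_add hz]; congr 1; ring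
  have hexp : Real.exp (-lam * τ) * Real.exp (-lam * τ) ≤ Real.exp (-2 * lam * s₀) := by
    rw [← Real.exp_add]
    refine Real.exp_le_exp.2 ?_
    nlinarith
  calc |F| * z ^ (-α) ≤ A * Real.exp (-lam * τ) * z ^ (2 * lam + 2) * z ^ (-α) := by gcongr
    _ = A * Real.exp (-lam * τ) * (z ^ (-(2 * lam)) * z ^ (4 * lam + 2 - α)) := by rw [← h3]; ring
    _ ≤ A * Real.exp (-lam * τ) * ((ρ / 2) ^ (-(2 * lam)) * Real.exp (-lam * τ)
          * (Real.exp (2 * (4 * lam + 2 - α) ^ 2) * Real.exp (z ^ 2 / 8))) := by gcongr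
    _ = A * ((ρ / 2) ^ (-(2 * lam)) * Real.exp (2 * (4 * lam + 2 - α) ^ 2))
          * (Real.exp (-lam * τ) * Real.exp (-lam * τ)) * Real.exp (z ^ 2 / 8) := by ring
    _ ≤ _ := by
        gcongr
        linarith

end sourceBounds

lemma exists_potential_le_exp {α γ lam ϑ κ : ℝ} (hα : α < -1) (hγ : 0 < γ) (hlam : 0 < lam)
    (hϑ : ϑ ∈ Ioo (0 : ℝ) 1) (hκ : κ ≤ 1 - ϑ)
    (hcase : (1 - α) / 2 < γ ∨ α = -2 ∧ γ = 1 / 2 ∧ κ ≤ (1 - ϑ) / 3) :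
    ∃ C : ℝ, 0 < C ∧ ∀ s₀ s y : ℝ, 0 ≤ s₀ → s ≤ s₀ + 1 →
      1 / 2 * Real.exp (-ϑ * (lam / (1 - α)) * s) ≤ y →
      ∫⁻ τ in Ioo s₀ s, ∫⁻ z in Ioi (0 : ℝ),
        besselDensity γ (1 - Real.exp (-(s - τ))) (Real.exp (-(s - τ) / 2) * y) z
          * ENNReal.ofReal
            ((z ^ 2 + Real.exp (-(lam / (1 - α)) * s) ^ 2) ^ (-((3 - α) / 2)))
        ≤ ENNReal.ofReal (C * Real.exp ((1 - κ) * lam * s₀)) := by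
  obtain ⟨hϑ0, hϑ1⟩ := hϑ
  have hpow {k y s : ℝ} (hk : 0 ≤ k) (hy : 1 / 2 * Real.exp (-ϑ * (lam / (1 - α)) * s) ≤ y) :
      y ^ (-k) ≤ 2 ^ k * Real.exp (ϑ * (lam / (1 - α)) * s * k) := by
    calc y ^ (-k) ≤ (1 / 2 * Real.exp (-ϑ * (lam / (1 - α)) * s)) ^ (-k) :=
          Real.rpow_le_rpow_of_nonpos (by positivity) hy (by linarith)
      _ = _ := by
          rw [Real.mul_rpow (by positivity) (by positivity), ← Real.exp_mul, one_div,
            Real.inv_rpow two_pos.le, ← Real.rpow_neg two_pos.le, neg_neg]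
          congr 2
          ring
  rcases hcase with h | ⟨rfl, rfl, hκ'⟩
  · obtain ⟨C, hC, H⟩ := exists_potential_le_of_lt (γ := γ) (p := (3 - α) / 2) (by linarith)
      (by linarith)
    refine ⟨C * (2 ^ (1 - α) * Real.exp lam), by positivity, fun s₀ s y hs₀ hs hy => ?_⟩
    have hy0 : 0 < y := lt_of_lt_of_le (by positivity) hy
    refine (H _ s₀ s y hy0 hs).trans (ENNReal.ofReal_le_ofReal ?_)
    rw [mul_assoc C, mul_assoc (2 ^ (1 - α)), ← Real.exp_add]
    refine mul_le_mul_of_nonneg_left ?_ hC.le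
    rw [show -2 * ((3 - α) / 2 - 1) = -(1 - α) by ring]
    refine (hpow (by linarith) hy).trans ?_
    gcongr 2 ^ _ * Real.exp ?_
    have h1 : 1 - α ≠ 0 := by linarith
    rw [show ϑ * (lam / (1 - α)) * s * (1 - α) = ϑ * lam * s by field_simp]
    have h2 : ϑ * lam * s ≤ ϑ * lam * (s₀ + 1) := by gcongr
    nlinarith [mul_nonneg hlam.le hs₀, mul_nonneg (sub_nonneg.2 hκ) (mul_nonneg hlam.le hs₀)]
  · obtain ⟨C, hC, H⟩ := exists_potential_le_of_gt (γ := 1 / 2) (p := (3 - (-2)) / 2) (by norm_num)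
      (by norm_num)
    refine ⟨C * (2 ^ (1 : ℝ) * Real.exp lam), by positivity, fun s₀ s y hs₀ hs hy => ?_⟩
    have hy0 : 0 < y := lt_of_lt_of_le (by positivity) hy
    refine (H _ s₀ s y (Real.exp_pos _) hy0 hs).trans (ENNReal.ofReal_le_ofReal ?_)
    rw [mul_assoc C, mul_assoc (2 ^ (1 : ℝ)), ← Real.exp_add]
    refine mul_le_mul_of_nonneg_left ?_ hC.le
    rw [show (-2 : ℝ) * (1 / 2) = -1 by norm_num, ← Real.exp_mul]
    calc _ ≤ 2 ^ (1 : ℝ) * Real.exp (ϑ * (lam / (1 - -2)) * s * 1)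
          * Real.exp (-(lam / (1 - -2)) * s * (-2 * ((3 - -2) / 2 - 1 - 1 / 2))) := by
          gcongr
          exact hpow zero_le_one hy
      _ ≤ _ := by
          rw [mul_assoc, ← Real.exp_add]
          gcongr 2 ^ _ * Real.exp ?_
          have h2 : (ϑ + 2) / 3 * lam * s ≤ (ϑ + 2) / 3 * lam * (s₀ + 1) := by gcongr
          nlinarith [mul_nonneg (sub_nonneg.2 hκ') (mul_nonneg hlam.le hs₀)]

/-- Reduction of a Duhamel integral to the two model potentials. -/
lemma enorm_duhamel_le {γ D s₀ s y Pw Pg : ℝ} {W : ℝ → ℝ} {Φ : ℝ → ℝ → ℝ}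
    (hW : Measurable W) (hW0 : ∀ z, 0 ≤ W z) (hD : 0 ≤ D) (hPw : 0 ≤ Pw) (hPg : 0 ≤ Pg)
    (hΦ : ∀ τ ∈ Ioo s₀ s, ∀ z, 0 < z → ‖Φ τ z‖ₑ ≤ ENNReal.ofReal (D * (W z + Real.exp (z ^ 2 / 8)))
      * besselDensity γ (1 - Real.exp (-(s - τ))) (Real.exp (-(s - τ) / 2) * y) z)
    (hw : ∫⁻ τ in Ioo s₀ s, ∫⁻ z in Ioi (0 : ℝ),
        besselDensity γ (1 - Real.exp (-(s - τ))) (Real.exp (-(s - τ) / 2) * y) z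
          * ENNReal.ofReal (W z) ≤ ENNReal.ofReal Pw)
    (hg : ∫⁻ τ in Ioo s₀ s, ∫⁻ z in Ioi (0 : ℝ),
        besselDensity γ (1 - Real.exp (-(s - τ))) (Real.exp (-(s - τ) / 2) * y) z
          * ENNReal.ofReal (Real.exp (z ^ 2 / 8)) ≤ ENNReal.ofReal Pg) :
    |∫ τ in Ioc s₀ s, ∫ z in Ioi (0 : ℝ), Φ τ z| ≤ D * (Pw + Pg) := by
  have hmeas : Measurable fun x : ℝ × ℝ =>
      besselDensity γ (1 - Real.exp (-(s - x.1))) (Real.exp (-(s - x.1) / 2) * y) x.2 :=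
    (measurable_besselDensity γ).comp (g := fun x : (ℝ × ℝ) × ℝ => besselDensity γ x.1.1 x.1.2 x.2)
      (f := fun x : ℝ × ℝ => ((1 - Real.exp (-(s - x.1)), Real.exp (-(s - x.1) / 2) * y), x.2))
      (by fun_prop)
  rw [← ENNReal.ofReal_le_ofReal_iff (by positivity), ← Real.enorm_eq_ofReal_abs]
  calc _ ≤ ∫⁻ τ in Ioc s₀ s, ‖∫ z in Ioi (0 : ℝ), Φ τ z‖ₑ := enorm_integral_le_lintegral_enorm _
    _ = ∫⁻ τ in Ioo s₀ s, ‖∫ z in Ioi (0 : ℝ), Φ τ z‖ₑ := by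
        rw [Measure.restrict_congr_set Ioo_ae_eq_Ioc]
    _ ≤ ∫⁻ τ in Ioo s₀ s, ENNReal.ofReal D * ((∫⁻ z in Ioi (0 : ℝ),
        besselDensity γ (1 - Real.exp (-(s - τ))) (Real.exp (-(s - τ) / 2) * y) z
          * ENNReal.ofReal (W z)) + ∫⁻ z in Ioi (0 : ℝ),
        besselDensity γ (1 - Real.exp (-(s - τ))) (Real.exp (-(s - τ) / 2) * y) z
          * ENNReal.ofReal (Real.exp (z ^ 2 / 8))) := by
        refine setLIntegral_mono' measurableSet_Ioo fun τ hτ => ?_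
        have hτm : Measurable fun z =>
            besselDensity γ (1 - Real.exp (-(s - τ))) (Real.exp (-(s - τ) / 2) * y) z
              * ENNReal.ofReal (W z) :=
          (measurable_besselDensity_space γ _ _).mul hW.ennreal_ofReal
        rw [← lintegral_add_left hτm, ← lintegral_const_mul' _ _ ENNReal.ofReal_ne_top]
        refine (enorm_integral_le_lintegral_enorm _).trans
          (setLIntegral_mono' measurableSet_Ioi fun z hz => (hΦ τ hτ z hz).trans_eq ?_)
        rw [ENNReal.ofReal_mul hD, ENNReal.ofReal_add (hW0 z) (Real.exp_nonneg _)]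
        ring
    _ ≤ _ := by
        rw [lintegral_const_mul' _ _ ENNReal.ofReal_ne_top, lintegral_add_left
          (Measurable.lintegral_prod_right' (f := fun x : ℝ × ℝ => _ * ENNReal.ofReal (W x.2))
            (hmeas.mul (hW.comp measurable_snd).ennreal_ofReal)),
          ENNReal.ofReal_mul hD, ENNReal.ofReal_add hPw hPg]
        gcongr

section exponents

variable {n : ℕ} {α γ : ℝ}

lemma neg_two_le_exponent (hn : 8 ≤ n)
    (hα : α = (3 - (n : ℝ) + Real.sqrt ((n : ℝ) ^ 2 - 10 * (n : ℝ) + 17)) / 2) : -2 ≤ α := by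
  have hn' : (8 : ℝ) ≤ n := by exact_mod_cast hn
  have : (n : ℝ) - 7 ≤ Real.sqrt ((n : ℝ) ^ 2 - 10 * (n : ℝ) + 17) :=
    Real.le_sqrt_of_sq_le (by nlinarith)
  linarith

lemma exponent_lt_neg_one (hn : 8 ≤ n)
    (hα : α = (3 - (n : ℝ) + Real.sqrt ((n : ℝ) ^ 2 - 10 * (n : ℝ) + 17)) / 2) : α < -1 := by
  have hn' : (8 : ℝ) ≤ n := by exact_mod_cast hn
  have : Real.sqrt ((n : ℝ) ^ 2 - 10 * (n : ℝ) + 17) < (n : ℝ) - 5 :=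
    (Real.sqrt_lt' (by linarith)).2 (by nlinarith)
  linarith

lemma bessel_index_pos (hn : 8 ≤ n)
    (hα : α = (3 - (n : ℝ) + Real.sqrt ((n : ℝ) ^ 2 - 10 * (n : ℝ) + 17)) / 2)
    (hγ : γ = ((n : ℝ) - 3) / 2 + α) : 0 < γ := by
  have hn' : (8 : ℝ) ≤ n := by exact_mod_cast hn
  have : 0 < Real.sqrt ((n : ℝ) ^ 2 - 10 * (n : ℝ) + 17) := Real.sqrt_pos.2 (by nlinarith)
  linarith

lemma half_one_sub_exponent_lt (hn : 9 ≤ n)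
    (hα : α = (3 - (n : ℝ) + Real.sqrt ((n : ℝ) ^ 2 - 10 * (n : ℝ) + 17)) / 2)
    (hγ : γ = ((n : ℝ) - 3) / 2 + α) : (1 - α) / 2 < γ := by
  have hn' : (9 : ℝ) ≤ n := by exact_mod_cast hn
  have : ((n : ℝ) - 1) / 3 < Real.sqrt ((n : ℝ) ^ 2 - 10 * (n : ℝ) + 17) :=
    Real.lt_sqrt_of_sq_lt (by nlinarith)
  linarith

end exponents

/-- A common weighted bound for the three parts of the source term. -/
lemma exists_source_le {α lam A β ρ : ℝ} (hα : α < 0) (hlam : 0 < lam)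
    (hp : 0 ≤ 4 * lam - 1 - α) (hA : 0 < A) (hβ : 1 ≤ β) (hρ : 0 < ρ) :
    ∃ B : ℝ, 0 < B ∧ ∀ F₁ F₂ F₃ z s₀ s τ : ℝ, 0 < z → s₀ ≤ τ → τ ≤ s →
      2 ≤ ρ * Real.exp (τ / 2) →
      |F₁| ≤ A * Real.exp (-2 * lam * τ) * z ^ (-3 : ℝ) * (z ^ (2 * α) + z ^ (4 * lam + 2)) →
      (¬(β * Real.exp (-(lam / (1 - α)) * τ) < z ∧ z < ρ * Real.exp (τ / 2)) → F₁ = 0) →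
      |F₂| ≤ A * Real.exp (-lam * τ) * z ^ (α - 2) →
      (¬(β * Real.exp (-(lam / (1 - α)) * τ) < z
        ∧ z < (β + 1) * Real.exp (-(lam / (1 - α)) * τ)) → F₂ = 0) →
      |F₃| ≤ A * Real.exp (-lam * τ) * z ^ (2 * lam + 2) →
      (¬(ρ * Real.exp (τ / 2) - 1 < z ∧ z < ρ * Real.exp (τ / 2)) → F₃ = 0) →
      |F₁ + F₂ + F₃| * z ^ (-α) ≤ B * Real.exp (-2 * lam * s₀)
        * ((z ^ 2 + Real.exp (-(lam / (1 - α)) * s) ^ 2) ^ (-((3 - α) / 2))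
          + Real.exp (z ^ 2 / 8)) := by
  refine ⟨A * (2 ^ ((3 - α) / 2) + Real.exp (2 * (4 * lam - 1 - α) ^ 2))
    + A * ((β + 1) ^ (1 - α) * 2 ^ ((3 - α) / 2))
    + A * ((ρ / 2) ^ (-(2 * lam)) * Real.exp (2 * (4 * lam + 2 - α) ^ 2)), by positivity, ?_⟩
  intro F₁ F₂ F₃ z s₀ s τ hz hτ hτs hlarge h₁ h₁' h₂ h₂' h₃ h₃'
  have b₁ := nonlinear_source_le hα hlam hp hA hβ hz hτ hτs h₁ h₁'
  have b₂ := inner_cutoff_source_le hα hlam hA hβ hz hτ hτs h₂ h₂'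
  have b₃ := outer_cutoff_source_le (s := s) hα hlam hA hρ hz hτ hlarge h₃ h₃'
  have htri : |F₁ + F₂ + F₃| * z ^ (-α) ≤ (|F₁| + |F₂| + |F₃|) * z ^ (-α) := by
    gcongr
    exact abs_add_three _ _ _
  linarith

/-- short-time estimate for the Duhamel term
`∫_{s₀}^s ∫₀^∞ K(y, z, s−τ) f(z, τ) dz dτ`, where `f = f₁ + f₂ + f₃` satisfies the
size and support bounds coming from the admissibility condition.  The constants `S₀`
and `C` depend only on `n, l, A, ρ, β, R, ϑ`. -/
theorem stmt_12 (n : ℕ) (hn : 8 ≤ n) (l : ℕ) (hl : 2 ≤ l)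
    (α γ lamₗ σₗ ς κ : ℝ)
    (hα : α = (3 - (n : ℝ) + Real.sqrt ((n : ℝ) ^ 2 - 10 * (n : ℝ) + 17)) / 2)
    (hγ : γ = ((n : ℝ) - 3) / 2 + α)
    (hlamₗ : lamₗ = -(1 - α) / 2 + (l : ℝ))
    (hσ : σₗ = lamₗ / (1 - α))
    (hς : ς = if 9 ≤ n then min 1 (((n : ℝ) - 3 + 2 * α) / (2 * (1 - α))) else 1 / 7)
    (Iγ : ℝ → ℝ)
    (hI : ∀ x : ℝ, Iγ x = ∑' m : ℕ,
      (x / 2) ^ (2 * (m : ℝ) + γ) / ((m.factorial : ℝ) * Real.Gamma ((m : ℝ) + γ + 1)))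
    (K : ℝ → ℝ → ℝ → ℝ)
    (hK : ∀ y z s : ℝ, K y z s
      = (z / y) ^ ((n : ℝ) / 2 - 1) * Real.sqrt (y * z)
        * (Real.exp (((n : ℝ) - 1) * s / 4) / (2 * (1 - Real.exp (-s))))
        * Iγ (Real.exp (-s / 2) * y * z / (2 * (1 - Real.exp (-s))))
        * Real.exp (-(Real.exp (-s) * y ^ 2 + z ^ 2) / (4 * (1 - Real.exp (-s)))))
    (A β ρ R ϑ : ℝ) (hA : 0 < A) (hβ : 1 ≤ β) (hρ : ρ ∈ Ioo (0 : ℝ) 1)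
    (hR : 1 ≤ R) (hϑ : ϑ ∈ Ioo (0 : ℝ) 1)
    (hκ : κ = min (min (1 - ϑ) ((1 - ϑ) * ((n : ℝ) - 1 + 2 * α) / (3 * (1 - α))))
      (min ς (1 / (lamₗ + 1)))) :
    ∃ S₀ C : ℝ, 0 < C ∧
      ∀ (f f₁ f₂ f₃ : ℝ → ℝ → ℝ) (s₀ : ℝ),
        (∀ y s : ℝ, f y s = f₁ y s + f₂ y s + f₃ y s) →
        ContinuousOn (fun pt : ℝ × ℝ => f₁ pt.1 pt.2) (Ioi 0 ×ˢ univ) →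
        ContinuousOn (fun pt : ℝ × ℝ => f₂ pt.1 pt.2) (Ioi 0 ×ˢ univ) →
        ContinuousOn (fun pt : ℝ × ℝ => f₃ pt.1 pt.2) (Ioi 0 ×ˢ univ) →
        (∀ s : ℝ, s₀ ≤ s → ∀ y : ℝ, 0 < y →
          |f₁ y s| ≤ A * Real.exp (-2 * lamₗ * s) * y ^ (-3 : ℝ)
            * (y ^ (2 * α) + y ^ (4 * lamₗ + 2))) →
        (∀ s : ℝ, s₀ ≤ s → ∀ y : ℝ, 0 < y →
          ¬(β * Real.exp (-σₗ * s) < y ∧ y < ρ * Real.exp (s / 2)) → f₁ y s = 0) →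
        (∀ s : ℝ, s₀ ≤ s → ∀ y : ℝ, 0 < y →
          |f₂ y s| ≤ A * Real.exp (-lamₗ * s) * y ^ (α - 2)) →
        (∀ s : ℝ, s₀ ≤ s → ∀ y : ℝ, 0 < y →
          ¬(β * Real.exp (-σₗ * s) < y ∧ y < (β + 1) * Real.exp (-σₗ * s)) → f₂ y s = 0) →
        (∀ s : ℝ, s₀ ≤ s → ∀ y : ℝ, 0 < y →
          |f₃ y s| ≤ A * Real.exp (-lamₗ * s) * y ^ (2 * lamₗ + 2)) →
        (∀ s : ℝ, s₀ ≤ s → ∀ y : ℝ, 0 < y →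
          ¬(ρ * Real.exp (s / 2) - 1 < y ∧ y < ρ * Real.exp (s / 2)) → f₃ y s = 0) →
        S₀ ≤ s₀ →
        ∀ s : ℝ, s₀ < s → s ≤ s₀ + 1 →
        ∀ y : ℝ, (1 / 2) * Real.exp (-ϑ * σₗ * s) ≤ y → y ≤ 2 * R →
          |∫ τ in Ioc s₀ s, ∫ z in Ioi (0 : ℝ), K y z (s - τ) * f z τ|
            ≤ C * Real.exp (-(1 + κ) * lamₗ * s₀) * y ^ α := by
  have hα2 := neg_two_le_exponent hn hα
  have hα1 := exponent_lt_neg_one hn hα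
  have hγ0 := bessel_index_pos hn hα hγ
  have hl' : (2 : ℝ) ≤ l := by exact_mod_cast hl
  have hlam : 0 < lamₗ := by linarith
  obtain ⟨hρ0, -⟩ := hρ
  have hκ1 : κ ≤ 1 - ϑ := hκ.le.trans ((min_le_left _ _).trans (min_le_left _ _))
  have hcase : (1 - α) / 2 < γ ∨ α = -2 ∧ γ = 1 / 2 ∧ κ ≤ (1 - ϑ) / 3 := by
    rcases hn.eq_or_lt with rfl | h9
    · have hα8 : α = -2 := by
        rw [hα, show ((8 : ℕ) : ℝ) ^ 2 - 10 * ((8 : ℕ) : ℝ) + 17 = 1 by norm_num, Real.sqrt_one]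
        norm_num
      refine Or.inr ⟨hα8, by rw [hγ, hα8]; norm_num, ?_⟩
      refine hκ.le.trans ((min_le_left _ _).trans ((min_le_right _ _).trans_eq ?_))
      rw [hα8]
      push_cast
      ring
    · exact Or.inl (half_one_sub_exponent_lt h9 hα hγ)
  obtain ⟨Cw, hCw, hpot⟩ := exists_potential_le_exp hα1 hγ0 hlam hϑ hκ1 hcase
  obtain ⟨B, hB, hsrc⟩ := exists_source_le (α := α) (β := β) (by linarith) hlam (by linarith)
    hA hβ hρ0
  set G := (2 : ℝ) ^ (γ + 1) * Real.exp (R ^ 2) with hG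
  refine ⟨max 0 (2 * Real.log (2 / ρ)), Real.exp ((1 - α) / 2) * B * (Cw + G),
    by positivity, ?_⟩
  intro f f₁ f₂ f₃ s₀ hf _ _ _ hf₁ hf₁' hf₂ hf₂' hf₃ hf₃' hS s hs hs1 y hy hyR
  have hs₀ : 0 ≤ s₀ := (le_max_left _ _).trans hS
  have hy0 : 0 < y := lt_of_lt_of_le (by positivity) hy
  subst hσ
  have hsource (τ : ℝ) (hτ : τ ∈ Ioo s₀ s) (z : ℝ) (hz : 0 < z) :
      |f z τ| * z ^ (-α) ≤ B * Real.exp (-2 * lamₗ * s₀)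
        * ((z ^ 2 + Real.exp (-(lamₗ / (1 - α)) * s) ^ 2) ^ (-((3 - α) / 2))
          + Real.exp (z ^ 2 / 8)) := by
    have hlarge : 2 ≤ ρ * Real.exp (τ / 2) := by
      have h1 : Real.log (2 / ρ) ≤ τ / 2 := by linarith [(le_max_right _ _).trans hS, hτ.1]
      have h2 := (Real.log_le_iff_le_exp (by positivity)).1 h1
      rwa [div_le_iff₀' hρ0] at h2
    rw [hf]
    exact hsrc _ _ _ _ _ _ _ hz hτ.1.le hτ.2.le hlarge (hf₁ τ hτ.1.le z hz) (hf₁' τ hτ.1.le z hz)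
      (hf₂ τ hτ.1.le z hz) (hf₂' τ hτ.1.le z hz) (hf₃ τ hτ.1.le z hz) (hf₃' τ hτ.1.le z hz)
  set D := Real.exp ((1 - α) / 2) * y ^ α * (B * Real.exp (-2 * lamₗ * s₀)) with hD
  have hexp : Real.exp (-2 * lamₗ * s₀) * Real.exp ((1 - κ) * lamₗ * s₀)
      = Real.exp (-(1 + κ) * lamₗ * s₀) := by
    rw [← Real.exp_add]; congr 1; ring
  have hone : 1 ≤ Real.exp ((1 - κ) * lamₗ * s₀) := Real.one_le_exp (by
    have : 0 < 1 - κ := by linarith [hϑ.1]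
    positivity)
  calc _ ≤ D * (Cw * Real.exp ((1 - κ) * lamₗ * s₀) + G) := by
        refine enorm_duhamel_le (γ := γ)
          (W := fun z => (z ^ 2 + Real.exp (-(lamₗ / (1 - α)) * s) ^ 2) ^ (-((3 - α) / 2)))
          (Φ := fun τ z => K y z (s - τ) * f z τ) (by fun_prop)
          (fun z => by positivity) (by positivity) (by positivity) (by positivity) (fun τ hτ z hz => ?_) (hpot s₀ s y hs₀ hs1 hy)
          ((lintegral_lintegral_besselDensity_mul_exp_le hγ0 hy0 hs1).trans
            (ENNReal.ofReal_le_ofReal ?_))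
        · have hker := enorm_kernel_le hγ hγ0 hy0 hz (sub_pos.2 hτ.2)
          rw [enorm_mul, hK, hI, Real.enorm_eq_ofReal_abs (f z τ)]
          refine (mul_le_mul_left hker _).trans ?_
          rw [mul_right_comm, ← ENNReal.ofReal_mul (by positivity)]
          refine mul_le_mul_left (ENNReal.ofReal_le_ofReal ?_) _
          calc _ = Real.exp ((1 - α) * (s - τ) / 2) * y ^ α * (|f z τ| * z ^ (-α)) := by ring
            _ ≤ Real.exp ((1 - α) / 2) * y ^ α * (|f z τ| * z ^ (-α)) := by
                gcongr
                nlinarith [hτ.1]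
            _ ≤ Real.exp ((1 - α) / 2) * y ^ α * _ := by
                exact mul_le_mul_of_nonneg_left (hsource τ hτ z hz) (by positivity)
            _ = _ := by rw [hD]; ring
        · rw [hG]
          gcongr
          nlinarith
    _ ≤ D * ((Cw + G) * Real.exp ((1 - κ) * lamₗ * s₀)) := by
        gcongr
        have hG0 : 0 ≤ G := by positivity
        nlinarith
    _ = _ := by
        rw [hD, ← hexp]
        ring
end

section
/- Let l ≥ 2 be an integer, A > 0, β ≥ 1, ρ ∈ (0, 1), R ≥ 1, ϑ ∈ (0, 1). Then there exist S₀ and C > 0, depending only on n, l, A, ρ, β, R, ϑ, such that for every s₀ ≥ S₀ the following holds: if g : (0, ∞) → ℝ is continuous, |g(y)| ≤ A e^{−λ_l s₀} (y^α + y^{2λ_l + 1}) for all y > 0, and moreover |g(y)| ≤ A e^{−(1 + ς) λ_l s₀} (y^α + y^{2λ_l + 1}) for all y with (β + 1) e^{−σ_l s₀} ≤ y ≤ ρ e^{s₀/2} − 1, then for every s with s₀ < s ≤ s₀ + 1 and every y with (1/2) e^{−ϑ σ_l s} ≤ y ≤ 2R, one has |∫₀^∞ K(y, z, s − s₀) g(z)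 dz| ≤ C e^{−(1 + κ̃) λ_l s₀} y^α. -/
open Set MeasureTheory

/-- The `m`-th term of the power series of the modified Bessel function `I_γ` at `x`. -/
noncomputable def besselITerm (γ x : ℝ) (m : ℕ) : ℝ :=
  (x / 2) ^ (2 * (m : ℝ) + γ) / ((m.factorial : ℝ) * Real.Gamma ((m : ℝ) + γ + 1))

/-- The modified Bessel function of the first kind. -/
noncomputable def besselI (γ x : ℝ) : ℝ := ∑' m : ℕ, besselITerm γ x m

lemma factorial_two_mul_le_four_pow_mul (m : ℕ) :
    (2 * m).factorial ≤ 4 ^ m * (m.factorial * m.factorial) := by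
  induction m with
  | zero => simp
  | succ k ih =>
    have h1 : (2 * (k + 1)).factorial = (2 * k + 2) * ((2 * k + 1) * (2 * k).factorial) := by
      rw [show 2 * (k + 1) = (2 * k + 1) + 1 by ring, Nat.factorial_succ, Nat.factorial_succ]
    rw [h1, Nat.factorial_succ]
    calc (2 * k + 2) * ((2 * k + 1) * (2 * k).factorial)
        ≤ (2 * k + 2) * ((2 * k + 2) * (4 ^ k * (k.factorial * k.factorial))) := by
          gcongr
          omega
      _ = _ := by ring

lemma factorial_mul_Gamma_le {γ : ℝ} (hγ : 0 ≤ γ) (m : ℕ) :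
    (m.factorial : ℝ) * Real.Gamma (γ + 1) ≤ Real.Gamma ((m : ℝ) + γ + 1) := by
  induction m with
  | zero => simp
  | succ k ih =>
    have hk : (0 : ℝ) ≤ k := k.cast_nonneg
    have hG : 0 < Real.Gamma (γ + 1) := Real.Gamma_pos_of_pos (by linarith)
    have hf : (0 : ℝ) < k.factorial := by positivity
    rw [show ((k + 1 : ℕ) : ℝ) + γ + 1 = (k + γ + 1) + 1 by push_cast; ring,
      Real.Gamma_add_one (s := k + γ + 1) (by positivity), Nat.factorial_succ]
    push_cast
    calc ((k : ℝ) + 1) * k.factorial * Real.Gamma (γ + 1)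
        = (k + 1) * (k.factorial * Real.Gamma (γ + 1)) := by ring
      _ ≤ (k + γ + 1) * Real.Gamma (k + γ + 1) := by
          gcongr
          linarith

lemma besselITerm_nonneg {γ x : ℝ} (hγ : 0 ≤ γ) (hx : 0 ≤ x) (m : ℕ) :
    0 ≤ besselITerm γ x m := by
  have : 0 < Real.Gamma ((m : ℝ) + γ + 1) := Real.Gamma_pos_of_pos (by positivity)
  unfold besselITerm
  positivity

lemma besselITerm_le {γ x : ℝ} (hγ : 0 ≤ γ) (hx : 0 < x) (m : ℕ) :
    besselITerm γ x m ≤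
      (x / 2) ^ γ / Real.Gamma (γ + 1) * (x ^ (2 * m) / ((2 * m).factorial : ℝ)) := by
  have hG : 0 < Real.Gamma (γ + 1) := Real.Gamma_pos_of_pos (by linarith)
  have h4 : ((2 * m).factorial : ℝ) ≤ 4 ^ m * (m.factorial * m.factorial) := by
    exact_mod_cast factorial_two_mul_le_four_pow_mul m
  have hpow : (x / 2) ^ (2 * (m : ℝ) + γ) = x ^ (2 * m) / 4 ^ m * (x / 2) ^ γ := by
    rw [Real.rpow_add (by positivity), show 2 * (m : ℝ) = ((2 * m : ℕ) : ℝ) by push_cast; ring,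
      Real.rpow_natCast, div_pow, pow_mul 2 2 m]
    norm_num
  unfold besselITerm
  rw [hpow]
  calc x ^ (2 * m) / 4 ^ m * (x / 2) ^ γ / (m.factorial * Real.Gamma ((m : ℝ) + γ + 1))
      ≤ x ^ (2 * m) / 4 ^ m * (x / 2) ^ γ / (m.factorial * (m.factorial * Real.Gamma (γ + 1))) := by
        gcongr
        exact factorial_mul_Gamma_le hγ m
    _ = (x / 2) ^ γ / Real.Gamma (γ + 1) *
          (x ^ (2 * m) / (4 ^ m * (m.factorial * m.factorial))) := by
        field_simp
    _ ≤ _ := by gcongr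

lemma summable_besselITerm {γ x : ℝ} (hγ : 0 ≤ γ) (hx : 0 < x) :
    Summable (besselITerm γ x) :=
  Summable.of_nonneg_of_le (besselITerm_nonneg hγ hx.le) (besselITerm_le hγ hx)
    ((Real.hasSum_cosh x).summable.mul_left _)

lemma besselI_nonneg {γ x : ℝ} (hγ : 0 ≤ γ) (hx : 0 ≤ x) : 0 ≤ besselI γ x :=
  tsum_nonneg (besselITerm_nonneg hγ hx)

lemma besselI_le {γ x : ℝ} (hγ : 0 ≤ γ) (hx : 0 < x) :
    besselI γ x ≤ (x / 2) ^ γ / Real.Gamma (γ + 1) * Real.exp x := by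
  have hG : 0 < Real.Gamma (γ + 1) := Real.Gamma_pos_of_pos (by linarith)
  have h := (Real.hasSum_cosh x).mul_left ((x / 2) ^ γ / Real.Gamma (γ + 1))
  calc besselI γ x ≤ (x / 2) ^ γ / Real.Gamma (γ + 1) * Real.cosh x := by
        rw [← h.tsum_eq]
        exact (summable_besselITerm hγ hx).tsum_le_tsum (besselITerm_le hγ hx) h.summable
    _ ≤ _ := by
        gcongr
        rw [Real.cosh_eq]
        have : Real.exp (-x) ≤ Real.exp x := Real.exp_le_exp.2 (by linarith)
        linarith

/-- Weber's integral `∫₀^∞ z^{γ+1} I_γ(2bz) e^{-az²} dz = b^γ / (2 a^{γ+1}) e^{b²/a}`. -/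
lemma lintegral_rpow_mul_besselI_mul_exp {γ a b : ℝ} (hγ : 0 ≤ γ) (ha : 0 < a) (hb : 0 < b) :
    ∫⁻ z in Ioi (0 : ℝ),
        ENNReal.ofReal (z ^ (γ + 1) * besselI γ (2 * b * z) * Real.exp (-a * z ^ 2)) =
      ENNReal.ofReal (b ^ γ / (2 * a ^ (γ + 1)) * Real.exp (b ^ 2 / a)) := by
  set c : ℕ → ℝ := fun m ↦
    b ^ (2 * (m : ℝ) + γ) / ((m.factorial : ℝ) * Real.Gamma ((m : ℝ) + γ + 1)) with hc
  have hGm : ∀ m : ℕ, 0 < Real.Gamma ((m : ℝ) + γ + 1) := fun m ↦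
    Real.Gamma_pos_of_pos (by positivity)
  have hc0 : ∀ m, 0 ≤ c m := fun m ↦ by
    have := hGm m
    simp only [hc]
    positivity
  have hterm : ∀ z ∈ Ioi (0 : ℝ), ∀ m : ℕ,
      z ^ (γ + 1) * besselITerm γ (2 * b * z) m * Real.exp (-a * z ^ 2) =
        c m * (z ^ (2 * (m : ℝ) + 2 * γ + 1) * Real.exp (-a * z ^ (2 : ℝ))) := by
    intro z hz m
    have hz : 0 < z := hz
    rw [show 2 * (m : ℝ) + 2 * γ + 1 = (γ + 1) + (2 * m + γ) by ring,
      Real.rpow_add hz (γ + 1) (2 * m + γ),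
      Real.rpow_two, besselITerm, show 2 * b * z / 2 = b * z by ring,
      Real.mul_rpow hb.le hz.le]
    simp only [hc]
    ring
  have hexp : ∀ m : ℕ, (-1 : ℝ) < 2 * (m : ℝ) + 2 * γ + 1 := fun m ↦ by
    have : (0 : ℝ) ≤ m := m.cast_nonneg
    linarith
  have h_int : ∀ m : ℕ, ∫⁻ z in Ioi (0 : ℝ), ENNReal.ofReal
      (c m * (z ^ (2 * (m : ℝ) + 2 * γ + 1) * Real.exp (-a * z ^ (2 : ℝ)))) =
      ENNReal.ofReal (b ^ γ / (2 * a ^ (γ + 1)) * ((b ^ 2 / a) ^ m / (m.factorial : ℝ))) := by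
    intro m
    rw [← ofReal_integral_eq_lintegral_ofReal
      ((integrableOn_rpow_mul_exp_neg_mul_rpow (hexp m) two_pos ha).const_mul _)
      ((ae_restrict_mem measurableSet_Ioi).mono fun z hz ↦ by
        have hz : 0 < z := hz
        have := hc0 m
        simp only [Pi.zero_apply]
        positivity),
      integral_const_mul, integral_rpow_mul_exp_neg_mul_rpow two_pos (hexp m) ha]
    congr 1
    have e1 : (2 * (m : ℝ) + 2 * γ + 1 + 1) / 2 = m + γ + 1 := by ring
    have e2 : -(2 * (m : ℝ) + 2 * γ + 1 + 1) / 2 = -((γ + 1) + m) := by ring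
    have hG := (hGm m).ne'
    have hapos : 0 < a ^ (γ + 1) := by positivity
    rw [e1, e2, Real.rpow_neg ha.le, Real.rpow_add ha, Real.rpow_natCast]
    simp only [hc]
    rw [Real.rpow_add hb, show 2 * (m : ℝ) = ((2 * m : ℕ) : ℝ) by push_cast; ring,
      Real.rpow_natCast, div_pow, ← pow_mul]
    field_simp
  have hsumexp : HasSum (fun m : ℕ ↦ b ^ γ / (2 * a ^ (γ + 1)) *
      ((b ^ 2 / a) ^ m / (m.factorial : ℝ)))
      (b ^ γ / (2 * a ^ (γ + 1)) * Real.exp (b ^ 2 / a)) := by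
    rw [Real.exp_eq_exp_ℝ]
    exact (NormedSpace.expSeries_div_hasSum_exp (b ^ 2 / a)).mul_left _
  calc ∫⁻ z in Ioi (0 : ℝ),
        ENNReal.ofReal (z ^ (γ + 1) * besselI γ (2 * b * z) * Real.exp (-a * z ^ 2))
      = ∫⁻ z in Ioi (0 : ℝ), ∑' m : ℕ, ENNReal.ofReal
          (c m * (z ^ (2 * (m : ℝ) + 2 * γ + 1) * Real.exp (-a * z ^ (2 : ℝ)))) := by
        refine setLIntegral_congr_fun measurableSet_Ioi fun z hz ↦ ?_
        have hz' : 0 < z := hz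
        have hs := ((summable_besselITerm hγ (x := 2 * b * z) (by positivity)).mul_left
          (z ^ (γ + 1))).mul_right (Real.exp (-a * z ^ 2))
        simp only [besselI]
        rw [← tsum_mul_left, ← tsum_mul_right, ENNReal.ofReal_tsum_of_nonneg _ hs]
        · exact tsum_congr fun m ↦ by rw [hterm z hz m]
        · intro m
          have := besselITerm_nonneg hγ (x := 2 * b * z) (by positivity) m
          positivity
    _ = ∑' m : ℕ, ENNReal.ofReal
          (b ^ γ / (2 * a ^ (γ + 1)) * ((b ^ 2 / a) ^ m / (m.factorial : ℝ))) := by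
        rw [lintegral_tsum fun m ↦ by fun_prop]
        exact tsum_congr h_int
    _ = _ := by
        rw [← ENNReal.ofReal_tsum_of_nonneg (fun m ↦ by positivity) hsumexp.summable,
          hsumexp.tsum_eq]

/-- The kernel `K(y, z, s)` with `τ = 1 - e^{-s}`, `η = e^{-s/2}` and `c = e^{(n-1)s/4}`, after
collecting the powers of `y` and of `z`. -/
noncomputable def radialKernel (γ α c τ η y z : ℝ) : ℝ :=
  y ^ (α - γ) * z ^ (γ + 1 - α) * (c / (2 * τ)) * besselI γ (2 * (η * y / (4 * τ)) * z) *
    Real.exp (-(η ^ 2 * y ^ 2 + z ^ 2) / (4 * τ))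

lemma radialKernel_nonneg {γ α c τ η y z : ℝ} (hγ : 0 ≤ γ) (hc : 0 ≤ c) (hτ : 0 < τ)
    (hη : 0 < η) (hy : 0 < y) (hz : 0 < z) : 0 ≤ radialKernel γ α c τ η y z := by
  have := besselI_nonneg hγ (x := 2 * (η * y / (4 * τ)) * z) (by positivity)
  unfold radialKernel
  positivity

lemma div_rpow_mul_sqrt {p q y z : ℝ} (hy : 0 < y) (hz : 0 < z) (hq : q = p + 1 / 2) :
    (z / y) ^ p * √(y * z) = y ^ (1 - q) * z ^ q := by
  rw [Real.div_rpow hz.le hy.le, Real.sqrt_eq_rpow, Real.mul_rpow hy.le hz.le, hq,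
    Real.rpow_add hz, show 1 - (p + 1 / 2) = 1 / 2 - p by ring, Real.rpow_sub hy]
  field_simp

lemma lintegral_radialKernel_mul_exp_le {γ α c τ η y : ℝ} (hγ : 0 ≤ γ) (hc : 0 ≤ c)
    (hτ : 0 < τ) (hτ1 : τ ≤ 1) (hη : 0 < η) (hη1 : η ≤ 1) (hy : 0 < y) :
    ∫⁻ z in Ioi (0 : ℝ),
        ENNReal.ofReal (radialKernel γ α c τ η y z * (z ^ α * Real.exp (z ^ 2 / 8))) ≤
      ENNReal.ofReal (c * 2 ^ (γ + 1) * Real.exp (y ^ 2 / 4) * y ^ α) := by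
  set a : ℝ := 1 / (4 * τ) - 1 / 8 with ha
  set b : ℝ := η * y / (4 * τ) with hb
  have ha8 : 1 / (8 * τ) ≤ a := by
    have h1 : 1 / (4 * τ) = 2 * (1 / (8 * τ)) := by field_simp; norm_num
    have h2 : 1 / 8 ≤ 1 / (8 * τ) := one_div_le_one_div_of_le (by positivity) (by linarith)
    rw [ha, h1]
    linarith
  have hapos : 0 < a := lt_of_lt_of_le (by positivity) ha8
  have hbpos : 0 < b := by positivity
  set q : ℝ := y ^ (α - γ) * (c / (2 * τ)) * Real.exp (-(η ^ 2 * y ^ 2) / (4 * τ)) with hq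
  have hq0 : 0 ≤ q := by positivity
  have hpt : ∀ z ∈ Ioi (0 : ℝ),
      ENNReal.ofReal (radialKernel γ α c τ η y z * (z ^ α * Real.exp (z ^ 2 / 8))) =
        ENNReal.ofReal q *
          ENNReal.ofReal (z ^ (γ + 1) * besselI γ (2 * b * z) * Real.exp (-a * z ^ 2)) := by
    intro z hz
    have hz : 0 < z := hz
    rw [← ENNReal.ofReal_mul hq0]
    congr 1
    have e1 : z ^ (γ + 1) = z ^ (γ + 1 - α) * z ^ α := by
      rw [← Real.rpow_add hz]
      congr 1
      ring
    have e2 : Real.exp (-(η ^ 2 * y ^ 2 + z ^ 2) / (4 * τ)) * Real.exp (z ^ 2 / 8) =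
        Real.exp (-(η ^ 2 * y ^ 2) / (4 * τ)) * Real.exp (-a * z ^ 2) := by
      rw [← Real.exp_add, ← Real.exp_add, ha]
      congr 1
      field_simp
      ring
    rw [radialKernel, e1]
    calc _ = y ^ (α - γ) * z ^ (γ + 1 - α) * (c / (2 * τ)) * besselI γ (2 * b * z) * z ^ α *
          (Real.exp (-(η ^ 2 * y ^ 2 + z ^ 2) / (4 * τ)) * Real.exp (z ^ 2 / 8)) := by ring
      _ = _ := by rw [e2]; ring
  rw [setLIntegral_congr_fun measurableSet_Ioi hpt, lintegral_const_mul' _ _ ENNReal.ofReal_ne_top,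
    lintegral_rpow_mul_besselI_mul_exp hγ hapos hbpos, ← ENNReal.ofReal_mul hq0]
  refine ENNReal.ofReal_le_ofReal ?_
  have hexp : Real.exp (-(η ^ 2 * y ^ 2) / (4 * τ)) * Real.exp (b ^ 2 / a) ≤
      Real.exp (y ^ 2 / 4) := by
    rw [← Real.exp_add, Real.exp_le_exp]
    have h2τ : 0 < 2 - τ := by linarith
    have e : -(η ^ 2 * y ^ 2) / (4 * τ) + b ^ 2 / a = η ^ 2 * y ^ 2 / (4 * (2 - τ)) := by
      have : a = (2 - τ) / (8 * τ) := by
        rw [ha]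
        field_simp
        ring
      rw [this, hb]
      field_simp
      ring
    rw [e]
    have hη2 : η ^ 2 ≤ 1 := pow_le_one₀ hη.le hη1
    calc η ^ 2 * y ^ 2 / (4 * (2 - τ)) ≤ 1 * y ^ 2 / (4 * 1) := by
          gcongr
          linarith
      _ = y ^ 2 / 4 := by ring
  have hpow : b ^ γ / (2 * a ^ (γ + 1)) ≤ y ^ γ * (2 ^ (γ + 1) * (2 * τ)) := by
    have h1 : (1 / (8 * τ)) ^ (γ + 1) ≤ a ^ (γ + 1) := by gcongr
    have h2 : b ^ γ ≤ (y / (4 * τ)) ^ γ := by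
      rw [hb]
      gcongr
      exact mul_le_of_le_one_left hy.le hη1
    calc b ^ γ / (2 * a ^ (γ + 1))
        ≤ (y / (4 * τ)) ^ γ / (2 * (1 / (8 * τ)) ^ (γ + 1)) := by gcongr
      _ = y ^ γ * (2 ^ (γ + 1) * (2 * τ)) := by
          rw [Real.div_rpow hy.le (by positivity), Real.div_rpow one_pos.le (by positivity),
            Real.one_rpow, show 8 * τ = 2 * (4 * τ) by ring,
            Real.mul_rpow (x := 2) (y := 4 * τ) (by positivity) (by positivity),
            Real.rpow_add_one (x := 4 * τ) (by positivity)]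
          have : 0 < (4 * τ) ^ γ := by positivity
          field_simp
          norm_num
  calc q * (b ^ γ / (2 * a ^ (γ + 1)) * Real.exp (b ^ 2 / a))
      = y ^ (α - γ) * (c / (2 * τ)) * (b ^ γ / (2 * a ^ (γ + 1))) *
          (Real.exp (-(η ^ 2 * y ^ 2) / (4 * τ)) * Real.exp (b ^ 2 / a)) := by
        rw [hq]
        ring
    _ ≤ y ^ (α - γ) * (c / (2 * τ)) * (y ^ γ * (2 ^ (γ + 1) * (2 * τ))) *
          Real.exp (y ^ 2 / 4) := by gcongr
    _ = _ := by
        rw [Real.rpow_sub hy]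
        have : 0 < y ^ γ := by positivity
        field_simp

lemma exists_rpow_mul_exp_neg_le (p : ℝ) (hp : 0 ≤ p) :
    ∃ C : ℝ, 0 < C ∧ ∀ v : ℝ, 0 ≤ v → v ^ p * Real.exp (-v) ≤ C := by
  obtain ⟨N, hN⟩ := exists_nat_ge p
  refine ⟨N.factorial * Real.exp 1, by positivity, fun v hv ↦ ?_⟩
  have h1 : v ^ p ≤ N.factorial * Real.exp (1 + v) :=
    calc v ^ p ≤ (1 + v) ^ p := by
          gcongr
          linarith
      _ ≤ (1 + v) ^ (N : ℝ) := Real.rpow_le_rpow_of_exponent_le (by linarith) hN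
      _ = (1 + v) ^ N := Real.rpow_natCast _ _
      _ ≤ N.factorial * Real.exp (1 + v) :=
          (div_le_iff₀' (by positivity)).1
            (Real.pow_div_factorial_le_exp (1 + v) (by positivity) N)
  calc v ^ p * Real.exp (-v) ≤ N.factorial * Real.exp (1 + v) * Real.exp (-v) := by gcongr
    _ = N.factorial * Real.exp 1 := by
        rw [mul_assoc, ← Real.exp_add]
        congr 2
        ring

lemma exists_gaussian_le_rpow (p : ℝ) (hp : 0 ≤ p) :
    ∃ C : ℝ, 0 < C ∧ ∀ h x : ℝ, 0 < h → 0 < x →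
      Real.exp (-(x ^ 2) / (4 * h)) / h ^ p ≤ C / x ^ (2 * p) := by
  obtain ⟨C, hC, hle⟩ := exists_rpow_mul_exp_neg_le p hp
  refine ⟨4 ^ p * C, by positivity, fun h x hh hx ↦ ?_⟩
  have hv := hle (x ^ 2 / (4 * h)) (by positivity)
  rw [Real.div_rpow (by positivity) (by positivity), Real.mul_rpow (by positivity) hh.le,
    ← Real.rpow_two, ← Real.rpow_mul hx.le, Real.rpow_two, ← neg_div] at hv
  have h1 : 0 < h ^ p := by positivity
  have h2 : 0 < x ^ (2 * p) := by positivity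
  have h4 : (0 : ℝ) < 4 ^ p := by positivity
  rw [div_le_div_iff₀ h1 h2]
  calc Real.exp (-(x ^ 2) / (4 * h)) * x ^ (2 * p)
      = x ^ (2 * p) / (4 ^ p * h ^ p) * Real.exp (-(x ^ 2) / (4 * h)) * (4 ^ p * h ^ p) := by
        field_simp
    _ ≤ C * (4 ^ p * h ^ p) := by gcongr
    _ = 4 ^ p * C * h ^ p := by ring

/-- Off-diagonal bound: the kernel is small when `z` is much smaller than `y`. -/
lemma exists_radialKernel_mul_rpow_le {γ : ℝ} (α : ℝ) (hγ : 0 ≤ γ) :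
    ∃ B : ℝ, 0 < B ∧ ∀ c τ η y z δ : ℝ, 0 ≤ c → 0 < τ → 0 < η → η ≤ 1 → 0 < y → 0 < z → z ≤ δ →
      δ ≤ η * y / 2 →
      radialKernel γ α c τ η y z * z ^ α ≤
        B * c * y ^ α * (δ ^ (2 * γ + 1) / (η * y) ^ (2 * γ + 2)) := by
  obtain ⟨C, hC, hle⟩ := exists_gaussian_le_rpow (γ + 1) (by linarith)
  have hG : 0 < Real.Gamma (γ + 1) := Real.Gamma_pos_of_pos (by linarith)
  refine ⟨2 / Real.Gamma (γ + 1) * C, by positivity, ?_⟩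
  intro c τ η y z δ hc hτ hη hη1 hy hz hzδ hδ
  have hδ0 : 0 < δ := hz.trans_le hzδ
  have hI := besselI_le hγ (x := 2 * (η * y / (4 * τ)) * z) (by positivity)
  have hgauss := hle (4 * τ) (η * y) (by positivity) (by positivity)
  rw [show 2 * (γ + 1) = 2 * γ + 2 by ring] at hgauss
  have hexp : Real.exp (2 * (η * y / (4 * τ)) * z) *
      Real.exp (-(η ^ 2 * y ^ 2 + z ^ 2) / (4 * τ)) ≤
      Real.exp (-((η * y) ^ 2) / (4 * (4 * τ))) := by
    rw [← Real.exp_add, Real.exp_le_exp]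
    have e : 2 * (η * y / (4 * τ)) * z + -(η ^ 2 * y ^ 2 + z ^ 2) / (4 * τ) =
        -((2 * (η * y - z)) ^ 2) / (4 * (4 * τ)) := by
      field_simp
      ring
    rw [e]
    have hs : (η * y) ^ 2 ≤ (2 * (η * y - z)) ^ 2 :=
      pow_le_pow_left₀ (by positivity) (by linarith) 2
    exact div_le_div_of_nonneg_right (neg_le_neg hs) (by positivity)
  have hpow : (2 * (η * y / (4 * τ)) * z / 2) ^ γ = η ^ γ * y ^ γ * z ^ γ / (4 * τ) ^ γ := by
    rw [show 2 * (η * y / (4 * τ)) * z / 2 = η * y * z / (4 * τ) by ring,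
      Real.div_rpow (by positivity) (by positivity), Real.mul_rpow (by positivity) hz.le,
      Real.mul_rpow hη.le hy.le]
  have hηγ : η ^ γ ≤ 1 := Real.rpow_le_one hη.le hη1 hγ
  have hzpow : z ^ (γ + 1 - α) * z ^ α * z ^ γ = z ^ (2 * γ + 1) := by
    rw [← Real.rpow_add hz, ← Real.rpow_add hz]
    congr 1
    ring
  have hypow : y ^ (α - γ) * y ^ γ = y ^ α := by
    rw [← Real.rpow_add hy]
    congr 1
    ring
  have hτpow : (4 * τ) ^ (γ + 1) = (4 * τ) ^ γ * (4 * τ) :=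
    Real.rpow_add_one (by positivity) _
  have hτγ : 0 < (4 * τ) ^ γ := by positivity
  have hgauss' : (Real.exp (2 * (η * y / (4 * τ)) * z) *
      Real.exp (-(η ^ 2 * y ^ 2 + z ^ 2) / (4 * τ))) / (4 * τ) ^ (γ + 1) ≤
        C / (η * y) ^ (2 * γ + 2) :=
    (div_le_div_of_nonneg_right hexp (by positivity)).trans hgauss
  rw [hpow] at hI
  calc radialKernel γ α c τ η y z * z ^ α
      = y ^ (α - γ) * (z ^ (γ + 1 - α) * z ^ α) * (c / (2 * τ)) *
          besselI γ (2 * (η * y / (4 * τ)) * z) *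
          Real.exp (-(η ^ 2 * y ^ 2 + z ^ 2) / (4 * τ)) := by
        rw [radialKernel]
        ring
    _ ≤ y ^ (α - γ) * (z ^ (γ + 1 - α) * z ^ α) * (c / (2 * τ)) *
          (η ^ γ * y ^ γ * z ^ γ / (4 * τ) ^ γ / Real.Gamma (γ + 1) *
            Real.exp (2 * (η * y / (4 * τ)) * z)) *
          Real.exp (-(η ^ 2 * y ^ 2 + z ^ 2) / (4 * τ)) := by gcongr
    _ = 2 / Real.Gamma (γ + 1) * c * (y ^ (α - γ) * y ^ γ) * η ^ γ *
          (z ^ (γ + 1 - α) * z ^ α * z ^ γ) *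
          ((Real.exp (2 * (η * y / (4 * τ)) * z) *
            Real.exp (-(η ^ 2 * y ^ 2 + z ^ 2) / (4 * τ))) / (4 * τ) ^ (γ + 1)) := by
        rw [hτpow]
        field_simp
        ring
    _ = 2 / Real.Gamma (γ + 1) * c * y ^ α * η ^ γ * z ^ (2 * γ + 1) *
          ((Real.exp (2 * (η * y / (4 * τ)) * z) *
            Real.exp (-(η ^ 2 * y ^ 2 + z ^ 2) / (4 * τ))) / (4 * τ) ^ (γ + 1)) := by
        rw [hypow, hzpow]
    _ ≤ 2 / Real.Gamma (γ + 1) * c * y ^ α * 1 * δ ^ (2 * γ + 1) *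
          (C / (η * y) ^ (2 * γ + 2)) := by
        gcongr
    _ = _ := by ring

/-- Bound for the evolution of data dominated by `a z^α e^{z²/8}` away from the origin and by
`b z^α` near the origin. -/
lemma exists_abs_integral_radialKernel_mul_le {γ : ℝ} (α : ℝ) (hγ : 0 ≤ γ) :
    ∃ B : ℝ, 0 < B ∧ ∀ (c τ η y δ a b : ℝ) (g : ℝ → ℝ), 0 ≤ c → 0 < τ → τ ≤ 1 → 0 < η → η ≤ 1 →
      0 < y → 0 < δ → δ ≤ η * y / 2 → 0 ≤ a → 0 ≤ b →
      (∀ z, δ ≤ z → |g z| ≤ a * (z ^ α * Real.exp (z ^ 2 / 8))) →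
      (∀ z, 0 < z → z < δ → |g z| ≤ b * z ^ α) →
      |∫ z in Ioi (0 : ℝ), radialKernel γ α c τ η y z * g z| ≤
        B * c * y ^ α * (a * Real.exp (y ^ 2 / 4) + b * (δ / (η * y)) ^ (2 * γ + 2)) := by
  obtain ⟨B, hB, hle⟩ := exists_radialKernel_mul_rpow_le α hγ
  refine ⟨2 ^ (γ + 1) + B, by positivity, ?_⟩
  intro c τ η y δ a b g hc hτ hτ1 hη hη1 hy hδ hδy ha hb hfar hnear
  have hηy : 0 < η * y := by positivity
  set k := radialKernel γ α c τ η y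
  set q : ℝ := b * (B * c * y ^ α * (δ ^ (2 * γ + 1) / (η * y) ^ (2 * γ + 2))) with hq
  have hq0 : 0 ≤ q := by positivity
  have hpt : ∀ z ∈ Ioi (0 : ℝ), ‖k z * g z‖ₑ ≤
      ENNReal.ofReal a * ENNReal.ofReal (k z * (z ^ α * Real.exp (z ^ 2 / 8))) +
        (Ioo 0 δ).indicator (fun _ ↦ ENNReal.ofReal q) z := by
    intro z hz
    have hz : 0 < z := hz
    have hk0 : 0 ≤ k z := radialKernel_nonneg hγ hc hτ hη hy hz
    rw [Real.enorm_eq_ofReal_abs, abs_mul, abs_of_nonneg hk0]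
    rcases lt_or_ge z δ with h | h
    · rw [indicator_of_mem (show z ∈ Ioo 0 δ from ⟨hz, h⟩)]
      refine le_add_left (ENNReal.ofReal_le_ofReal ?_)
      calc k z * |g z| ≤ k z * (b * z ^ α) := by gcongr; exact hnear z hz h
        _ = b * (k z * z ^ α) := by ring
        _ ≤ q := mul_le_mul_of_nonneg_left (hle c τ η y z δ hc hτ hη hη1 hy hz h.le hδy) hb
    · rw [← ENNReal.ofReal_mul ha]
      refine le_add_right (ENNReal.ofReal_le_ofReal ?_)
      calc k z * |g z| ≤ k z * (a * (z ^ α * Real.exp (z ^ 2 / 8))) := by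
            gcongr
            exact hfar z h
        _ = _ := by ring
  have hmain : ENNReal.ofReal |∫ z in Ioi (0 : ℝ), k z * g z| ≤
      ENNReal.ofReal (a * (c * 2 ^ (γ + 1) * Real.exp (y ^ 2 / 4) * y ^ α) + q * δ) := by
    rw [← Real.enorm_eq_ofReal_abs, ENNReal.ofReal_add (by positivity) (by positivity),
      ENNReal.ofReal_mul ha, ENNReal.ofReal_mul hq0]
    calc ‖∫ z in Ioi (0 : ℝ), k z * g z‖ₑ
        ≤ ∫⁻ z in Ioi (0 : ℝ), ‖k z * g z‖ₑ := enorm_integral_le_lintegral_enorm _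
      _ ≤ ∫⁻ z in Ioi (0 : ℝ),
            (ENNReal.ofReal a * ENNReal.ofReal (k z * (z ^ α * Real.exp (z ^ 2 / 8))) +
              (Ioo 0 δ).indicator (fun _ ↦ ENNReal.ofReal q) z) :=
          setLIntegral_mono' measurableSet_Ioi hpt
      _ = ENNReal.ofReal a * (∫⁻ z in Ioi (0 : ℝ),
            ENNReal.ofReal (k z * (z ^ α * Real.exp (z ^ 2 / 8)))) +
            ∫⁻ z in Ioi (0 : ℝ), (Ioo 0 δ).indicator (fun _ ↦ ENNReal.ofReal q) z := by
          rw [lintegral_add_right _ (measurable_const.indicator measurableSet_Ioo),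
            lintegral_const_mul' _ _ ENNReal.ofReal_ne_top]
      _ ≤ _ := by
          gcongr
          · exact lintegral_radialKernel_mul_exp_le hγ hc hτ hτ1 hη hη1 hy
          · calc _ ≤ ∫⁻ z, (Ioo 0 δ).indicator (fun _ ↦ ENNReal.ofReal q) z :=
                  setLIntegral_le_lintegral _ _
              _ = _ := by
                rw [lintegral_indicator measurableSet_Ioo, setLIntegral_const, Real.volume_Ioo,
                  sub_zero]
  rw [ENNReal.ofReal_le_ofReal_iff (by positivity)] at hmain
  have hqδ : q * δ = B * (c * y ^ α * (b * (δ / (η * y)) ^ (2 * γ + 2))) := by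
    have hδpow : δ ^ (2 * γ + 2) = δ ^ (2 * γ + 1) * δ := by
      rw [← Real.rpow_add_one hδ.ne']
      congr 1
      ring
    rw [hq, Real.div_rpow hδ.le hηy.le, hδpow]
    ring
  have h1 : 0 ≤ B * (c * y ^ α * (a * Real.exp (y ^ 2 / 4))) := by positivity
  have h2 : 0 ≤ 2 ^ (γ + 1) * (c * y ^ α * (b * (δ / (η * y)) ^ (2 * γ + 2))) := by positivity
  rw [hqδ] at hmain
  linarith

lemma even_pow_le_factorial_mul_exp (z : ℝ) (k : ℕ) :
    z ^ (2 * k) ≤ k.factorial * 8 ^ k * Real.exp (z ^ 2 / 8) := by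
  have h := Real.pow_div_factorial_le_exp (z ^ 2 / 8) (by positivity) k
  rw [div_le_iff₀' (by positivity), div_pow, div_le_iff₀ (by positivity), ← pow_mul] at h
  linarith

/-- The data bound `z^α + z^{2λ+1}`, with `2λ + 1 = α + 2l`, is dominated by `z^α e^{z²/8}`. -/
lemma rpow_add_rpow_le_mul_exp {α z : ℝ} (hz : 0 < z) (l : ℕ) :
    z ^ α + z ^ (α + 2 * l) ≤ (1 + l.factorial * 8 ^ l) * (z ^ α * Real.exp (z ^ 2 / 8)) := by
  have h1 : (1 : ℝ) ≤ Real.exp (z ^ 2 / 8) := Real.one_le_exp (by positivity)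
  have h2 := even_pow_le_factorial_mul_exp z l
  rw [Real.rpow_add hz, show 2 * (l : ℝ) = ((2 * l : ℕ) : ℝ) by push_cast; ring,
    Real.rpow_natCast]
  calc z ^ α + z ^ α * z ^ (2 * l)
      ≤ z ^ α * Real.exp (z ^ 2 / 8) +
          z ^ α * (l.factorial * 8 ^ l * Real.exp (z ^ 2 / 8)) := by
        gcongr
        exact le_mul_of_one_le_right (by positivity) h1
    _ = _ := by ring

lemma rpow_add_rpow_le_div_sq_mul_exp {α z M : ℝ} (hM : 1 ≤ M) (hz : M ≤ z) (l : ℕ) :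
    z ^ α + z ^ (α + 2 * l) ≤
      2 * ((l + 1).factorial * 8 ^ (l + 1)) / M ^ 2 * (z ^ α * Real.exp (z ^ 2 / 8)) := by
  have hM0 : 0 < M := by linarith
  have hz1 : 1 ≤ z := hM.trans hz
  have hz0 : 0 < z := by linarith
  have h2 := even_pow_le_factorial_mul_exp z (l + 1)
  have h3 : (1 : ℝ) ≤ z ^ (2 * l) := one_le_pow₀ hz1
  rw [Real.rpow_add hz0, show 2 * (l : ℝ) = ((2 * l : ℕ) : ℝ) by push_cast; ring,
    Real.rpow_natCast]
  calc z ^ α + z ^ α * z ^ (2 * l) ≤ z ^ α * z ^ (2 * l) + z ^ α * z ^ (2 * l) := by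
        gcongr
        exact le_mul_of_one_le_right (by positivity) h3
    _ = 2 / M ^ 2 * (z ^ α * (z ^ (2 * l) * M ^ 2)) := by
        field_simp
        norm_num
    _ ≤ 2 / M ^ 2 * (z ^ α * (z ^ (2 * l) * z ^ 2)) := by gcongr
    _ = 2 / M ^ 2 * (z ^ α * z ^ (2 * (l + 1))) := by ring
    _ ≤ 2 / M ^ 2 * (z ^ α * ((l + 1).factorial * 8 ^ (l + 1) * Real.exp (z ^ 2 / 8))) := by
        gcongr
    _ = _ := by ring

lemma rpow_add_rpow_le_two_mul {α z : ℝ} (hz : 0 < z) (hz1 : z ≤ 1) (l : ℕ) :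
    z ^ α + z ^ (α + 2 * l) ≤ 2 * z ^ α := by
  have h : z ^ (α + 2 * l) ≤ z ^ α :=
    Real.rpow_le_rpow_of_exponent_ge hz hz1 (by linarith [l.cast_nonneg (α := ℝ)])
  linarith

lemma alpha_bounds {n : ℝ} (hn : 8 ≤ n) :
    -2 ≤ (3 - n + √(n ^ 2 - 10 * n + 17)) / 2 ∧ (3 - n + √(n ^ 2 - 10 * n + 17)) / 2 < -1 := by
  have h1 : n - 7 ≤ √(n ^ 2 - 10 * n + 17) := Real.le_sqrt_of_sq_le (by nlinarith)
  have h2 : √(n ^ 2 - 10 * n + 17) < n - 5 := (Real.sqrt_lt' (by linarith)).2 (by nlinarith)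
  constructor <;> linarith

lemma eventually_mul_exp_neg_mul_le (a : ℝ) {k ε : ℝ} (hk : 0 < k) (hε : 0 < ε) :
    ∀ᶠ s in Filter.atTop, a * Real.exp (-k * s) ≤ ε := by
  have h : Filter.Tendsto (fun s : ℝ ↦ a * Real.exp (-k * s)) Filter.atTop (nhds (a * 0)) :=
    (Real.tendsto_exp_atBot.comp
      (Filter.tendsto_id.const_mul_atTop_of_neg (neg_lt_zero.2 hk))).const_mul a
  rw [mul_zero] at h
  exact (h.eventually_lt_const hε).mono fun _ ↦ le_of_lt

/-- short-time estimate for the evolution `∫₀^∞ K(y, z, s−s₀) g(z) dz` of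
initial data `g` that is small of order `e^{−λ_l s₀}` globally and of order
`e^{−(1+ς) λ_l s₀}` on the middle region.  The constants `S₀` and `C` depend only on
`n, l, A, ρ, β, R, ϑ`. -/
theorem stmt_13 (n : ℕ) (hn : 8 ≤ n) (l : ℕ) (hl : 2 ≤ l)
    (α γ lamₗ σₗ ς κ : ℝ)
    (hα : α = (3 - (n : ℝ) + Real.sqrt ((n : ℝ) ^ 2 - 10 * (n : ℝ) + 17)) / 2)
    (hγ : γ = ((n : ℝ) - 3) / 2 + α)
    (hlamₗ : lamₗ = -(1 - α) / 2 + (l : ℝ))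
    (hσ : σₗ = lamₗ / (1 - α))
    (hς : ς = if 9 ≤ n then min 1 (((n : ℝ) - 3 + 2 * α) / (2 * (1 - α))) else 1 / 7)
    (Iγ : ℝ → ℝ)
    (hI : ∀ x : ℝ, Iγ x = ∑' m : ℕ,
      (x / 2) ^ (2 * (m : ℝ) + γ) / ((m.factorial : ℝ) * Real.Gamma ((m : ℝ) + γ + 1)))
    (K : ℝ → ℝ → ℝ → ℝ)
    (hK : ∀ y z s : ℝ, K y z s
      = (z / y) ^ ((n : ℝ) / 2 - 1) * Real.sqrt (y * z)
        * (Real.exp (((n : ℝ) - 1) * s / 4) / (2 * (1 - Real.exp (-s))))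
        * Iγ (Real.exp (-s / 2) * y * z / (2 * (1 - Real.exp (-s))))
        * Real.exp (-(Real.exp (-s) * y ^ 2 + z ^ 2) / (4 * (1 - Real.exp (-s)))))
    (A β ρ R ϑ : ℝ) (hA : 0 < A) (hβ : 1 ≤ β) (hρ : ρ ∈ Ioo (0 : ℝ) 1)
    (hR : 1 ≤ R) (hϑ : ϑ ∈ Ioo (0 : ℝ) 1)
    (hκ : κ = min (min (1 - ϑ) ((1 - ϑ) * ((n : ℝ) - 1 + 2 * α) / (3 * (1 - α))))
      (min ς (1 / (lamₗ + 1)))) :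
    ∃ S₀ C : ℝ, 0 < C ∧
      ∀ s₀ : ℝ, S₀ ≤ s₀ →
      ∀ g : ℝ → ℝ, ContinuousOn g (Ioi 0) →
        (∀ y : ℝ, 0 < y →
          |g y| ≤ A * Real.exp (-lamₗ * s₀) * (y ^ α + y ^ (2 * lamₗ + 1))) →
        (∀ y : ℝ, (β + 1) * Real.exp (-σₗ * s₀) ≤ y → y ≤ ρ * Real.exp (s₀ / 2) - 1 →
          |g y| ≤ A * Real.exp (-(1 + ς) * lamₗ * s₀) * (y ^ α + y ^ (2 * lamₗ + 1))) →
        ∀ s : ℝ, s₀ < s → s ≤ s₀ + 1 →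
        ∀ y : ℝ, (1 / 2) * Real.exp (-ϑ * σₗ * s) ≤ y → y ≤ 2 * R →
          |∫ z in Ioi (0 : ℝ), K y z (s - s₀) * g z|
            ≤ C * Real.exp (-(1 + κ) * lamₗ * s₀) * y ^ α := by
  obtain ⟨hα2, hα1⟩ : -2 ≤ α ∧ α < -1 := by
    rw [hα]
    exact alpha_bounds (by exact_mod_cast hn)
  have hγ0 : 0 ≤ γ := by
    rw [hγ, hα]
    linarith [Real.sqrt_nonneg ((n : ℝ) ^ 2 - 10 * (n : ℝ) + 17)]
  have hγ2 : (n : ℝ) - 1 + 2 * α = 2 * γ + 2 := by rw [hγ]; ring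
  have hl' : (2 : ℝ) ≤ l := by exact_mod_cast hl
  have hlam : 0 < lamₗ := by rw [hlamₗ]; linarith
  have hexpo : 2 * lamₗ + 1 = α + 2 * l := by rw [hlamₗ]; ring
  have hα0 : 0 < 1 - α := by linarith
  have hσ0 : 0 < σₗ := by rw [hσ]; positivity
  obtain ⟨hϑ0, hϑ1⟩ := hϑ
  obtain ⟨hρ0, -⟩ := hρ
  have hϑ' : 0 < 1 - ϑ := by linarith
  have hκς : κ ≤ ς := by
    rw [hκ]
    exact (min_le_right _ _).trans (min_le_left _ _)
  have hκ1 : κ * lamₗ ≤ 1 := by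
    have h : κ ≤ 1 / (lamₗ + 1) := by
      rw [hκ]
      exact (min_le_right _ _).trans (min_le_right _ _)
    calc κ * lamₗ ≤ 1 / (lamₗ + 1) * lamₗ := by gcongr
      _ ≤ 1 := by
        rw [one_div_mul_eq_div, div_le_one (by positivity)]
        linarith
  have hκσ : κ * lamₗ ≤ (1 - ϑ) * σₗ * (2 * γ + 2) := by
    have h : κ ≤ (1 - ϑ) * (2 * γ + 2) / (3 * (1 - α)) := by
      rw [hκ, ← hγ2]
      exact (min_le_left _ _).trans (min_le_right _ _)
    calc κ * lamₗ ≤ (1 - ϑ) * (2 * γ + 2) / (3 * (1 - α)) * lamₗ := by gcongr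
      _ = (1 - ϑ) * σₗ * (2 * γ + 2) / 3 := by
        rw [hσ]
        field_simp
      _ ≤ (1 - ϑ) * σₗ * (2 * γ + 2) := div_le_self (by positivity) (by norm_num)
  have hbessel : Iγ = besselI γ := funext hI
  have hKrad : ∀ y z s : ℝ, 0 < y → 0 < z → K y z s =
      radialKernel γ α (Real.exp (((n : ℝ) - 1) * s / 4)) (1 - Real.exp (-s))
        (Real.exp (-s / 2)) y z := by
    intro y z s hy hz
    rw [hK, hbessel, div_rpow_mul_sqrt (q := γ + 1 - α) hy hz (by rw [hγ]; ring),
      show 1 - (γ + 1 - α) = α - γ by ring, radialKernel, ← Real.exp_nat_mul]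
    congr 1
    · congr 2
      generalize 1 - Real.exp (-s) = τ
      ring
    · congr 6
      push_cast
      ring
  obtain ⟨B, hB, hmain⟩ := exists_abs_integral_radialKernel_mul_le α hγ0
  set D : ℝ := 2 * (β + 1) * Real.exp (1 / 2 + ϑ * σₗ) with hD
  have hD0 : 0 < D := by positivity
  set F : ℝ := A * (1 + l.factorial * 8 ^ l) +
    A * (2 * ((l + 1).factorial * 8 ^ (l + 1)) * (4 / ρ ^ 2)) with hF
  have hF0 : 0 < F := by positivity
  obtain ⟨S, hS⟩ := Filter.eventually_atTop.1
    (((eventually_mul_exp_neg_mul_le (β + 1) hσ0 one_pos).and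
      (eventually_mul_exp_neg_mul_le D (mul_pos hϑ' hσ0) one_half_pos)).and
      ((eventually_mul_exp_neg_mul_le 1 one_half_pos (half_pos hρ0)).and
        (Filter.eventually_ge_atTop 0)))
  set c₁ : ℝ := Real.exp (((n : ℝ) - 1) / 4) with hc₁
  refine ⟨S, B * c₁ * (F * Real.exp ((2 * R) ^ 2 / 4) + 2 * A * D ^ (2 * γ + 2)),
    by positivity, ?_⟩
  intro s₀ hs₀ g _ hg hgmid s hs hs1 y hylow hyhigh
  obtain ⟨⟨hδ1, hDhalf⟩, hρS, hs₀0⟩ := hS s₀ hs₀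
  have hn' : (8 : ℝ) ≤ n := by exact_mod_cast hn
  have hy : 0 < y := lt_of_lt_of_le (by positivity) hylow
  set t : ℝ := s - s₀ with ht
  have ht0 : 0 < t := by linarith
  have ht1 : t ≤ 1 := by linarith
  set δ : ℝ := (β + 1) * Real.exp (-σₗ * s₀) with hδ
  have hδ0 : 0 < δ := by positivity
  set η : ℝ := Real.exp (-t / 2) with hη
  have hη0 : 0 < η := Real.exp_pos _
  have hδη : δ / (η * y) ≤ D * Real.exp (-((1 - ϑ) * σₗ) * s₀) := by
    have hlow : Real.exp (-(1 / 2)) * (1 / 2 * Real.exp (-ϑ * σₗ * (s₀ + 1))) ≤ η * y := by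
      refine mul_le_mul ?_ (le_trans ?_ hylow) (by positivity) hη0.le
      · exact Real.exp_le_exp.2 (by linarith)
      · have : ϑ * σₗ * s ≤ ϑ * σₗ * (s₀ + 1) := by gcongr
        gcongr ?_ * Real.exp ?_
        linarith
    rw [div_le_iff₀ (by positivity)]
    calc δ = D * Real.exp (-((1 - ϑ) * σₗ) * s₀) *
          (Real.exp (-(1 / 2)) * (1 / 2 * Real.exp (-ϑ * σₗ * (s₀ + 1)))) := by
          have e : Real.exp (-σₗ * s₀) = Real.exp (1 / 2 + ϑ * σₗ) *
              Real.exp (-((1 - ϑ) * σₗ) * s₀) *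
              (Real.exp (-(1 / 2)) * Real.exp (-ϑ * σₗ * (s₀ + 1))) := by
            rw [← Real.exp_add, ← Real.exp_add, ← Real.exp_add]
            congr 1
            ring
          rw [hδ, hD, e]
          ring
      _ ≤ _ := by gcongr
  have hδy : δ ≤ η * y / 2 := by
    have h := hδη.trans hDhalf
    rw [div_le_iff₀ (by positivity)] at h
    linarith
  set M : ℝ := ρ * Real.exp (s₀ / 2) - 1 with hM
  have hρM : 2 ≤ ρ * Real.exp (s₀ / 2) := by
    have h : Real.exp (-(1 / 2) * s₀) * Real.exp (s₀ / 2) = 1 := by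
      rw [← Real.exp_add, Real.exp_eq_one_iff]
      ring
    have h' : 1 * Real.exp (-(1 / 2) * s₀) * Real.exp (s₀ / 2) ≤
        ρ / 2 * Real.exp (s₀ / 2) := by gcongr
    linarith
  have hM1 : 1 ≤ M := by linarith
  set E : ℝ := Real.exp (-(1 + κ) * lamₗ * s₀) with hE
  have hE0 : 0 < E := Real.exp_pos _
  have hEς : Real.exp (-(1 + ς) * lamₗ * s₀) ≤ E := by
    refine Real.exp_le_exp.2 ?_
    have : κ * (lamₗ * s₀) ≤ ς * (lamₗ * s₀) := by gcongr
    linarith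
  have hEM : Real.exp (-lamₗ * s₀) / M ^ 2 ≤ 4 / ρ ^ 2 * E := by
    have h1 : (ρ / 2 * Real.exp (s₀ / 2)) ^ 2 ≤ M ^ 2 :=
      pow_le_pow_left₀ (by positivity) (by linarith) 2
    have h2 : Real.exp (-lamₗ * s₀) * Real.exp (-s₀) ≤ E := by
      rw [← Real.exp_add, hE, Real.exp_le_exp]
      have : κ * lamₗ * s₀ ≤ 1 * s₀ := by gcongr
      linarith
    calc Real.exp (-lamₗ * s₀) / M ^ 2
        ≤ Real.exp (-lamₗ * s₀) / (ρ / 2 * Real.exp (s₀ / 2)) ^ 2 := by gcongr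
      _ = 4 / ρ ^ 2 * (Real.exp (-lamₗ * s₀) * Real.exp (-s₀)) := by
          rw [mul_pow, ← Real.exp_nat_mul, Real.exp_neg s₀,
            show ((2 : ℕ) : ℝ) * (s₀ / 2) = s₀ by push_cast; ring]
          field_simp
          norm_num
      _ ≤ _ := by gcongr
  have hfar : ∀ z, δ ≤ z → |g z| ≤ F * E * (z ^ α * Real.exp (z ^ 2 / 8)) := by
    intro z hz
    have hz0 : 0 < z := hδ0.trans_le hz
    set w : ℝ := z ^ α * Real.exp (z ^ 2 / 8) with hw
    have hw0 : 0 ≤ w := by positivity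
    rcases le_or_gt z M with h | h
    · calc |g z| ≤ A * Real.exp (-(1 + ς) * lamₗ * s₀) * (z ^ α + z ^ (2 * lamₗ + 1)) :=
            hgmid z hz h
        _ ≤ A * E * ((1 + l.factorial * 8 ^ l) * w) := by
            rw [hexpo]
            gcongr
            exact rpow_add_rpow_le_mul_exp hz0 l
        _ = A * (1 + l.factorial * 8 ^ l) * E * w := by ring
        _ ≤ F * E * w := by
            gcongr
            exact le_add_of_nonneg_right (by positivity)
    · calc |g z| ≤ A * Real.exp (-lamₗ * s₀) * (z ^ α + z ^ (2 * lamₗ + 1)) := hg z hz0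
        _ ≤ A * Real.exp (-lamₗ * s₀) *
              (2 * ((l + 1).factorial * 8 ^ (l + 1)) / M ^ 2 * w) := by
            rw [hexpo]
            gcongr
            exact rpow_add_rpow_le_div_sq_mul_exp hM1 h.le l
        _ = A * (2 * ((l + 1).factorial * 8 ^ (l + 1)) *
              (Real.exp (-lamₗ * s₀) / M ^ 2)) * w := by ring
        _ ≤ A * (2 * ((l + 1).factorial * 8 ^ (l + 1)) * (4 / ρ ^ 2 * E)) * w := by gcongr
        _ = A * (2 * ((l + 1).factorial * 8 ^ (l + 1)) * (4 / ρ ^ 2)) * E * w := by ring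
        _ ≤ F * E * w := by
            gcongr
            exact le_add_of_nonneg_left (by positivity)
  have hnear : ∀ z, 0 < z → z < δ → |g z| ≤ 2 * A * Real.exp (-lamₗ * s₀) * z ^ α := by
    intro z hz hzδ
    calc |g z| ≤ A * Real.exp (-lamₗ * s₀) * (z ^ α + z ^ (2 * lamₗ + 1)) := hg z hz
      _ ≤ A * Real.exp (-lamₗ * s₀) * (2 * z ^ α) := by
          rw [hexpo]
          gcongr
          exact rpow_add_rpow_le_two_mul hz (hzδ.le.trans hδ1) l
      _ = _ := by ring
  have hτ0 : 0 < 1 - Real.exp (-t) := by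
    linarith [Real.exp_lt_one_iff.2 (neg_lt_zero.2 ht0)]
  have h_int : ∫ z in Ioi (0 : ℝ), K y z t * g z = ∫ z in Ioi (0 : ℝ),
      radialKernel γ α (Real.exp (((n : ℝ) - 1) * t / 4)) (1 - Real.exp (-t)) η y z * g z :=
    setIntegral_congr_fun measurableSet_Ioi fun z hz ↦ by
      simp only [hKrad y z t hy hz, hη]
  have hbound := hmain (Real.exp (((n : ℝ) - 1) * t / 4)) (1 - Real.exp (-t)) η y δ (F * E)
    (2 * A * Real.exp (-lamₗ * s₀)) g (Real.exp_pos _).le hτ0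
    (by linarith [Real.exp_pos (-t)]) hη0 (Real.exp_le_one_iff.2 (by linarith)) hy hδ0 hδy
    (by positivity) (by positivity) hfar hnear
  have hc : Real.exp (((n : ℝ) - 1) * t / 4) ≤ c₁ := by
    refine Real.exp_le_exp.2 ?_
    gcongr
    exact mul_le_of_le_one_right (by linarith) ht1
  have hpow : Real.exp (-lamₗ * s₀) * (δ / (η * y)) ^ (2 * γ + 2) ≤ D ^ (2 * γ + 2) * E := by
    calc Real.exp (-lamₗ * s₀) * (δ / (η * y)) ^ (2 * γ + 2)
        ≤ Real.exp (-lamₗ * s₀) *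
            (D * Real.exp (-((1 - ϑ) * σₗ) * s₀)) ^ (2 * γ + 2) := by gcongr
      _ = D ^ (2 * γ + 2) * Real.exp (-lamₗ * s₀ + -((1 - ϑ) * σₗ) * s₀ * (2 * γ + 2)) := by
          rw [Real.mul_rpow hD0.le (Real.exp_pos _).le, ← Real.exp_mul, Real.exp_add]
          ring
      _ ≤ D ^ (2 * γ + 2) * E := by
          have : κ * lamₗ * s₀ ≤ (1 - ϑ) * σₗ * (2 * γ + 2) * s₀ := by gcongr
          refine mul_le_mul_of_nonneg_left (Real.exp_le_exp.2 ?_) (by positivity)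
          linarith
  rw [h_int]
  calc _ ≤ _ := hbound
    _ = B * Real.exp (((n : ℝ) - 1) * t / 4) * y ^ α * (F * E * Real.exp (y ^ 2 / 4) +
          2 * A * (Real.exp (-lamₗ * s₀) * (δ / (η * y)) ^ (2 * γ + 2))) := by ring
    _ ≤ B * c₁ * y ^ α * (F * E * Real.exp ((2 * R) ^ 2 / 4) +
          2 * A * (D ^ (2 * γ + 2) * E)) := by gcongr
    _ = _ := by ring
end
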